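/- arXiv:2011.04809 — 3 statements merged into one kernel-verified Lean document; each statement's English description precedes it below -/
import Mathlib

section
/- Fix an integer k ≥ 3 and a real r* > 0. If the liminf as n → ∞ of the probability that H_k(n, ⌈r*n⌉) is 2-colorable is strictly positive, then for every real r with 0 < r < r*, the probability that H_k(n, ⌈rn⌉) is 2-colorable tends to 1 as n → ∞. -/
open Filter Real

/-- A multi-hypergraph given as a tuple of `m` edges, each a `k`-element subset of
`{1,…,n}` (modeled as `Fin n`), is 2-colorable if there is a 2-coloring of the
vertices under which no edge is monochromatic. -/
def IsTwoColorable {n k m : ℕ} (E : Fin m → {s : Finset (Fin n) // s.card = k}) : Prop :=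
  ∃ c : Fin n → Bool, ∀ i : Fin m, ∃ u ∈ (E i).1, ∃ v ∈ (E i).1, c u ≠ c v

/-- The probability that the random `k`-uniform hypergraph `H_k(n,m)`, whose `m` edges
are chosen uniformly, independently and with replacement from all `C(n,k)` possible
`k`-subsets of the vertex set, is 2-colorable. -/
noncomputable def probTwoColorable (k n m : ℕ) : ℝ :=
  (Nat.card {E : Fin m → {s : Finset (Fin n) // s.card = k} // IsTwoColorable E} : ℝ) /
    ((n.choose k : ℝ) ^ m)

namespace Frd
open Finset
set_option linter.unusedSectionVars false
set_option linter.unusedSimpArgs false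

section ops
variable {ι Ω : Type} [Fintype ι] [DecidableEq ι] [Fintype Ω] [DecidableEq Ω]

/-- Tensor-product operator with coordinate kernels `M i`. -/
noncomputable def op (M : ι → Matrix Ω Ω ℝ) (f : (ι → Ω) → ℝ) : (ι → Ω) → ℝ :=
  fun x => ∑ y, (∏ i, M i (x i) (y i)) * f y

lemma op_op (M N : ι → Matrix Ω Ω ℝ) (f : (ι → Ω) → ℝ) :
    op M (op N f) = op (fun i => M i * N i) f := by
  funext x
  simp only [op, Finset.mul_sum]
  rw [Finset.sum_comm]
  refine Finset.sum_congr rfl fun z _ => ?_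
  simp only [Matrix.mul_apply, ← mul_assoc, ← Finset.sum_mul, ← Finset.prod_mul_distrib]
  congr 1
  rw [Finset.prod_univ_sum, Fintype.piFinset_univ]

lemma op_add (M : ι → Matrix Ω Ω ℝ) (f g : (ι → Ω) → ℝ) :
    op M (f + g) = op M f + op M g := by
  funext x
  simp [op, mul_add, Finset.sum_add_distrib]

lemma op_sub (M : ι → Matrix Ω Ω ℝ) (f g : (ι → Ω) → ℝ) :
    op M (f - g) = op M f - op M g := by
  funext x
  simp [op, mul_sub, Finset.sum_sub_distrib]

lemma op_smul (M : ι → Matrix Ω Ω ℝ) (c : ℝ) (f : (ι → Ω) → ℝ) :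
    op M (c • f) = c • op M f := by
  funext x
  simp only [op, Pi.smul_apply, smul_eq_mul, Finset.mul_sum]
  refine Finset.sum_congr rfl fun z _ => by ring

lemma op_adj (M : ι → Matrix Ω Ω ℝ) (f g : (ι → Ω) → ℝ) :
    ∑ x, f x * op M g x = ∑ x, op (fun i => (M i).transpose) f x * g x := by
  simp only [op, Finset.mul_sum, Finset.sum_mul, Matrix.transpose_apply]
  rw [Finset.sum_comm]
  refine Finset.sum_congr rfl fun z _ => Finset.sum_congr rfl fun y _ => by ring

/-- apply the kernel `A` on the coordinates in `s`. -/
noncomputable def opS (s : Finset ι) (A : Matrix Ω Ω ℝ) (f : (ι → Ω) → ℝ) : (ι → Ω) → ℝ :=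
  op (fun i => if i ∈ s then A else 1) f

lemma opS_single (i : ι) (A : Matrix Ω Ω ℝ) (f : (ι → Ω) → ℝ) (x : ι → Ω) :
    opS {i} A f x = ∑ w, A (x i) w * f (Function.update x i w) := by
  unfold opS op
  symm
  refine Finset.sum_of_injOn (fun w => Function.update x i w) ?_ (by simp) ?_ ?_
  · intro a _ b _ h
    have := congrFun h i
    simpa using this
  · intro y _ hy
    have : ∃ j, j ≠ i ∧ x j ≠ y j := by
      by_contra hcon
      push Not at hcon
      apply hy
      refine ⟨y i, by simp, ?_⟩
      funext j
      by_cases hj : j = i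
      · subst hj; simp
      · simp [hj, hcon j hj]
    obtain ⟨j, hj, hxy⟩ := this
    rw [Finset.prod_eq_zero (Finset.mem_univ j), zero_mul]
    simp [hj, Matrix.one_apply, hxy]
  · intro w _
    congr 1
    rw [Finset.prod_eq_single i]
    · simp
    · intro j _ hj
      simp only [Function.update_of_ne hj]
      simp [hj]
    · simp

lemma opS_congr_op {M : ι → Matrix Ω Ω ℝ} {s : Finset ι} {A : Matrix Ω Ω ℝ}
    (h : ∀ i, M i = if i ∈ s then A else 1) (f : (ι → Ω) → ℝ) : op M f = opS s A f := by
  unfold opS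
  congr 1
  funext i; exact h i

lemma opS_opS (s : Finset ι) (A B : Matrix Ω Ω ℝ) (f : (ι → Ω) → ℝ) :
    opS s A (opS s B f) = opS s (A * B) f := by
  conv_lhs => unfold opS
  rw [op_op]
  apply opS_congr_op
  intro i
  by_cases h : i ∈ s <;> simp [h]

lemma opS_disj_union {s t : Finset ι} (h : Disjoint s t) (A : Matrix Ω Ω ℝ) (f : (ι → Ω) → ℝ) :
    opS s A (opS t A f) = opS (s ∪ t) A f := by
  conv_lhs => unfold opS
  rw [op_op]
  apply opS_congr_op
  intro i
  have hd : i ∈ s → i ∉ t := fun hh => Finset.disjoint_left.1 h hh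
  by_cases hs : i ∈ s <;> by_cases ht : i ∈ t <;> simp_all

lemma opS_comm (s t : Finset ι) (A B : Matrix Ω Ω ℝ) (h : A * B = B * A) (f : (ι → Ω) → ℝ) :
    opS s A (opS t B f) = opS t B (opS s A f) := by
  unfold opS
  rw [op_op, op_op]
  congr 1
  funext i
  by_cases hs : i ∈ s <;> by_cases ht : i ∈ t <;> simp [hs, ht, h]

lemma opS_comm_disj {s t : Finset ι} (h : Disjoint s t) (A B : Matrix Ω Ω ℝ) (f : (ι → Ω) → ℝ) :
    opS s A (opS t B f) = opS t B (opS s A f) := by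
  unfold opS
  rw [op_op, op_op]
  congr 1
  funext i
  have hd : i ∈ s → i ∉ t := fun hh => Finset.disjoint_left.1 h hh
  by_cases hs : i ∈ s <;> by_cases ht : i ∈ t <;> simp_all

lemma opS_insert {i : ι} {s : Finset ι} (h : i ∉ s) (A : Matrix Ω Ω ℝ) (f : (ι → Ω) → ℝ) :
    opS (insert i s) A f = opS {i} A (opS s A f) := by
  rw [opS_disj_union (by simpa using h)]; rfl

lemma opS_insert' {i : ι} {s : Finset ι} (h : i ∉ s) (A : Matrix Ω Ω ℝ) (f : (ι → Ω) → ℝ) :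
    opS (insert i s) A f = opS s A (opS {i} A f) := by
  rw [opS_insert h, opS_comm_disj (by simpa using h)]

lemma opS_empty (A : Matrix Ω Ω ℝ) (f : (ι → Ω) → ℝ) : opS ∅ A f = f := by
  funext x
  unfold opS op
  rw [Finset.sum_eq_single x]
  · simp
  · intro y _ hy
    obtain ⟨j, hj⟩ := Function.ne_iff.1 hy
    rw [Finset.prod_eq_zero (Finset.mem_univ j), zero_mul]
    simp [Matrix.one_apply, hj.symm]
  · simp

lemma opS_add (s : Finset ι) (A : Matrix Ω Ω ℝ) (f g : (ι → Ω) → ℝ) :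
    opS s A (f + g) = opS s A f + opS s A g := op_add _ _ _
lemma opS_sub (s : Finset ι) (A : Matrix Ω Ω ℝ) (f g : (ι → Ω) → ℝ) :
    opS s A (f - g) = opS s A f - opS s A g := op_sub _ _ _
lemma opS_smul (s : Finset ι) (A : Matrix Ω Ω ℝ) (c : ℝ) (f : (ι → Ω) → ℝ) :
    opS s A (c • f) = c • opS s A f := op_smul _ _ _

/-- Averaging kernel. -/
noncomputable def Jm : Matrix Ω Ω ℝ := fun _ _ => (Fintype.card Ω : ℝ)⁻¹
/-- Noise kernel. -/
noncomputable def Tm (ρ : ℝ) : Matrix Ω Ω ℝ := ρ • (1 : Matrix Ω Ω ℝ) + (1 - ρ) • Jm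
/-- Laplacian kernel. -/
noncomputable def Dm : Matrix Ω Ω ℝ := 1 - Jm
/-- Evaluation kernel. -/
def Pm (w : Ω) : Matrix Ω Ω ℝ := fun _ b => if b = w then 1 else 0

lemma opS_P (i : ι) (w : Ω) (f : (ι → Ω) → ℝ) (x : ι → Ω) :
    opS {i} (Pm w) f x = f (Function.update x i w) := by
  rw [opS_single]; simp [Pm]

variable [Nonempty Ω]

lemma cardne : (Fintype.card Ω : ℝ) ≠ 0 := by
  exact_mod_cast Fintype.card_ne_zero

lemma J_mul_J : (Jm : Matrix Ω Ω ℝ) * Jm = Jm := by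
  ext a b
  have := cardne (Ω := Ω)
  simp [Matrix.mul_apply, Jm]

lemma T_mul_T (ρ τ : ℝ) : (Tm ρ : Matrix Ω Ω ℝ) * Tm τ = Tm (ρ * τ) := by
  unfold Tm
  simp only [mul_add, add_mul, Matrix.smul_mul, Matrix.mul_smul, mul_one, one_mul, J_mul_J]
  module

lemma T_mul_D (ρ : ℝ) : (Tm ρ : Matrix Ω Ω ℝ) * Dm = ρ • Dm := by
  unfold Tm Dm
  simp only [mul_sub, add_mul, Matrix.smul_mul, mul_one, one_mul, J_mul_J]
  module

lemma D_mul_T (ρ : ℝ) : (Dm : Matrix Ω Ω ℝ) * Tm ρ = ρ • Dm := by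
  unfold Tm Dm
  simp only [sub_mul, mul_add, Matrix.mul_smul, mul_one, one_mul, J_mul_J]
  module

lemma D_mul_D : (Dm : Matrix Ω Ω ℝ) * Dm = Dm := by
  unfold Dm
  simp only [mul_sub, sub_mul, mul_one, one_mul, J_mul_J]
  module

lemma J_mul_T (ρ : ℝ) : (Jm : Matrix Ω Ω ℝ) * Tm ρ = Jm := by
  unfold Tm
  simp only [mul_add, Matrix.mul_smul, mul_one, J_mul_J]
  module

lemma T_zero : (Tm 0 : Matrix Ω Ω ℝ) = Jm := by simp [Tm]

lemma J_tr : (Jm : Matrix Ω Ω ℝ).transpose = Jm := by ext; simp [Jm]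
lemma T_tr (ρ : ℝ) : (Tm ρ : Matrix Ω Ω ℝ).transpose = Tm ρ := by
  simp [Tm, J_tr]
lemma D_tr : (Dm : Matrix Ω Ω ℝ).transpose = Dm := by
  simp [Dm, J_tr]

lemma opS_adj (s : Finset ι) (A : Matrix Ω Ω ℝ) (hA : A.transpose = A) (f g : (ι → Ω) → ℝ) :
    ∑ x, f x * opS s A g x = ∑ x, opS s A f x * g x := by
  unfold opS
  rw [op_adj]
  refine Finset.sum_congr rfl fun x _ => ?_
  congr 3
  funext i
  by_cases h : i ∈ s <;> simp [h, hA]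

lemma single_J (i : ι) (f : (ι → Ω) → ℝ) (x : ι → Ω) :
    opS {i} Jm f x = (Fintype.card Ω : ℝ)⁻¹ * ∑ w, f (Function.update x i w) := by
  rw [opS_single, Finset.mul_sum]; rfl

lemma single_T (i : ι) (ρ : ℝ) (f : (ι → Ω) → ℝ) (x : ι → Ω) :
    opS {i} (Tm ρ) f x = ρ * f x + (1 - ρ) * opS {i} Jm f x := by
  rw [opS_single, opS_single, Finset.mul_sum]
  simp only [Tm, Matrix.add_apply, Matrix.smul_apply, smul_eq_mul, add_mul,
    Finset.sum_add_distrib, mul_assoc]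
  congr 1
  rw [Finset.sum_eq_single (x i)]
  · simp
  · intro b _ hb; simp [Matrix.one_apply, hb.symm]
  · simp

lemma single_D (i : ι) (f : (ι → Ω) → ℝ) (x : ι → Ω) :
    opS {i} Dm f x = f x - opS {i} Jm f x := by
  rw [opS_single, opS_single]
  simp only [Dm, Matrix.sub_apply, sub_mul, Finset.sum_sub_distrib]
  congr 1
  rw [Finset.sum_eq_single (x i)]
  · simp
  · intro b _ hb; simp [Matrix.one_apply, hb.symm]
  · simp

/-- positivity of a kernel -/
lemma opS_mono (s : Finset ι) (A : Matrix Ω Ω ℝ) (hA : ∀ a b, 0 ≤ A a b) {f g : (ι → Ω) → ℝ}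
    (h : ∀ x, f x ≤ g x) (x : ι → Ω) : opS s A f x ≤ opS s A g x := by
  unfold opS op
  refine Finset.sum_le_sum fun y _ => mul_le_mul_of_nonneg_left (h y) ?_
  refine Finset.prod_nonneg fun i _ => ?_
  by_cases hi : i ∈ s
  · simp [hi, hA]
  · simp only [hi, if_false, Matrix.one_apply]; split_ifs <;> simp

lemma J_nonneg (a b : Ω) : (0:ℝ) ≤ Jm a b := by unfold Jm; positivity
lemma T_nonneg {ρ : ℝ} (h0 : 0 ≤ ρ) (h1 : ρ ≤ 1) (a b : Ω) : (0:ℝ) ≤ Tm ρ a b := by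
  simp only [Tm, Matrix.add_apply, Matrix.smul_apply, smul_eq_mul, Matrix.one_apply]
  have := J_nonneg a b
  have h2 : 0 ≤ 1 - ρ := by linarith
  split_ifs <;> positivity

lemma opS_J_const (s : Finset ι) (c : ℝ) : opS s (Jm : Matrix Ω Ω ℝ) (fun _ => c) = fun _ => c := by
  induction s using Finset.induction_on with
  | empty => rw [opS_empty]
  | insert i s hi ih =>
    rw [opS_insert hi, ih]
    funext x
    rw [single_J]
    have := cardne (Ω := Ω)
    simp [this]

lemma opS_T_const (s : Finset ι) (ρ c : ℝ) :
    opS s (Tm ρ : Matrix Ω Ω ℝ) (fun _ => c) = fun _ => c := by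
  induction s using Finset.induction_on with
  | empty => rw [opS_empty]
  | insert i s hi ih =>
    rw [opS_insert hi, ih]
    funext x
    rw [single_T, opS_J_const]
    ring

lemma sum_J (s : Finset ι) (f : (ι → Ω) → ℝ) : ∑ x, opS s Jm f x = ∑ x, f x := by
  have := opS_adj s Jm J_tr (fun _ => (1:ℝ)) f
  rw [opS_J_const] at this
  simpa using this

lemma sum_T (s : Finset ι) (ρ : ℝ) (f : (ι → Ω) → ℝ) : ∑ x, opS s (Tm ρ) f x = ∑ x, f x := by
  have := opS_adj s (Tm ρ) (T_tr ρ) (fun _ => (1:ℝ)) f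
  rw [opS_T_const] at this
  simpa using this

lemma opS_J_eq (s : Finset ι) (f : (ι → Ω) → ℝ) (x : ι → Ω) :
    opS s Jm f x = (∑ y, f (s.piecewise y x)) / Fintype.card (ι → Ω) := by
  have hc : (Fintype.card (ι → Ω) : ℝ) ≠ 0 := cardne
  rw [eq_div_iff hc]
  induction s using Finset.induction_on generalizing x with
  | empty => simp [opS_empty]; ring
  | insert i s hi ih =>
    rw [opS_insert hi, single_J]
    rw [mul_assoc, Finset.sum_mul]
    simp only [ih]
    rw [Finset.sum_comm]
    have key : ∀ w : Ω, ∀ y : ι → Ω, s.piecewise y (Function.update x i w)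
        = (insert i s).piecewise (Function.update y i w) x := by
      intro w y
      funext j
      by_cases hj : j = i
      · subst hj; simp [hi]
      · by_cases hs : j ∈ s <;> simp [hj, hs, Finset.piecewise]
    simp only [key]
    have h2 := sum_J {i} (fun y => f ((insert i s).piecewise y x))
    rw [← h2]
    simp only [single_J]
    rw [Finset.mul_sum]

lemma opS_J_univ (f : (ι → Ω) → ℝ) (x : ι → Ω) :
    opS univ Jm f x = (∑ y, f y) / Fintype.card (ι → Ω) := by
  rw [opS_J_eq]; simp

lemma opS_abs (s : Finset ι) (A : Matrix Ω Ω ℝ) (hA : ∀ a b, 0 ≤ A a b) (f : (ι → Ω) → ℝ)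
    (x : ι → Ω) : |opS s A f x| ≤ opS s A (fun y => |f y|) x := by
  rw [abs_le]
  constructor
  · have := opS_mono s A hA (f := (-1:ℝ) • (fun y => |f y|)) (g := f)
      (fun y => by simpa using neg_abs_le (f y)) x
    rw [opS_smul] at this
    simpa using this
  · exact opS_mono s A hA (fun y => le_abs_self _) x

lemma T_sq (s : Finset ι) {ρ : ℝ} (h0 : 0 ≤ ρ) (h1 : ρ ≤ 1) (f : (ι → Ω) → ℝ) (x : ι → Ω) :
    (opS s (Tm ρ) f x) ^ 2 ≤ opS s (Tm ρ) (fun y => f y ^ 2) x := by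
  set c := opS s (Tm ρ) f x with hc
  have h := opS_mono s (Tm ρ) (T_nonneg h0 h1) (f := fun _ => 0)
    (g := (fun y => f y ^ 2) - (2 * c) • f + (fun _ => c ^ 2))
    (fun y => by simp only [Pi.add_apply, Pi.sub_apply, Pi.smul_apply, smul_eq_mul]
                 nlinarith [sq_nonneg (f y - c)]) x
  rw [opS_T_const, opS_add, opS_sub, opS_smul, opS_T_const] at h
  simp only [Pi.add_apply, Pi.sub_apply, Pi.smul_apply, smul_eq_mul, ← hc] at h
  nlinarith

lemma T_contr (s : Finset ι) {ρ : ℝ} (h0 : 0 ≤ ρ) (h1 : ρ ≤ 1) (f : (ι → Ω) → ℝ) :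
    ∑ x, (opS s (Tm ρ) f x) ^ 2 ≤ ∑ x, f x ^ 2 := by
  rw [← sum_T s ρ (fun y => f y ^ 2)]
  exact Finset.sum_le_sum fun x _ => T_sq s h0 h1 f x

end ops
end Frd

namespace Frd
open Finset
set_option linter.unusedSectionVars false
set_option linter.unusedSimpArgs false

section hyp
variable {ι Ω : Type} [Fintype ι] [DecidableEq ι] [Fintype Ω] [DecidableEq Ω] [Nonempty Ω]

lemma hyper_1d {Z : Type} [Fintype Z] (w : Z → ℝ) (hw : ∀ z, 0 ≤ w z) (a : Z → ℝ)
    (g : Z → Ω → ℝ) (hg : ∀ z, ∑ o, g z o = 0) {σ : ℝ} (h0 : 0 ≤ σ) (h1 : σ ≤ 1 / 4) :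
    (Fintype.card Ω : ℝ)⁻¹ * ∑ o, (∑ z, w z * (a z + σ * g z o) ^ 2) ^ 2 ≤
      ((Fintype.card Ω : ℝ)⁻¹ * ∑ o, ∑ z, w z * (a z + g z o) ^ 2) ^ 2 +
        (1 / 64) * ((Fintype.card Ω : ℝ)⁻¹ * ∑ o, (∑ z, w z * (g z o) ^ 2) ^ 2) := by
  set A := ∑ z, w z * a z ^ 2 with hA
  set B : Ω → ℝ := fun o => ∑ z, w z * (a z * g z o) with hB
  set G : Ω → ℝ := fun o => ∑ z, w z * (g z o) ^ 2 with hG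
  set N := (Fintype.card Ω : ℝ) with hN
  have hN0 : N ≠ 0 := cardne
  have hNpos : 0 < N := by positivity
  have hA0 : 0 ≤ A := Finset.sum_nonneg fun z _ => mul_nonneg (hw z) (sq_nonneg _)
  have hG0 : ∀ o, 0 ≤ G o := fun o => Finset.sum_nonneg fun z _ => mul_nonneg (hw z) (sq_nonneg _)
  have hBs : ∑ o, B o = 0 := by
    simp only [hB]
    rw [Finset.sum_comm]
    apply Finset.sum_eq_zero
    intro z _
    rw [← Finset.mul_sum, ← Finset.mul_sum, hg z]; simp
  have hcs : ∀ o, B o ^ 2 ≤ A * G o := by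
    intro o
    apply Finset.sum_sq_le_sum_mul_sum_of_sq_le_mul
    · intro z _; exact mul_nonneg (hw z) (sq_nonneg _)
    · intro z _; exact mul_nonneg (hw z) (sq_nonneg _)
    · intro z _; exact le_of_eq (by ring)
  have hexp : ∀ t : ℝ, ∀ o, ∑ z, w z * (a z + t * g z o) ^ 2 = A + 2 * t * B o + t ^ 2 * G o := by
    intro t o
    simp only [hA, hB, hG, Finset.mul_sum, ← Finset.sum_add_distrib]
    refine Finset.sum_congr rfl fun z _ => by ring
  have hexp1 : ∀ o, ∑ z, w z * (a z + g z o) ^ 2 = A + 2 * B o + G o := by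
    intro o
    have := hexp 1 o
    simpa using this
  simp only [hexp, hexp1]
  have hpt : ∀ o, (A + 2 * σ * B o + σ ^ 2 * G o) ^ 2 ≤
      A ^ 2 + 4 * σ * A * B o + 2 * A * G o + (1 / 64) * G o ^ 2 := by
    intro o
    have e1 := hcs o
    have e2 := hG0 o
    have hs2 : σ ^ 2 ≤ 1 / 16 := by nlinarith
    have hs4 : σ ^ 4 ≤ 1 / 256 := by nlinarith [sq_nonneg σ]
    have i1 : 4 * σ ^ 3 * (B o * G o) ≤ 2 * σ ^ 2 * B o ^ 2 + 2 * σ ^ 4 * G o ^ 2 := by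
      nlinarith [sq_nonneg (σ * B o - σ ^ 2 * G o)]
    have i2 : σ ^ 2 * B o ^ 2 ≤ (1/16) * (A * G o) :=
      mul_le_mul hs2 e1 (sq_nonneg _) (by norm_num)
    have i3 : σ ^ 4 * G o ^ 2 ≤ (1/256) * G o ^ 2 :=
      mul_le_mul_of_nonneg_right hs4 (sq_nonneg _)
    have i4 : σ ^ 2 * (A * G o) ≤ (1/16) * (A * G o) :=
      mul_le_mul_of_nonneg_right hs2 (mul_nonneg hA0 e2)
    have i5 : 0 ≤ A * G o := mul_nonneg hA0 e2
    have i6 : 0 ≤ G o ^ 2 := sq_nonneg _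
    have : (A + 2 * σ * B o + σ ^ 2 * G o) ^ 2 = A ^ 2 + 4 * σ * A * B o + 4 * (σ ^ 2 * B o ^ 2)
      + σ ^ 4 * G o ^ 2 + 2 * (σ ^ 2 * (A * G o)) + 4 * σ ^ 3 * (B o * G o) := by ring
    rw [this]
    linarith
  have hsum : ∑ o, (A + 2 * σ * B o + σ ^ 2 * G o) ^ 2 ≤
      N * A ^ 2 + 2 * A * ∑ o, G o + (1/64) * ∑ o, G o ^ 2 := by
    refine (Finset.sum_le_sum fun o _ => hpt o).trans (le_of_eq ?_)
    simp only [Finset.sum_add_distrib, ← Finset.mul_sum, hBs]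
    simp [hN]
  have hsum1 : ∑ o, (A + 2 * B o + G o) = N * A + ∑ o, G o := by
    simp only [Finset.sum_add_distrib, ← Finset.mul_sum, hBs]
    simp [hN]
  rw [hsum1]
  have hmul := mul_le_mul_of_nonneg_left hsum (inv_nonneg.2 hNpos.le)
  refine hmul.trans ?_
  have : N⁻¹ * (N * A ^ 2 + 2 * A * ∑ o, G o + (1/64) * ∑ o, G o ^ 2) =
     A ^ 2 + 2 * A * (N⁻¹ * ∑ o, G o) + (1/64) * (N⁻¹ * ∑ o, G o ^ 2) := by
    field_simp
  rw [this]
  have : N⁻¹ * (N * A + ∑ o, G o) = A + N⁻¹ * ∑ o, G o := by field_simp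
  rw [this]
  nlinarith [sq_nonneg (N⁻¹ * ∑ o, G o)]

lemma single_J_update (i : ι) (f : (ι → Ω) → ℝ) (x : ι → Ω) (o : Ω) :
    opS {i} Jm f (Function.update x i o) = opS {i} Jm f x := by
  simp [single_J]

lemma hyper_step {Z : Type} [Fintype Z] (w : Z → ℝ) (hw : ∀ z, 0 ≤ w z) (i : ι)
    (u : Z → (ι → Ω) → ℝ) {σ : ℝ} (h0 : 0 ≤ σ) (h1 : σ ≤ 1 / 4) :
    ∑ x, (∑ z, w z * (opS {i} (Tm σ) (u z) x) ^ 2) ^ 2 ≤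
      ∑ x, (opS {i} Jm (fun y => ∑ z, w z * (u z y) ^ 2) x) ^ 2 +
      (1 / 64) * ∑ x, (∑ z, w z * (opS {i} Dm (u z) x) ^ 2) ^ 2 := by
  rw [← sum_J {i} (fun x => (∑ z, w z * (opS {i} (Tm σ) (u z) x) ^ 2) ^ 2),
    ← sum_J {i} (fun x => (∑ z, w z * (opS {i} Dm (u z) x) ^ 2) ^ 2), Finset.mul_sum,
    ← Finset.sum_add_distrib]
  refine Finset.sum_le_sum fun x _ => ?_
  have hg : ∀ z, ∑ o, (u z (Function.update x i o) - opS {i} Jm (u z) x) = 0 := by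
    intro z
    rw [Finset.sum_sub_distrib, single_J]
    have := cardne (Ω := Ω)
    simp [this]
  have := hyper_1d w hw (fun z => opS {i} Jm (u z) x)
    (fun z o => u z (Function.update x i o) - opS {i} Jm (u z) x) hg h0 h1
  simp only [single_J i (fun x => (∑ z, w z * (opS {i} (Tm σ) (u z) x) ^ 2) ^ 2),
    single_J i (fun x => (∑ z, w z * (opS {i} Dm (u z) x) ^ 2) ^ 2),
    single_J i (fun y => ∑ z, w z * (u z y) ^ 2)]
  simp only [single_T, single_D, single_J_update]
  have r1 : ∀ a b : ℝ, σ * a + (1 - σ) * b = b + σ * (a - b) := fun a b => by ring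
  have r2 : ∀ a b : ℝ, b + (a - b) = a := fun a b => by ring
  simp only [r1]
  simp only [r2] at this
  exact this

theorem hyper (s : Finset ι) {σ : ℝ} (h0 : 0 ≤ σ) (h1 : σ ≤ 1 / 4) :
    ∀ {Z : Type} [Fintype Z] (w : Z → ℝ) (_ : ∀ z, 0 ≤ w z) (f : Z → (ι → Ω) → ℝ),
    ∑ x, (∑ z, w z * (opS s (Tm σ) (f z) x) ^ 2) ^ 2 ≤
      ∑ T ∈ s.powerset, (1 / 64 : ℝ) ^ T.card *
        ∑ x, (opS (s \ T) Jm (fun y => ∑ z, w z * (opS T Dm (f z) y) ^ 2) x) ^ 2 := by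
  induction s using Finset.induction_on with
  | empty =>
    intro Z _ w hw f
    simp [opS_empty]
  | insert i s hi ih =>
    intro Z _ w hw f
    simp only [opS_insert hi]
    refine (hyper_step w hw i (fun z => opS s (Tm σ) (f z)) h0 h1).trans ?_
    rw [Finset.sum_powerset_insert hi]
    apply add_le_add
    · have := ih (Z := Z × Ω) (fun p => w p.1 * (Fintype.card Ω : ℝ)⁻¹)
        (fun p => mul_nonneg (hw _) (by positivity)) (fun p => opS {i} (Pm p.2) (f p.1))
      have hx : ∀ (v : Z → (ι → Ω) → ℝ) (x : ι → Ω),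
          ∑ p : Z × Ω, w p.1 * (Fintype.card Ω : ℝ)⁻¹ * (opS {i} (Pm p.2) (v p.1) x) ^ 2 =
          opS {i} Jm (fun y => ∑ z, w z * (v z y) ^ 2) x := by
        intro v x
        rw [single_J, Fintype.sum_prod_type, Finset.sum_comm, Finset.mul_sum]
        refine Finset.sum_congr rfl fun o _ => ?_
        rw [Finset.mul_sum]
        refine Finset.sum_congr rfl fun z _ => ?_
        rw [opS_P]; ring
      have hdisj : Disjoint s {i} := by simpa using hi
      simp only [opS_comm_disj hdisj (Tm σ)] at this
      simp only [hx (fun z => opS s (Tm σ) (f z))] at this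
      refine this.trans (Finset.sum_le_sum fun T hT => ?_)
      have hTs := Finset.mem_powerset.1 hT
      have hiT : i ∉ T := fun h => hi (hTs h)
      have hdisjT : Disjoint T {i} := by simpa using hiT
      apply le_of_eq
      congr 1
      refine Finset.sum_congr rfl fun x _ => ?_
      congr 1
      simp only [opS_comm_disj hdisjT Dm]
      simp only [hx (fun z => opS T Dm (f z))]
      rw [Finset.insert_sdiff_of_notMem _ hiT, opS_insert' (by simp [hi])]
    · have := ih w hw (fun z => opS {i} Dm (f z))
      have hdisj : Disjoint {i} s := by simpa using hi
      simp only [opS_comm_disj hdisj Dm (Tm σ)]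
      refine (mul_le_mul_of_nonneg_left this (by norm_num)).trans (le_of_eq ?_)
      rw [Finset.mul_sum]
      refine Finset.sum_congr rfl fun T hT => ?_
      have hTs := Finset.mem_powerset.1 hT
      have hiT : i ∉ T := fun h => hi (hTs h)
      rw [Finset.card_insert_of_notMem hiT, pow_succ, ← mul_assoc, mul_comm (1/64 : ℝ)]
      congr 1
      refine Finset.sum_congr rfl fun x _ => ?_
      congr 1
      have : insert i s \ insert i T = s \ T := by
        ext j; by_cases hj : j = i
        · subst hj; simp [hi]
        · simp [hj]
      rw [this]
      simp only [opS_insert' hiT]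

lemma l2_step (i : ι) (f : (ι → Ω) → ℝ) {σ : ℝ} (h0 : 0 ≤ σ) (h1 : σ ≤ 1 / 4) :
    ∑ x, (opS {i} (Tm σ) f x) ^ 2 + ∑ x, (opS {i} Dm (opS {i} (Tm σ) f) x) ^ 2 ≤ ∑ x, f x ^ 2 := by
  have hD : ∀ x, opS {i} Dm (opS {i} (Tm σ) f) x = σ * opS {i} Dm f x := by
    intro x
    rw [opS_opS, D_mul_T]
    rw [opS_single, opS_single, Finset.mul_sum]
    refine Finset.sum_congr rfl fun o _ => ?_
    simp [mul_assoc]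
  simp only [hD]
  -- decompose
  have horth : ∑ x, opS {i} Jm f x * opS {i} Dm f x = 0 := by
    rw [opS_adj _ _ D_tr, opS_opS]
    have : (Dm : Matrix Ω Ω ℝ) * Jm = 0 := by simp [Dm, sub_mul, J_mul_J]
    rw [this]
    apply Finset.sum_eq_zero
    intro x _
    rw [opS_single]; simp
  have e1 : ∑ x, (opS {i} (Tm σ) f x) ^ 2 =
      ∑ x, (opS {i} Jm f x) ^ 2 + 2 * σ * ∑ x, opS {i} Jm f x * opS {i} Dm f x
        + σ ^ 2 * ∑ x, (opS {i} Dm f x) ^ 2 := by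
    simp only [Finset.mul_sum, ← Finset.sum_add_distrib]
    refine Finset.sum_congr rfl fun x _ => ?_
    rw [single_T, single_D]; ring
  have e2 : ∑ x, f x ^ 2 =
      ∑ x, (opS {i} Jm f x) ^ 2 + 2 * ∑ x, opS {i} Jm f x * opS {i} Dm f x
        + ∑ x, (opS {i} Dm f x) ^ 2 := by
    simp only [Finset.mul_sum, ← Finset.sum_add_distrib]
    refine Finset.sum_congr rfl fun x _ => ?_
    rw [single_D]; ring
  rw [e1, e2, horth]
  have : 0 ≤ ∑ x, (opS {i} Dm f x) ^ 2 := Finset.sum_nonneg fun x _ => sq_nonneg _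
  simp only [mul_pow, ← Finset.mul_sum]
  have hs : σ ^ 2 ≤ 1 / 16 := by nlinarith
  have := mul_le_mul_of_nonneg_right hs this
  linarith

theorem l2_bound (s : Finset ι) {σ : ℝ} (h0 : 0 ≤ σ) (h1 : σ ≤ 1 / 4) : ∀ (f : (ι → Ω) → ℝ),
    ∑ T ∈ s.powerset, ∑ x, (opS T Dm (opS s (Tm σ) f) x) ^ 2 ≤ ∑ x, f x ^ 2 := by
  induction s using Finset.induction_on with
  | empty => intro f; simp [opS_empty]
  | insert i s hi ih =>
    intro f
    rw [Finset.sum_powerset_insert hi]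
    refine le_trans (add_le_add ?_ ?_) (l2_step i f h0 h1)
    · rw [opS_insert' hi]; exact ih _
    · refine le_trans (le_of_eq ?_) (ih (opS {i} Dm (opS {i} (Tm σ) f)))
      refine Finset.sum_congr rfl fun T hT => ?_
      have hTs := Finset.mem_powerset.1 hT
      have hiT : i ∉ T := fun h => hi (hTs h)
      rw [opS_insert' hiT, opS_insert' hi]
      rw [opS_comm_disj (s := {i}) (t := s) (by simpa using hi)]

/-- hybrid / Efron–Stein bound -/
theorem hybrid (s : Finset ι) {ρ : ℝ} (h0 : 0 ≤ ρ) (h1 : ρ ≤ 1) (f : (ι → Ω) → ℝ) :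
    ∑ x, f x ^ 2 - ∑ x, f x * opS s (Tm ρ) f x ≤
      (1 - ρ) * ∑ i ∈ s, ∑ x, (opS {i} Dm f x) ^ 2 := by
  induction s using Finset.induction_on with
  | empty => simp [opS_empty, sq]
  | insert i s hi ih =>
    rw [Finset.sum_insert hi, mul_add]
    have e1 : ∀ x, opS (insert i s) (Tm ρ) f x =
        opS s (Tm ρ) f x - (1 - ρ) * opS {i} Dm (opS s (Tm ρ) f) x := by
      intro x
      rw [opS_insert hi, single_T, single_D]; ring
    have e2 : ∑ x, f x * opS {i} Dm (opS s (Tm ρ) f) x =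
        ∑ x, opS {i} Dm f x * opS s (Tm ρ) (opS {i} Dm f) x := by
      rw [← D_mul_D, ← opS_opS, opS_adj _ _ D_tr, D_mul_D,
        opS_comm_disj (s := {i}) (t := s) (by simpa using hi)]
    have e3 : ∑ x, opS {i} Dm f x * opS s (Tm ρ) (opS {i} Dm f) x ≤
        ∑ x, (opS {i} Dm f x) ^ 2 := by
      have c := T_contr s h0 h1 (opS {i} Dm f)
      have : ∑ x, opS {i} Dm f x * opS s (Tm ρ) (opS {i} Dm f) x ≤
        ∑ x, ((1/2) * (opS {i} Dm f x) ^ 2 + (1/2) * (opS s (Tm ρ) (opS {i} Dm f) x) ^ 2) :=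
        Finset.sum_le_sum fun x _ => by
          nlinarith [sq_nonneg (opS {i} Dm f x - opS s (Tm ρ) (opS {i} Dm f) x)]
      rw [Finset.sum_add_distrib, ← Finset.mul_sum, ← Finset.mul_sum] at this
      linarith
    have e4 : ∑ x, f x * opS (insert i s) (Tm ρ) f x = ∑ x, f x * opS s (Tm ρ) f x
        - (1 - ρ) * ∑ x, f x * opS {i} Dm (opS s (Tm ρ) f) x := by
      rw [Finset.mul_sum, ← Finset.sum_sub_distrib]
      refine Finset.sum_congr rfl fun x _ => ?_
      rw [e1]; ring
    rw [e4, e2]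
    have := mul_le_mul_of_nonneg_left e3 (by linarith : 0 ≤ 1 - ρ)
    linarith

end hyp
end Frd

namespace Frd
open Finset
set_option linter.unusedSectionVars false
set_option linter.unusedSimpArgs false

section ana
variable {ι Ω : Type} [Fintype ι] [DecidableEq ι] [Fintype Ω] [DecidableEq Ω] [Nonempty Ω]

lemma opS_sum {α : Type} (t : Finset α) (s : Finset ι) (A : Matrix Ω Ω ℝ)
    (f : α → (ι → Ω) → ℝ) (x : ι → Ω) :
    opS s A (fun y => ∑ a ∈ t, f a y) x = ∑ a ∈ t, opS s A (f a) x := by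
  unfold opS op
  rw [Finset.sum_comm]
  simp only [Finset.mul_sum]

lemma opS_smul_mat (s : Finset ι) (c : ℝ) (A : Matrix Ω Ω ℝ) (f : (ι → Ω) → ℝ) (x : ι → Ω) :
    opS s (c • A) f x = c ^ s.card * opS s A f x := by
  induction s using Finset.induction_on generalizing x with
  | empty => simp [opS_empty]
  | insert i s hi ih =>
    rw [opS_insert hi, opS_insert hi, opS_single, opS_single, Finset.card_insert_of_notMem hi,
      Finset.mul_sum]
    refine Finset.sum_congr rfl fun o _ => ?_
    rw [ih]
    simp only [Matrix.smul_apply, smul_eq_mul]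
    ring

lemma D_abs_le (U : Finset ι) (u : (ι → Ω) → ℝ) (x : ι → Ω) :
    |opS U Dm u x| ≤ ∑ A ∈ U.powerset, opS A Jm (fun y => |u y|) x := by
  induction U using Finset.induction_on generalizing x with
  | empty => simp [opS_empty]
  | insert i s hi ih =>
    rw [opS_insert hi, single_D, Finset.sum_powerset_insert hi]
    refine (abs_sub _ _).trans (add_le_add (ih x) ?_)
    refine (opS_abs _ _ J_nonneg _ _).trans ?_
    refine (opS_mono _ _ J_nonneg ih x).trans (le_of_eq ?_)
    rw [opS_sum]
    refine Finset.sum_congr rfl fun A hA => ?_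
    have hiA : i ∉ A := fun h => hi (Finset.mem_powerset.1 hA h)
    rw [opS_insert hiA]

lemma D_abs_le_two (U : Finset ι) (u : (ι → Ω) → ℝ) (hu : ∀ x, |u x| ≤ 1) (x : ι → Ω) :
    |opS U Dm u x| ≤ 2 ^ U.card := by
  refine (D_abs_le U u x).trans ?_
  have : ∀ A ∈ U.powerset, opS A Jm (fun y => |u y|) x ≤ 1 := by
    intro A _
    have := opS_mono A Jm J_nonneg (f := fun y => |u y|) (g := fun _ => 1) hu x
    rwa [opS_J_const] at this
  refine (Finset.sum_le_sum this).trans ?_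
  simp

/-- local second moment of the derivative along `U` -/
noncomputable def Q (σ : ℝ) (f : (ι → Ω) → ℝ) (U : Finset ι) : (ι → Ω) → ℝ :=
  opS (univ \ U) Jm (fun y => (opS U Dm (opS univ (Tm σ) f) y) ^ 2)

lemma T_range (f : (ι → Ω) → ℝ) (hf : ∀ x, 0 ≤ f x ∧ f x ≤ 1) {σ : ℝ} (h0 : 0 ≤ σ)
    (h1 : σ ≤ 1) (s : Finset ι) (x : ι → Ω) : 0 ≤ opS s (Tm σ) f x ∧ opS s (Tm σ) f x ≤ 1 := by
  have a := opS_mono s (Tm σ) (T_nonneg h0 h1) (f := fun _ => 0) (g := f) (fun x => (hf x).1) x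
  have b := opS_mono s (Tm σ) (T_nonneg h0 h1) (f := f) (g := fun _ => 1) (fun x => (hf x).2) x
  rw [opS_T_const] at a b
  exact ⟨a, b⟩

lemma Q_nonneg (σ : ℝ) (f : (ι → Ω) → ℝ) (U : Finset ι) (x : ι → Ω) : 0 ≤ Q σ f U x := by
  have a := opS_mono (univ \ U) Jm J_nonneg (f := fun _ => 0)
    (g := (fun y => (opS U Dm (opS univ (Tm σ) f) y) ^ 2)) (fun x => sq_nonneg _) x
  rwa [opS_J_const] at a

lemma Q_le (f : (ι → Ω) → ℝ) (hf : ∀ x, 0 ≤ f x ∧ f x ≤ 1) {σ : ℝ} (h0 : 0 ≤ σ)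
    (h1 : σ ≤ 1) (U : Finset ι) (x : ι → Ω) : Q σ f U x ≤ 4 ^ U.card := by
  have a := opS_mono (univ \ U) Jm J_nonneg
    (f := (fun y => (opS U Dm (opS univ (Tm σ) f) y) ^ 2)) (g := fun _ => 4 ^ U.card) ?_ x
  · rwa [opS_J_const] at a
  · intro y
    have := D_abs_le_two U (opS univ (Tm σ) f) (fun x => by
      have := T_range f hf h0 h1 univ x
      rw [abs_of_nonneg this.1]; exact this.2) y
    have e : (4:ℝ) ^ U.card = (2 ^ U.card) ^ 2 := by rw [← pow_mul, mul_comm, pow_mul]; norm_num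
    rw [e, ← sq_abs]
    gcongr

lemma D_T_comm (U : Finset ι) (s : Finset ι) (σ : ℝ) (f : (ι → Ω) → ℝ) :
    opS U Dm (opS s (Tm σ) f) = opS s (Tm σ) (opS U Dm f) := by
  apply opS_comm
  rw [D_mul_T, T_mul_D]

lemma Q_le_eps (f : (ι → Ω) → ℝ) (hf : ∀ x, 0 ≤ f x ∧ f x ≤ 1) {σ : ℝ} (h0 : 0 ≤ σ)
    (h1 : σ ≤ 1) (U : Finset ι) (x : ι → Ω) {ε : ℝ} (hε : 0 ≤ ε) (i : ι) (hi : i ∈ U)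
    (h : ∀ W ⊆ U, i ∈ W → opS (univ \ W) Jm (fun y => |opS {i} Dm f y|) x ≤ ε) :
    Q σ f U x ≤ 4 ^ U.card * ε := by
  -- first step
  have s1 : Q σ f U x ≤ 2 ^ U.card *
      opS (univ \ U) Jm (fun y => |opS U Dm (opS univ (Tm σ) f) y|) x := by
    have a := opS_mono (univ \ U) Jm J_nonneg
      (f := (fun y => (opS U Dm (opS univ (Tm σ) f) y) ^ 2))
      (g := ((2:ℝ) ^ U.card) • (fun y => |opS U Dm (opS univ (Tm σ) f) y|)) ?_ x
    · rw [opS_smul] at a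
      simpa [Q] using a
    · intro y
      have := D_abs_le_two U (opS univ (Tm σ) f) (fun x => by
        have := T_range f hf h0 h1 univ x
        rw [abs_of_nonneg this.1]; exact this.2) y
      rw [← sq_abs]
      simp only [Pi.smul_apply, smul_eq_mul]
      nlinarith [abs_nonneg (opS U Dm (opS univ (Tm σ) f) y)]
  have s2 : ∀ y, |opS U Dm (opS univ (Tm σ) f) y| ≤
      opS (univ \ U) (Tm σ) (fun z => |opS U Dm f z|) y := by
    intro y
    have e : (univ : Finset ι) = (univ \ U) ∪ U := by simp
    have e2 : opS U Dm (opS univ (Tm σ) f) y =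
        σ ^ U.card * opS (univ \ U) (Tm σ) (opS U Dm f) y := by
      rw [D_T_comm]
      conv_lhs => rw [e, ← opS_disj_union Finset.sdiff_disjoint]
      rw [opS_opS, T_mul_D]
      have : opS U (σ • Dm) f = σ ^ U.card • opS U Dm f := by
        funext z; rw [opS_smul_mat]; rfl
      rw [this, opS_smul]; rfl
    rw [e2, abs_mul]
    have p1 : |σ ^ U.card| ≤ 1 := by
      rw [abs_of_nonneg (by positivity)]; exact pow_le_one₀ h0 h1
    calc _ ≤ 1 * |opS (univ \ U) (Tm σ) (opS U Dm f) y| := by gcongr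
      _ ≤ _ := by rw [one_mul]; exact opS_abs _ _ (T_nonneg h0 h1) _ _
  have s3 : opS (univ \ U) Jm (fun y => |opS U Dm (opS univ (Tm σ) f) y|) x ≤
      opS (univ \ U) Jm (fun z => |opS U Dm f z|) x := by
    refine (opS_mono _ _ J_nonneg s2 x).trans (le_of_eq ?_)
    rw [opS_opS, J_mul_T]
  have s4 : ∀ z, |opS U Dm f z| ≤
      ∑ A ∈ (U.erase i).powerset, opS A Jm (fun y => |opS {i} Dm f y|) z := by
    intro z
    conv_lhs => rw [← Finset.insert_erase hi, opS_insert' (Finset.notMem_erase i U)]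
    exact D_abs_le _ _ _
  have s5 : opS (univ \ U) Jm (fun z => |opS U Dm f z|) x ≤ 2 ^ U.card * ε := by
    refine (opS_mono _ _ J_nonneg s4 x).trans ?_
    rw [opS_sum]
    have : ∀ A ∈ (U.erase i).powerset,
        opS (univ \ U) Jm (opS A Jm (fun y => |opS {i} Dm f y|)) x ≤ ε := by
      intro A hA
      have hA' := Finset.mem_powerset.1 hA
      have hAU : A ⊆ U := hA'.trans (Finset.erase_subset _ _)
      have hd : Disjoint (univ \ U) A :=
        Finset.disjoint_of_subset_right hAU Finset.sdiff_disjoint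
      rw [opS_disj_union hd]
      have e : univ \ U ∪ A = univ \ (U \ A) := by
        ext j
        have := @hAU j
        simp only [Finset.mem_union, Finset.mem_sdiff, Finset.mem_univ, true_and]
        tauto
      rw [e]
      apply h _ Finset.sdiff_subset
      simp only [Finset.mem_sdiff, hi, true_and]
      intro hiA
      exact Finset.notMem_erase i U (hA' hiA)
    refine (Finset.sum_le_sum this).trans ?_
    rw [Finset.sum_const, Finset.card_powerset, nsmul_eq_mul]
    push_cast
    gcongr
    · norm_num
    · exact Finset.erase_subset _ _
  have e : (4:ℝ) ^ U.card = 2 ^ U.card * 2 ^ U.card := by rw [← mul_pow]; norm_num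
  calc _ ≤ _ := s1
    _ ≤ 2 ^ U.card * (2 ^ U.card * ε) := by gcongr; exact s3.trans s5
    _ = _ := by rw [e]; ring

lemma sum_Q (f : (ι → Ω) → ℝ) (hf : ∀ x, 0 ≤ f x ∧ f x ≤ 1) {σ : ℝ} (h0 : 0 ≤ σ)
    (h1 : σ ≤ 1 / 4) : ∑ U : Finset ι, ∑ x, Q σ f U x ≤ Fintype.card (ι → Ω) := by
  have := l2_bound univ h0 h1 f
  rw [Finset.powerset_univ] at this
  unfold Q
  simp only [sum_J]
  refine this.trans ?_
  calc ∑ x, f x ^ 2 ≤ ∑ x : ι → Ω, (1:ℝ) := Finset.sum_le_sum fun x _ => by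
        have := hf x; nlinarith
    _ = _ := by simp

lemma D_mem_abs (f : (ι → Ω) → ℝ) (hf : ∀ x, 0 ≤ f x ∧ f x ≤ 1) (i : ι) (x : ι → Ω) :
    |opS {i} Dm f x| ≤ 1 := by
  rw [single_D]
  have a := T_range f hf le_rfl zero_le_one {i} x
  rw [T_zero] at a
  have := hf x
  rw [abs_le]; constructor <;> linarith [a.1, a.2]

lemma sum_pairs (φ : Finset ι → ℝ) :
    ∑ i, ∑ T ∈ (univ.erase i : Finset ι).powerset, φ (insert i T) =
      ∑ U : Finset ι, (U.card : ℝ) * φ U := by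
  have h1 : ∀ i : ι, ∑ T ∈ (univ.erase i : Finset ι).powerset, φ (insert i T) =
      ∑ U : Finset ι, if i ∈ U then φ U else 0 := by
    intro i
    have : ∑ U : Finset ι, (if i ∈ U then φ U else 0) =
      ∑ U ∈ (insert i (univ.erase i) : Finset ι).powerset, (if i ∈ U then φ U else 0) := by
        rw [Finset.insert_erase (mem_univ i), Finset.powerset_univ]
    rw [this, Finset.sum_powerset_insert (Finset.notMem_erase i univ)]
    have hz : ∑ t ∈ (univ.erase i : Finset ι).powerset, (if i ∈ t then φ t else 0) = 0 := by
      refine Finset.sum_eq_zero fun T hT => ?_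
      have : i ∉ T := fun h => Finset.notMem_erase i univ (Finset.mem_powerset.1 hT h)
      simp [this]
    rw [hz, zero_add]
    exact Finset.sum_congr rfl fun T _ => by simp
  simp only [h1]
  rw [Finset.sum_comm]
  refine Finset.sum_congr rfl fun U _ => ?_
  rw [← Finset.sum_filter]
  simp

/-- key upper bound -/
lemma upper (f : (ι → Ω) → ℝ) (hf : ∀ x, 0 ≤ f x ∧ f x ≤ 1) {σ : ℝ} (h0 : 0 ≤ σ)
    (h1 : σ ≤ 1 / 4) {τ : ℝ} (hτ : 0 < τ) :
    ∑ i, ∑ x, (opS {i} Dm (opS univ (Tm σ) f) x) ^ 2 ≤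
      τ * ∑ i, ∑ x, |opS {i} Dm f x| +
      (τ ^ 3)⁻¹ * ∑ U : Finset ι, (U.card : ℝ) * ((1 / 64) ^ (U.card - 1) *
        ∑ x, (Q σ f U x) ^ 2) := by
  set g := opS univ (Tm σ) f with hg
  set w : ι → (ι → Ω) → ℝ := fun i => opS (univ.erase i) (Tm σ) (opS {i} Dm g) with hw
  have k1 : ∀ i, ∑ x, (opS {i} Dm g x) ^ 2 ≤ ∑ x, |opS {i} Dm f x| * |w i x| := by
    intro i
    have e1 : ∑ x, (opS {i} Dm g x) ^ 2 = σ * ∑ x, opS {i} Dm f x * w i x := by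
      have : ∑ x, (opS {i} Dm g x) ^ 2 =
          ∑ x, opS {i} Dm g x * opS univ (Tm σ) (opS {i} Dm f) x := by
        refine Finset.sum_congr rfl fun x _ => ?_
        rw [← D_T_comm, sq]
      rw [this, opS_adj _ _ (T_tr σ)]
      have hu : (univ : Finset ι) = insert i (univ.erase i) := by simp
      have : opS univ (Tm σ) (opS {i} Dm g) = opS {i} (Tm σ) (w i) := by
        conv_lhs => rw [hu]
        rw [opS_insert (Finset.notMem_erase i univ)]
      rw [this, ← opS_adj _ _ (T_tr σ)] 
      have : ∑ x, opS {i} (Tm σ) (w i) x * opS {i} Dm f x =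
         ∑ x, w i x * opS {i} (Tm σ) (opS {i} Dm f) x := (opS_adj _ _ (T_tr σ) _ _).symm
      rw [opS_opS, T_mul_D, Finset.mul_sum]
      refine Finset.sum_congr rfl fun x _ => ?_
      rw [opS_smul_mat]; simp; ring
    rw [e1]
    have e2 : ∑ x, opS {i} Dm f x * w i x ≤ ∑ x, |opS {i} Dm f x| * |w i x| :=
      Finset.sum_le_sum fun x _ => by rw [← abs_mul]; exact le_abs_self _
    have e3 : 0 ≤ ∑ x, |opS {i} Dm f x| * |w i x| := Finset.sum_nonneg fun x _ => by positivity
    calc _ ≤ σ * ∑ x, |opS {i} Dm f x| * |w i x| := by gcongr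
      _ ≤ 1 * ∑ x, |opS {i} Dm f x| * |w i x| := by gcongr; linarith
      _ = _ := one_mul _
  have k2 : ∀ i x, |opS {i} Dm f x| * |w i x| ≤
      τ * |opS {i} Dm f x| + (τ ^ 3)⁻¹ * ((w i x) ^ 2) ^ 2 := by
    intro i x
    have a1 := D_mem_abs f hf i x
    have a0 := abs_nonneg (opS {i} Dm f x)
    have b0 := abs_nonneg (w i x)
    have hb : ((w i x) ^ 2) ^ 2 = |w i x| ^ 4 := by
      rw [← sq_abs (w i x)]; ring
    rw [hb]
    by_cases hc : |w i x| ≤ τ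
    · have : 0 ≤ (τ ^ 3)⁻¹ * |w i x| ^ 4 := by positivity
      nlinarith
    · push Not at hc
      have : |w i x| ≤ (τ ^ 3)⁻¹ * |w i x| ^ 4 := by
        rw [inv_mul_eq_div, le_div_iff₀ (by positivity)]
        have : τ ^ 3 ≤ |w i x| ^ 3 := by gcongr
        calc |w i x| * τ ^ 3 ≤ |w i x| * |w i x| ^ 3 := by gcongr
          _ = _ := by ring
      have h3 : 0 ≤ τ * |opS {i} Dm f x| := by positivity
      nlinarith
  have k3 : ∀ i, ∑ x, ((w i x) ^ 2) ^ 2 ≤ ∑ T ∈ (univ.erase i : Finset ι).powerset,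
      (1 / 64 : ℝ) ^ ((insert i T).card - 1) * ∑ x, (Q σ f (insert i T) x) ^ 2 := by
    intro i
    have := hyper (univ.erase i) h0 h1 (Z := Unit) (fun _ => 1) (fun _ => zero_le_one)
      (fun _ => opS {i} Dm g)
    simp only [Finset.univ_unique, Finset.sum_singleton, one_mul] at this
    refine this.trans (le_of_eq (Finset.sum_congr rfl fun T hT => ?_))
    have hiT : i ∉ T := fun h => Finset.notMem_erase i univ (Finset.mem_powerset.1 hT h)
    rw [Finset.card_insert_of_notMem hiT, Nat.add_sub_cancel]
    congr 1
    refine Finset.sum_congr rfl fun x _ => ?_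
    unfold Q
    rw [← opS_insert' hiT]
    have : univ.erase i \ T = univ \ insert i T := by
      ext j; simp [and_comm, not_or]
    rw [this]
  calc ∑ i, ∑ x, (opS {i} Dm g x) ^ 2 
      ≤ ∑ i, ∑ x, (τ * |opS {i} Dm f x| + (τ ^ 3)⁻¹ * ((w i x) ^ 2) ^ 2) :=
        Finset.sum_le_sum fun i _ => (k1 i).trans (Finset.sum_le_sum fun x _ => k2 i x)
    _ = τ * ∑ i, ∑ x, |opS {i} Dm f x| + (τ ^ 3)⁻¹ * ∑ i, ∑ x, ((w i x) ^ 2) ^ 2 := by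
        simp only [Finset.sum_add_distrib, ← Finset.mul_sum]
    _ ≤ _ := by
        gcongr
        rw [← sum_pairs (fun U => (1 / 64 : ℝ) ^ (U.card - 1) * ∑ x, (Q σ f U x) ^ 2)]
        exact Finset.sum_le_sum fun i _ => k3 i

open Classical in
lemma coef_bound (f : (ι → Ω) → ℝ) (hf : ∀ x, 0 ≤ f x ∧ f x ≤ 1) {σ : ℝ} (h0 : 0 ≤ σ)
    (h1 : σ ≤ 1 / 4) (d : ℕ) {ε : ℝ} (hε : 0 ≤ ε) (B : Finset ι → (ι → Ω) → Prop)
    (hgood : ∀ U x, U.Nonempty → U.card ≤ d → ¬ B U x → ∃ i ∈ U, ∀ W ⊆ U, i ∈ W →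
      opS (univ \ W) Jm (fun y => |opS {i} Dm f y|) x ≤ ε) (U : Finset ι) :
    (U.card : ℝ) * ((1 / 64) ^ (U.card - 1) * ∑ x, (Q σ f U x) ^ 2) ≤
      (64 * (1 / 8) ^ d + 4 ^ d * ε) * ∑ x, Q σ f U x +
      16 ^ d * (if U.Nonempty ∧ U.card ≤ d then ((univ.filter fun x => B U x).card : ℝ) else 0) := by
  have hQ0 : ∀ x, 0 ≤ Q σ f U x := Q_nonneg σ f U
  have hQ4 : ∀ x, Q σ f U x ≤ 4 ^ U.card := Q_le f hf h0 (by linarith) U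
  have hS : 0 ≤ ∑ x, Q σ f U x := Finset.sum_nonneg fun x _ => hQ0 x
  have hrest : 0 ≤ (16:ℝ) ^ d * (if U.Nonempty ∧ U.card ≤ d then
      ((univ.filter fun x => B U x).card : ℝ) else 0) := by
    split_ifs <;> positivity
  rcases Finset.eq_empty_or_nonempty U with hU | hU
  · have : (U.card : ℝ) = 0 := by simp [hU]
    rw [this, zero_mul]
    positivity
  have hc1 : 1 ≤ U.card := hU.card_pos
  obtain ⟨c, hc⟩ : ∃ c, U.card = c + 1 := ⟨U.card - 1, by omega⟩
  by_cases hd : U.card ≤ d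
  · -- small
    have hcoef : (U.card : ℝ) * (1 / 64) ^ (U.card - 1) ≤ 1 := by
      rw [hc, Nat.add_sub_cancel, one_div, inv_pow, ← div_eq_mul_inv, div_le_one (by positivity)]
      have : c + 1 ≤ 64 ^ c := by
        calc c + 1 ≤ 2 ^ c := Nat.lt_two_pow_self
          _ ≤ 64 ^ c := Nat.pow_le_pow_left (by norm_num) c
      exact_mod_cast this
    rw [← mul_assoc]
    have hq : ∑ x, (Q σ f U x) ^ 2 ≤ ∑ x, (4 ^ d * ε * Q σ f U x +
        16 ^ d * (if B U x then 1 else 0)) := by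
      refine Finset.sum_le_sum fun x _ => ?_
      by_cases hb : B U x
      · simp only [hb, if_true]
        have e16 : (16:ℝ) ^ d = (4 ^ d) ^ 2 := by rw [← pow_mul, mul_comm, pow_mul]; norm_num
        have h4 : Q σ f U x ≤ 4 ^ d := (hQ4 x).trans (pow_le_pow_right₀ (by norm_num) hd)
        have := hQ0 x
        have h5 : 0 ≤ 4 ^ d * ε * Q σ f U x := by positivity
        have : Q σ f U x ^ 2 ≤ (4 ^ d) ^ 2 := by gcongr
        rw [e16]; linarith
      · simp only [hb, if_false, mul_zero, add_zero]
        obtain ⟨i, hi, hW⟩ := hgood U x hU hd hb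
        have h4 := Q_le_eps f hf h0 (by linarith) U x hε i hi hW
        have h5 : (4:ℝ) ^ U.card * ε ≤ 4 ^ d * ε := by
          gcongr; norm_num
        have := hQ0 x
        rw [sq]; gcongr; linarith
    have hq' : ∑ x, (4 ^ d * ε * Q σ f U x + 16 ^ d * (if B U x then (1:ℝ) else 0)) =
        4 ^ d * ε * ∑ x, Q σ f U x + 16 ^ d * ((univ.filter fun x => B U x).card : ℝ) := by
      rw [Finset.sum_add_distrib, ← Finset.mul_sum, ← Finset.mul_sum]
      simp
    rw [hq'] at hq
    rw [if_pos ⟨hU, hd⟩]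
    have hsq : 0 ≤ ∑ x, (Q σ f U x) ^ 2 := Finset.sum_nonneg fun x _ => sq_nonneg _
    have h8 : 0 ≤ 64 * (1 / 8 : ℝ) ^ d * ∑ x, Q σ f U x := by positivity
    calc _ ≤ 1 * ∑ x, (Q σ f U x) ^ 2 := by gcongr
      _ ≤ _ := by linarith
  · push Not at hd
    have hq : ∑ x, (Q σ f U x) ^ 2 ≤ 4 ^ U.card * ∑ x, Q σ f U x := by
      rw [Finset.mul_sum]
      refine Finset.sum_le_sum fun x _ => ?_
      rw [sq]
      exact mul_le_mul_of_nonneg_right (hQ4 x) (hQ0 x)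
    have hcoef : (U.card : ℝ) * (1 / 64) ^ (U.card - 1) * 4 ^ U.card ≤ 64 * (1 / 8) ^ d := by
      have e : (U.card : ℝ) * (1 / 64) ^ (U.card - 1) * 4 ^ U.card
         = 64 * ((U.card : ℝ) * (1 / 16) ^ U.card) := by
        rw [hc, Nat.add_sub_cancel]
        have : (4 : ℝ) ^ (c+1) = 4 * 4 ^ c := by ring
        have h2 : (1/64 : ℝ) ^ c * 4 ^ c = (1/16) ^ c := by rw [← mul_pow]; norm_num
        have h3 : (1/16 : ℝ) ^ (c + 1) = (1/16) ^ c / 16 := by ring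
        rw [this, h3, ← h2]; ring
      rw [e]
      have h2 : (U.card : ℝ) ≤ 2 ^ U.card := by exact_mod_cast Nat.lt_two_pow_self.le
      have h3 : (2:ℝ) ^ U.card * (1/16) ^ U.card = (1/8) ^ U.card := by
        rw [← mul_pow]; norm_num
      have h4 : (1/8 : ℝ) ^ U.card ≤ (1/8) ^ d :=
        pow_le_pow_of_le_one (by norm_num) (by norm_num) hd.le
      calc 64 * ((U.card : ℝ) * (1 / 16) ^ U.card) ≤ 64 * (2 ^ U.card * (1/16) ^ U.card) := by gcongr
        _ ≤ _ := by rw [h3]; gcongr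
    have h8 : 0 ≤ 4 ^ d * ε * ∑ x, Q σ f U x := by positivity
    calc _ ≤ (U.card : ℝ) * ((1 / 64) ^ (U.card - 1) * (4 ^ U.card * ∑ x, Q σ f U x)) := by gcongr
      _ = ((U.card : ℝ) * (1 / 64) ^ (U.card - 1) * 4 ^ U.card) * ∑ x, Q σ f U x := by ring
      _ ≤ 64 * (1 / 8) ^ d * ∑ x, Q σ f U x := by gcongr
      _ ≤ _ := by linarith

end ana
end Frd

namespace Frd
open Finset
set_option linter.unusedSectionVars false
set_option linter.unusedSimpArgs false

section ana2
variable {ι Ω : Type} [Fintype ι] [DecidableEq ι] [Fintype Ω] [DecidableEq Ω] [Nonempty Ω]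

lemma D_sub_const (i : ι) (f : (ι → Ω) → ℝ) (c : ℝ) :
    opS {i} Dm (f - fun _ => c) = opS {i} Dm f := by
  funext x
  rw [single_D, single_D, opS_sub, opS_J_const]
  simp

lemma lower (f : (ι → Ω) → ℝ) (hf : ∀ x, 0 ≤ f x ∧ f x ≤ 1) {C v ρ : ℝ} (hv : 0 < v)
    (hρ0 : 0 ≤ ρ) (hρ1 : ρ ≤ 1) (hρC : (1 - ρ) * C ≤ v / 2)
    (hI : ∑ i, ∑ x, |opS {i} Dm f x| ≤ C * Fintype.card (ι → Ω))
    (hvar : v ≤ (∑ x, f x ^ 2) / Fintype.card (ι → Ω) - ((∑ x, f x) / Fintype.card (ι → Ω)) ^ 2)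
    (n : ℕ) :
    (v / 2) ^ (2 ^ (n + 1)) * Fintype.card (ι → Ω) ≤
      ∑ i, ∑ x, (opS {i} Dm (opS univ (Tm (ρ ^ (2 ^ n))) f) x) ^ 2 := by
  set K : ℝ := ((Fintype.card (ι → Ω) : ℕ) : ℝ) with hK
  have hK0 : 0 < K := by
    have : (Fintype.card (ι → Ω) : ℝ) ≠ 0 := cardne
    positivity
  set μ : ℝ := (∑ x, f x) / K with hμ
  have hμK : ∑ x, f x = μ * K := by rw [hμ]; field_simp
  have hμ0 : 0 ≤ μ := div_nonneg (Finset.sum_nonneg fun x _ => (hf x).1) hK0.le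
  have hμ1 : μ ≤ 1 := by
    rw [hμ, div_le_one hK0]
    calc ∑ x, f x ≤ ∑ x : ι → Ω, (1:ℝ) := Finset.sum_le_sum fun x _ => (hf x).2
      _ = K := by simp [hK]
  set f0 : (ι → Ω) → ℝ := f - fun _ => μ with hf0
  have hsum0 : ∑ x, f0 x = 0 := by
    simp only [hf0, Pi.sub_apply, Finset.sum_sub_distrib, hμK]
    simp [hK]; ring
  have hsq : ∑ x, f0 x ^ 2 = ∑ x, f x ^ 2 - μ ^ 2 * K := by
    have : ∀ x, f0 x ^ 2 = f x ^ 2 - 2 * μ * f x + μ ^ 2 := by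
      intro x; simp only [hf0, Pi.sub_apply]; ring
    simp only [this, Finset.sum_add_distrib, Finset.sum_sub_distrib, ← Finset.mul_sum, hμK]
    simp only [Finset.sum_const, Finset.card_univ, nsmul_eq_mul, ← hK]; ring
  have hsqv : v * K ≤ ∑ x, f0 x ^ 2 := by
    rw [hsq]
    have := mul_le_mul_of_nonneg_right hvar hK0.le
    rw [sub_mul, div_mul_cancel₀ _ hK0.ne'] at this
    exact this
  have hsqK : ∑ x, f0 x ^ 2 ≤ K := by
    calc ∑ x, f0 x ^ 2 ≤ ∑ x : ι → Ω, (1:ℝ) := Finset.sum_le_sum fun x _ => by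
          have := hf x
          simp only [hf0, Pi.sub_apply]
          rw [← sq_abs]
          have : |f x - μ| ≤ 1 := by rw [abs_le]; constructor <;> linarith
          exact pow_le_one₀ (abs_nonneg _) this
      _ = K := by simp [hK]
  set b : ℝ → ℝ := fun r => ∑ x, f0 x * opS univ (Tm r) f0 x with hb
  have hbsq : ∀ r, ∑ x, (opS univ (Tm r) f0 x) ^ 2 = b (r * r) := by
    intro r
    simp only [hb]
    rw [← T_mul_T, ← opS_opS, opS_adj _ _ (T_tr r)]
    exact Finset.sum_congr rfl fun x _ => sq _
  have hb1 : v / 2 * K ≤ b ρ := by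
    have h := hybrid univ hρ0 hρ1 f0
    have h2 : ∑ i, ∑ x, (opS {i} Dm f0 x) ^ 2 ≤ C * K := by
      refine le_trans (Finset.sum_le_sum fun i _ => Finset.sum_le_sum fun x _ => ?_) hI
      rw [hf0, D_sub_const, ← sq_abs]
      have := D_mem_abs f hf i x
      nlinarith [abs_nonneg (opS {i} Dm f x)]
    have h3 := mul_le_mul_of_nonneg_left h2 (by linarith : 0 ≤ 1 - ρ)
    have h4 := mul_le_mul_of_nonneg_right hρC hK0.le
    simp only [hb]
    nlinarith
  have hbj : ∀ j : ℕ, (v / 2) ^ (2 ^ j) * K ≤ b (ρ ^ (2 ^ j)) := by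
    intro j
    induction j with
    | zero => simpa using hb1
    | succ j ih =>
      have hcs : (b (ρ ^ (2 ^ j))) ^ 2 ≤ K * b (ρ ^ (2 ^ (j + 1))) := by
        have e : ρ ^ (2 ^ (j + 1)) = ρ ^ (2 ^ j) * ρ ^ (2 ^ j) := by
          rw [← pow_add]; congr 1; ring
        rw [e, ← hbsq]
        refine (Finset.sum_mul_sq_le_sq_mul_sq _ _ _).trans ?_
        exact mul_le_mul_of_nonneg_right hsqK (Finset.sum_nonneg fun x _ => sq_nonneg _)
      have e2 : (v / 2) ^ (2 ^ (j + 1)) = ((v / 2) ^ (2 ^ j)) ^ 2 := by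
        rw [← pow_mul]; congr 1
      rw [e2]
      have ha : 0 ≤ (v / 2) ^ (2 ^ j) * K := by positivity
      have h5 : ((v / 2) ^ (2 ^ j) * K) ^ 2 ≤ (b (ρ ^ (2 ^ j))) ^ 2 := by gcongr
      have h6 : K * (((v / 2) ^ (2 ^ j)) ^ 2 * K) ≤ K * b (ρ ^ (2 ^ (j + 1))) := by
        refine le_trans (le_of_eq ?_) (h5.trans hcs)
        ring
      exact le_of_mul_le_mul_left h6 hK0
  refine (hbj (n + 1)).trans ?_
  have e : ρ ^ (2 ^ (n + 1)) = ρ ^ (2 ^ n) * ρ ^ (2 ^ n) := by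
    rw [← pow_add]; congr 1; ring
  rw [e, ← hbsq]
  have hh := hybrid univ le_rfl zero_le_one (opS univ (Tm (ρ ^ (2 ^ n))) f0)
  have hz : ∀ x, opS univ (Tm 0) (opS univ (Tm (ρ ^ (2 ^ n))) f0) x = 0 := by
    intro x
    rw [T_zero, opS_J_univ, sum_T, hsum0, zero_div]
  simp only [hz, mul_zero, Finset.sum_const_zero, sub_zero, one_mul] at hh
  refine hh.trans (le_of_eq ?_)
  refine Finset.sum_congr rfl fun i _ => Finset.sum_congr rfl fun x _ => ?_
  rw [D_T_comm, D_T_comm, hf0, D_sub_const]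

end ana2

open Classical in
theorem analytic (C v : ℝ) (hC : 0 ≤ C) (hv : 0 < v) : ∃ d : ℕ, ∃ ε : ℝ, 0 < ε ∧
    ∀ (ι Ω : Type) [Fintype ι] [DecidableEq ι] [Fintype Ω] [DecidableEq Ω] [Nonempty Ω]
      (f : (ι → Ω) → ℝ) (_ : ∀ x, 0 ≤ f x ∧ f x ≤ 1) (B : Finset ι → (ι → Ω) → Prop)
      (_ : ∑ i, ∑ x, |opS {i} Dm f x| ≤ C * Fintype.card (ι → Ω))
      (_ : ∑ U : Finset ι, (if U.Nonempty ∧ U.card ≤ d then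
        ((univ.filter fun x => B U x).card : ℝ) else 0) ≤ ε * Fintype.card (ι → Ω))
      (_ : ∀ U x, U.Nonempty → U.card ≤ d → ¬ B U x → ∃ i ∈ U, ∀ W ⊆ U, i ∈ W →
        opS (univ \ W) Jm (fun y => |opS {i} Dm f y|) x ≤ ε),
      (∑ x, f x ^ 2) / Fintype.card (ι → Ω) - ((∑ x, f x) / Fintype.card (ι → Ω)) ^ 2 < v := by
  obtain ⟨ρ, hρ0, hρ1, hρC⟩ : ∃ ρ : ℝ, 0 ≤ ρ ∧ ρ < 1 ∧ (1 - ρ) * C ≤ v / 2 := by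
    have hC1 : (0:ℝ) < C + 1 := by linarith
    have hq : 0 < v / (2 * (C + 1)) := by positivity
    have hl : 1 - v / (2 * (C + 1)) ≤ max 0 (1 - v / (2 * (C + 1))) := le_max_right _ _
    refine ⟨max 0 (1 - v / (2 * (C + 1))), le_max_left _ _, ?_, ?_⟩
    · rw [max_lt_iff]; constructor <;> linarith
    · calc _ ≤ v / (2 * (C + 1)) * C := by gcongr; linarith
        _ ≤ v / (2 * (C + 1)) * (C + 1) := by gcongr; linarith
        _ = v / 2 := by field_simp
  obtain ⟨n, hn⟩ : ∃ n : ℕ, ρ ^ (2 ^ n) ≤ 1 / 4 := by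
    obtain ⟨n, hn⟩ := exists_pow_lt_of_lt_one (show (0:ℝ) < 1 / 4 by norm_num) hρ1
    exact ⟨n, (pow_le_pow_of_le_one hρ0 hρ1.le Nat.lt_two_pow_self.le).trans hn.le⟩
  set σ := ρ ^ (2 ^ n) with hσ
  set c : ℝ := (v / 2) ^ (2 ^ (n + 1)) with hc
  have hc0 : 0 < c := by positivity
  set τ : ℝ := c / (4 * (C + 1)) with hτ
  have hτ0 : 0 < τ := by positivity
  have hτC : τ * C ≤ c / 4 := by
    have hC1 : (0:ℝ) < C + 1 := by linarith
    calc τ * C ≤ τ * (C + 1) := by gcongr; linarith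
      _ = c / 4 := by rw [hτ]; field_simp
  obtain ⟨d, hd⟩ := exists_pow_lt_of_lt_one (show 0 < c * τ ^ 3 / 256 by positivity)
    (show (1 / 8 : ℝ) < 1 by norm_num)
  set ε : ℝ := c * τ ^ 3 / (4 * (4 ^ d + 16 ^ d)) with hε
  have hε0 : 0 < ε := by positivity
  have hε2 : (4 ^ d + 16 ^ d) * ε = c * τ ^ 3 / 4 := by rw [hε]; field_simp
  refine ⟨d, ε, hε0, ?_⟩
  intro ι Ω _ _ _ _ _ f hf B hI hB hgood
  by_contra hvar
  push Not at hvar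
  have hlow := lower f hf hv hρ0 hρ1.le hρC hI hvar n
  rw [← hσ, ← hc] at hlow
  have hσ0 : 0 ≤ σ := by positivity
  have hup := upper f hf hσ0 hn hτ0
  have hK0 : (0:ℝ) < Fintype.card (ι → Ω) := by
    have : (Fintype.card (ι → Ω) : ℝ) ≠ 0 := cardne
    positivity
  have hcb : ∑ U : Finset ι, (U.card : ℝ) * ((1 / 64) ^ (U.card - 1) * ∑ x, (Q σ f U x) ^ 2) ≤
      ((64 * (1 / 8) ^ d + 4 ^ d * ε) + 16 ^ d * ε) * Fintype.card (ι → Ω) := by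
    refine (Finset.sum_le_sum fun U _ =>
      coef_bound f hf hσ0 hn d hε0.le B hgood U).trans ?_
    rw [Finset.sum_add_distrib, ← Finset.mul_sum, ← Finset.mul_sum,
      add_mul (64 * (1 / 8) ^ d + 4 ^ d * ε) (16 ^ d * ε)]
    have hsQ := sum_Q f hf hσ0 hn
    apply add_le_add
    · gcongr
    · rw [mul_assoc]; gcongr
  have hcoef : (τ ^ 3)⁻¹ * ((64 * (1 / 8) ^ d + 4 ^ d * ε) + 16 ^ d * ε) < c / 2 := by
    rw [inv_mul_lt_iff₀ (by positivity)]
    nlinarith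
  have h1 : τ * ∑ i, ∑ x, |opS {i} Dm f x| ≤ c / 4 * Fintype.card (ι → Ω) := by
    calc _ ≤ τ * (C * Fintype.card (ι → Ω)) := by gcongr
      _ = τ * C * Fintype.card (ι → Ω) := by ring
      _ ≤ _ := by gcongr
  have h2 : (τ ^ 3)⁻¹ * ∑ U : Finset ι, (U.card : ℝ) *
      ((1 / 64) ^ (U.card - 1) * ∑ x, (Q σ f U x) ^ 2) ≤ c / 2 * Fintype.card (ι → Ω) := by
    calc _ ≤ (τ ^ 3)⁻¹ * (((64 * (1 / 8) ^ d + 4 ^ d * ε) + 16 ^ d * ε) *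
          Fintype.card (ι → Ω)) := by gcongr
      _ = (τ ^ 3)⁻¹ * ((64 * (1 / 8) ^ d + 4 ^ d * ε) + 16 ^ d * ε) *
          Fintype.card (ι → Ω) := by ring
      _ ≤ _ := by gcongr
  have : 0 < c * (Fintype.card (ι → Ω) : ℝ) := by positivity
  linarith

end Frd

namespace Frd
open Finset
set_option linter.unusedSectionVars false
set_option linter.unusedSimpArgs false

section prs
variable {α β : Type} [Fintype α] [Fintype β]

open Classical in
/-- probability under the uniform distribution -/
noncomputable def pr (P : α → Prop) : ℝ := ((univ.filter P).card : ℝ) / Fintype.card α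

lemma pr_nonneg (P : α → Prop) : 0 ≤ pr P := by unfold pr; positivity

lemma pr_mono {P Q : α → Prop} (h : ∀ a, P a → Q a) : pr P ≤ pr Q := by
  unfold pr
  gcongr with a
  exact h a

lemma pr_le_one (P : α → Prop) : pr P ≤ 1 := by
  unfold pr
  apply div_le_one_of_le₀ _ (by positivity)
  exact_mod_cast Finset.card_le_univ _

lemma pr_congr {P Q : α → Prop} (h : ∀ a, P a ↔ Q a) : pr P = pr Q :=
  le_antisymm (pr_mono fun a => (h a).1) (pr_mono fun a => (h a).2)

lemma pr_equiv (e : α ≃ β) (P : β → Prop) : pr (fun a => P (e a)) = pr P := by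
  classical
  unfold pr
  rw [Fintype.card_congr e]
  congr 2
  refine Finset.card_bij (fun a _ => e a) ?_ ?_ ?_
  · intro a ha; simpa using ha
  · intro a _ b _ h; exact e.injective h
  · intro b hb; exact ⟨e.symm b, by simpa using hb, by simp⟩

lemma pr_prod (P : α × β → Prop) :
    pr P = (∑ a, pr (fun b => P (a, b))) / Fintype.card α := by
  classical
  unfold pr
  rw [← Finset.sum_div, div_div, Fintype.card_prod, Nat.cast_mul, mul_comm (Fintype.card α : ℝ)]
  congr 1
  rw [← Nat.cast_sum]
  congr 1
  simp only [Finset.card_filter]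
  rw [Fintype.sum_prod_type]

lemma pr_const (p : Prop) [Decidable p] [Nonempty α] : pr (fun _ : α => p) = if p then 1 else 0 := by
  unfold pr
  have : (Fintype.card α : ℝ) ≠ 0 := by simp
  split_ifs with h
  · simp [h]
  · simp [h]

lemma pr_fst [Nonempty β] (P : α → Prop) : pr (fun z : α × β => P z.1) = pr P := by
  classical
  rw [pr_prod]
  simp only [pr_const]
  unfold pr
  congr 1
  rw [Finset.card_filter]; push_cast
  exact Finset.sum_congr rfl fun a _ => by congr

lemma pr_split (P Q : α → Prop) : pr P ≤ pr Q + pr (fun a => P a ∧ ¬ Q a) := by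
  classical
  unfold pr
  rw [← add_div]
  gcongr
  rw [← Nat.cast_add, Nat.cast_le]
  refine le_trans (Finset.card_le_card ?_) (Finset.card_union_le _ _)
  intro a ha
  simp only [Finset.mem_filter, Finset.mem_univ, true_and, Finset.mem_union] at *
  tauto

lemma pr_sdiff {P Q : α → Prop} (h : ∀ a, Q a → P a) :
    pr (fun a => P a ∧ ¬ Q a) = pr P - pr Q := by
  classical
  unfold pr
  rw [← sub_div]
  congr 1
  rw [eq_sub_iff_add_eq, ← Nat.cast_add, Nat.cast_inj, ← Finset.card_union_of_disjoint]
  · congr 1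
    ext a
    have := h a
    simp only [Finset.mem_filter, Finset.mem_univ, true_and, Finset.mem_union] at *
    tauto
  · rw [Finset.disjoint_left]
    intro a ha
    simp only [Finset.mem_filter, Finset.mem_univ, true_and] at *
    tauto

open Classical in
lemma pr_eq_sum (P : α → Prop) : pr P = (∑ a, if P a then (1:ℝ) else 0) / Fintype.card α := by
  unfold pr
  rw [Finset.card_filter]; push_cast; rfl
end prs

section colr
variable {n k : ℕ}

/-- edges -/
abbrev Ed (n k : ℕ) : Type := {s : Finset (Fin n) // s.card = k}

def NM (c : Fin n → Bool) (e : Ed n k) : Prop := ∃ u ∈ e.1, ∃ v ∈ e.1, c u ≠ c v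

/-- colorability of the edges indexed by `s` -/
def CS {ι : Type} (s : Finset ι) (x : ι → Ed n k) : Prop := ∃ c : Fin n → Bool, ∀ i ∈ s, NM c (x i)

lemma CS_mono {ι : Type} {s t : Finset ι} (h : s ⊆ t) {x : ι → Ed n k} (hx : CS t x) : CS s x := by
  obtain ⟨c, hc⟩ := hx
  exact ⟨c, fun i hi => hc i (h hi)⟩

lemma CS_congr {ι : Type} {s : Finset ι} {x y : ι → Ed n k} (h : ∀ i ∈ s, x i = y i)
    (hx : CS s x) : CS s y := by
  obtain ⟨c, hc⟩ := hx
  exact ⟨c, fun i hi => h i hi ▸ hc i hi⟩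

lemma card_Ed : Fintype.card (Ed n k) = n.choose k := by
  rw [Fintype.card_finset_len]; simp

lemma Ed_nonempty (h : k ≤ n) : Nonempty (Ed n k) := by
  rw [← Fintype.card_pos_iff, card_Ed]; exact Nat.choose_pos h

lemma prob_eq (k n m : ℕ) :
    probTwoColorable k n m = pr (fun x : Fin m → Ed n k => CS univ x) := by
  classical
  unfold probTwoColorable pr
  rw [Fintype.card_fun, card_Ed, Fintype.card_fin, Nat.card_eq_fintype_card]
  push_cast
  congr 2
  rw [Fintype.card_subtype]
  refine congrArg Finset.card (Finset.filter_congr fun x _ => ?_)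
  simp [IsTwoColorable, CS, NM]

lemma pr_CS (hkn : k ≤ n) {ι : Type} [Fintype ι] [DecidableEq ι] (s : Finset ι) :
    pr (fun x : ι → Ed n k => CS s x) = probTwoColorable k n s.card := by
  have := Ed_nonempty hkn
  rw [prob_eq]
  rw [← pr_fst (β := {i // i ∉ s} → Ed n k) (fun x : Fin s.card → Ed n k => CS univ x),
    ← pr_equiv (Equiv.prodCongr
    (Equiv.arrowCongr s.equivFin (Equiv.refl (Ed n k))) (Equiv.refl ({i // i ∉ s} → Ed n k))),
    ← pr_equiv (Equiv.piEquivPiSubtypeProd (fun i => i ∈ s) (fun _ : ι => Ed n k))]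
  refine pr_congr fun x => ?_
  simp only [CS]
  refine exists_congr fun c => ?_
  constructor
  · intro h j _
    simpa using h _ (s.equivFin.symm j).2
  · intro h i hi
    simpa using h (s.equivFin ⟨i, hi⟩) (mem_univ _)

lemma prob_anti (hkn : k ≤ n) : Antitone (probTwoColorable k n) := by
  apply antitone_nat_of_succ_le
  intro m
  have h1 := pr_CS (k := k) hkn (univ : Finset (Fin (m+1)))
  have h2 := pr_CS (k := k) hkn (univ.erase (0 : Fin (m+1)))
  simp only [Finset.card_erase_of_mem (mem_univ _), Finset.card_univ, Fintype.card_fin,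
    Nat.add_sub_cancel] at h1 h2
  rw [← h1, ← h2]
  exact pr_mono fun x hx => CS_mono (Finset.erase_subset _ _) hx

lemma prob_nonneg (m : ℕ) : 0 ≤ probTwoColorable k n m := by rw [prob_eq]; exact pr_nonneg _
lemma prob_le_one (m : ℕ) : probTwoColorable k n m ≤ 1 := by rw [prob_eq]; exact pr_le_one _

end colr
end Frd

namespace Frd
open Finset
set_option linter.unusedSectionVars false
set_option linter.unusedSimpArgs false

section inf
variable {n k : ℕ} {ι : Type} [Fintype ι] [DecidableEq ι]

open Classical in
/-- indicator of colorability of the edges in `s` -/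
noncomputable def fS (s : Finset ι) (x : ι → Ed n k) : ℝ := if CS s x then 1 else 0

lemma fS_range (s : Finset ι) (x : ι → Ed n k) : 0 ≤ fS s x ∧ fS s x ≤ 1 := by
  unfold fS; split_ifs <;> norm_num

lemma fS_sq (s : Finset ι) (x : ι → Ed n k) : fS s x ^ 2 = fS s x := by
  unfold fS; split_ifs <;> norm_num

lemma fS_mono {s t : Finset ι} (h : s ⊆ t) (x : ι → Ed n k) : fS t x ≤ fS s x := by
  unfold fS
  by_cases h1 : CS t x
  · rw [if_pos h1, if_pos (CS_mono h h1)]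
  · rw [if_neg h1]; split_ifs <;> norm_num

lemma fS_congr {s : Finset ι} {x y : ι → Ed n k} (h : ∀ i ∈ s, x i = y i) : fS s x = fS s y := by
  unfold fS
  have : CS s x ↔ CS s y := ⟨CS_congr h, CS_congr fun i hi => (h i hi).symm⟩
  classical exact if_congr this rfl rfl

/-- loss -/
noncomputable def hS (i : ι) : (ι → Ed n k) → ℝ := fS (univ.erase i) - fS univ

variable [Nonempty (Ed n k)]

lemma opS_fS (s t : Finset ι) (x : ι → Ed n k) :
    opS s Jm (fS t) x = pr (fun y => CS t (s.piecewise y x)) := by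
  rw [opS_J_eq, pr_eq_sum]
  rfl

lemma sum_fS (hkn : k ≤ n) (s : Finset ι) :
    ∑ x : ι → Ed n k, fS s x = probTwoColorable k n s.card * Fintype.card (ι → Ed n k) := by
  rw [← pr_CS hkn, pr_eq_sum, div_mul_cancel₀ _ cardne]
  rfl

lemma D_le_h (i : ι) (x : ι → Ed n k) :
    |opS {i} Dm (fS univ) x| ≤ hS i x + opS {i} Jm (hS i) x := by
  have e : opS {i} Jm (fS (univ.erase i)) x = fS (univ.erase i) x := by
    rw [single_J]
    have : ∀ w : Ed n k, fS (univ.erase i) (Function.update x i w) = fS (univ.erase i) x := by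
      intro w
      apply fS_congr
      intro j hj
      rw [Function.update_of_ne (Finset.ne_of_mem_erase hj)]
    simp only [this]
    rw [Finset.sum_const, Finset.card_univ, nsmul_eq_mul, ← mul_assoc, inv_mul_cancel₀ cardne,
      one_mul]
  have h0 : ∀ y : ι → Ed n k, 0 ≤ hS i y := fun y => by
    have := fS_mono (Finset.erase_subset i univ) y
    simp only [hS, Pi.sub_apply]; linarith
  have h1 : 0 ≤ opS {i} Jm (hS i) x := by
    have := opS_mono {i} Jm J_nonneg (f := fun _ => 0) (g := hS (n := n) (k := k) i) h0 x
    rwa [opS_J_const] at this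
  have h2 : opS {i} Dm (fS univ) x = - hS i x + opS {i} Jm (hS i) x := by
    rw [single_D]
    conv_rhs => rw [hS, opS_sub]
    simp only [Pi.sub_apply, e]
    ring
  rw [h2]
  refine (abs_add_le _ _).trans ?_
  rw [abs_neg, abs_of_nonneg (h0 x), abs_of_nonneg h1]

lemma sum_hS (hkn : k ≤ n) (i : ι) : ∑ x : ι → Ed n k, hS i x =
    (probTwoColorable k n (Fintype.card ι - 1) - probTwoColorable k n (Fintype.card ι)) *
      Fintype.card (ι → Ed n k) := by
  simp only [hS, Pi.sub_apply, Finset.sum_sub_distrib]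
  rw [sum_fS hkn, sum_fS hkn, Finset.card_erase_of_mem (mem_univ _), Finset.card_univ]
  ring

lemma influence (hkn : k ≤ n) : ∑ i, ∑ x : ι → Ed n k, |opS {i} Dm (fS univ) x| ≤
    2 * Fintype.card ι * (probTwoColorable k n (Fintype.card ι - 1) -
      probTwoColorable k n (Fintype.card ι)) * Fintype.card (ι → Ed n k) := by
  calc _ ≤ ∑ i : ι, ∑ x : ι → Ed n k, (hS i x + opS {i} Jm (hS i) x) :=
        Finset.sum_le_sum fun i _ => Finset.sum_le_sum fun x _ => D_le_h i x
    _ = ∑ i : ι, 2 * ((probTwoColorable k n (Fintype.card ι - 1) -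
          probTwoColorable k n (Fintype.card ι)) * Fintype.card (ι → Ed n k)) := by
        refine Finset.sum_congr rfl fun i _ => ?_
        rw [Finset.sum_add_distrib, sum_J, sum_hS hkn]; ring
    _ = _ := by
        rw [Finset.sum_const, Finset.card_univ, nsmul_eq_mul]; ring

lemma fiber_split (x : ι → Ed n k) (i : ι) (W : Finset ι) (hi : i ∈ W) :
    opS (univ \ W) Jm (fun y => |opS {i} Dm (fS univ) y|) x ≤
      opS (univ \ W) Jm (hS i) x + opS (univ \ W.erase i) Jm (hS i) x := by
  refine (opS_mono _ _ J_nonneg (D_le_h i) x).trans (le_of_eq ?_)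
  have : (fun x => hS i x + opS {i} Jm (hS i) x) = hS (n := n) (k := k) i + opS {i} Jm (hS i) := rfl
  rw [this, opS_add]
  simp only [Pi.add_apply]
  congr 1
  rw [opS_disj_union (by simpa using hi)]
  congr 1
  ext j
  by_cases hj : j = i
  · subst hj; simp
  · simp [hj]

lemma fiber_term (hkn : k ≤ n) (x : ι → Ed n k) (i : ι) (W W' : Finset ι) (hi : i ∈ W)
    (hW' : W' ⊆ W) (d : ℕ) (hd : W.card ≤ d) (ε : ℝ)
    (hnb : probTwoColorable k n (Fintype.card ι) - ε ≤
      pr (fun y => CS univ ((univ \ W').piecewise y x))) :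
    opS (univ \ W') Jm (hS i) x ≤ probTwoColorable k n (Fintype.card ι - d) -
      probTwoColorable k n (Fintype.card ι) + ε := by
  rw [hS, opS_sub, Pi.sub_apply, opS_fS, opS_fS]
  have h1 : pr (fun y : ι → Ed n k => CS (univ.erase i) ((univ \ W').piecewise y x)) ≤
      probTwoColorable k n (Fintype.card ι - d) := by
    calc _ ≤ pr (fun y : ι → Ed n k => CS (univ \ W) y) := by
          apply pr_mono
          intro y hy
          have hsub : univ \ W ⊆ univ.erase i := by
            intro j hj
            simp only [Finset.mem_sdiff, Finset.mem_univ, true_and, Finset.mem_erase, and_true] at *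
            rintro rfl; exact hj hi
          refine CS_congr ?_ (CS_mono hsub hy)
          intro j hj
          rw [Finset.piecewise_eq_of_mem]
          simp only [Finset.mem_sdiff, Finset.mem_univ, true_and] at *
          exact fun h => hj (hW' h)
      _ = probTwoColorable k n (univ \ W).card := pr_CS hkn _
      _ ≤ _ := by
          apply prob_anti hkn
          rw [Finset.card_sdiff_of_subset (Finset.subset_univ _), Finset.card_univ]
          omega
  linarith

/-- recoloring: a vertex of `x i` lying in no other edge of `W` -/
lemma recolor (hk : 2 ≤ k) (x : ι → Ed n k) (i : ι) (W : Finset ι) (v : Fin n)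
    (hv : v ∈ (x i).1) (hv' : ∀ j ∈ W, j ≠ i → v ∉ (x j).1) (h : CS (W.erase i) x) : CS W x := by
  obtain ⟨c, hc⟩ := h
  obtain ⟨u, hu, huv⟩ : ∃ u ∈ (x i).1, u ≠ v := by
    apply Finset.exists_mem_ne
    rw [(x i).2]; omega
  refine ⟨Function.update c v (!c u), fun j hj => ?_⟩
  by_cases hji : j = i
  · subst hji
    refine ⟨u, hu, v, hv, ?_⟩
    simp [huv]
  · obtain ⟨a, ha, b, hb, hab⟩ := hc j (by simp [hji, hj])
    have hvj := hv' j hj hji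
    refine ⟨a, ha, b, hb, ?_⟩
    rw [Function.update_of_ne (by rintro rfl; exact hvj ha),
      Function.update_of_ne (by rintro rfl; exact hvj hb)]
    exact hab

/-- `U` is bad for `x` when no edge of `U` has a private vertex -/
def Bad (U : Finset ι) (x : ι → Ed n k) : Prop :=
  ∀ i ∈ U, ∀ v ∈ (x i).1, ∃ j ∈ U, j ≠ i ∧ v ∈ (x j).1

lemma good (hkn : k ≤ n) (hk : 2 ≤ k) (d : ℕ) (ε δ : ℝ) (hε : 0 ≤ ε)
    (hd : probTwoColorable k n (Fintype.card ι - d) - probTwoColorable k n (Fintype.card ι) ≤ δ)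
    (hnb : ∀ (W : Finset ι) (x : ι → Ed n k), W.card ≤ d → CS W x →
      probTwoColorable k n (Fintype.card ι) - ε ≤
      pr (fun y => CS univ ((univ \ W).piecewise y x)))
    (U : Finset ι) (x : ι → Ed n k) (hUd : U.card ≤ d) (hB : ¬ Bad U x) :
    ∃ i ∈ U, ∀ W ⊆ U, i ∈ W →
      opS (univ \ W) Jm (fun y => |opS {i} Dm (fS univ) y|) x ≤ 2 * (δ + ε) := by
  unfold Bad at hB
  push Not at hB
  obtain ⟨i, hi, v, hv, hj⟩ := hB
  refine ⟨i, hi, fun W hW hiW => ?_⟩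
  refine (fiber_split x i W hiW).trans ?_
  have hWd : W.card ≤ d := (Finset.card_le_card hW).trans hUd
  have hδ : 0 ≤ δ := le_trans (by have := prob_anti (k := k) hkn (Nat.sub_le (Fintype.card ι) d); linarith) hd
  by_cases hc : CS (W.erase i) x
  · have hcW : CS W x := recolor hk x i W v hv (fun j hjW hji => hj j (hW hjW) hji) hc
    have a1 := fiber_term hkn x i W W hiW subset_rfl d hWd ε (hnb W x hWd hcW)
    have a2 := fiber_term hkn x i W (W.erase i) hiW (Finset.erase_subset _ _) d hWd ε
      (hnb _ x ((Finset.card_le_card (Finset.erase_subset _ _)).trans hWd) hc)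
    linarith
  · have hz : ∀ W' : Finset ι, W.erase i ⊆ W' → opS (univ \ W') Jm (hS i) x = 0 := by
      intro W' hW'
      rw [opS_J_eq]
      have : ∀ y : ι → Ed n k, hS i ((univ \ W').piecewise y x) = 0 := by
        intro y
        have hn : ¬ CS (W.erase i) ((univ \ W').piecewise y x) := by
          intro h
          apply hc
          refine CS_congr ?_ h
          intro j hj
          rw [Finset.piecewise_eq_of_notMem]
          simp [hW' hj]
        have h1 : ¬ CS (univ.erase i) ((univ \ W').piecewise y x) := fun h =>
          hn (CS_mono (Finset.erase_subset_erase _ (Finset.subset_univ _)) h)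
        have h2 : ¬ CS univ ((univ \ W').piecewise y x) := fun h =>
          hn (CS_mono (Finset.subset_univ _) h)
        simp [hS, fS, h1, h2]
      simp [this]
    rw [hz W (Finset.erase_subset _ _), hz (W.erase i) subset_rfl]
    linarith
end inf
end Frd

namespace Frd
open Finset
set_option linter.unusedSectionVars false
set_option linter.unusedSimpArgs false

section badc
variable {n k : ℕ} {ι : Type} [Fintype ι] [DecidableEq ι]

lemma choose_ratio {s n : ℕ} (h : s ≤ n) (k : ℕ) : s.choose k * n ^ k ≤ n.choose k * s ^ k := by
  have hd : s.descFactorial k * n ^ k ≤ n.descFactorial k * s ^ k := by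
    induction k with
    | zero => simp
    | succ k ih =>
      rw [Nat.descFactorial_succ, Nat.descFactorial_succ, pow_succ, pow_succ]
      have h2 : (s - k) * n ≤ (n - k) * s := by
        rw [Nat.sub_mul, Nat.sub_mul, mul_comm s n]
        have : k * s ≤ k * n := Nat.mul_le_mul_left k h
        omega
      calc (s - k) * s.descFactorial k * (n ^ k * n)
          = ((s - k) * n) * (s.descFactorial k * n ^ k) := by ring
        _ ≤ ((n - k) * s) * (n.descFactorial k * s ^ k) := Nat.mul_le_mul h2 ih
        _ = _ := by ring
  rw [Nat.descFactorial_eq_factorial_mul_choose, Nat.descFactorial_eq_factorial_mul_choose,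
    mul_assoc, mul_assoc] at hd
  exact Nat.le_of_mul_le_mul_left hd (Nat.factorial_pos k)

lemma card_sub (S : Finset (Fin n)) :
    (univ.filter fun e : Ed n k => e.1 ⊆ S).card = S.card.choose k := by
  rw [← Finset.card_powersetCard]
  refine Finset.card_bij (fun e _ => e.1) ?_ ?_ ?_
  · intro e he
    rw [Finset.mem_powersetCard]
    exact ⟨(Finset.mem_filter.1 he).2, e.2⟩
  · intro a _ b _ h; exact Subtype.ext h
  · intro b hb
    rw [Finset.mem_powersetCard] at hb
    exact ⟨⟨b, hb.2⟩, by simpa using hb.1, rfl⟩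

lemma bad_cover (U : Finset ι) (x : ι → Ed n k) (h : Bad U x) :
    2 * (U.biUnion fun i => (x i).1).card ≤ k * U.card := by
  set S := U.biUnion fun i => (x i).1 with hS
  have h1 : ∑ v ∈ S, (U.filter fun i => v ∈ (x i).1).card =
      ∑ i ∈ U, (S.filter fun v => v ∈ (x i).1).card := by
    simp only [Finset.card_filter]
    exact Finset.sum_comm
  have h2 : ∑ i ∈ U, (S.filter fun v => v ∈ (x i).1).card ≤ ∑ i ∈ U, k := by
    refine Finset.sum_le_sum fun i _ => ?_
    refine le_trans (Finset.card_le_card ?_) (x i).2.le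
    intro v hv; exact (Finset.mem_filter.1 hv).2
  have h3 : ∑ v ∈ S, 2 ≤ ∑ v ∈ S, (U.filter fun i => v ∈ (x i).1).card := by
    refine Finset.sum_le_sum fun v hv => ?_
    obtain ⟨i, hi, hvi⟩ := Finset.mem_biUnion.1 hv
    obtain ⟨j, hj, hji, hvj⟩ := h i hi v hvi
    have : ({i, j} : Finset ι).card = 2 := Finset.card_pair (Ne.symm hji)
    rw [← this]
    apply Finset.card_le_card
    intro a ha
    simp only [Finset.mem_insert, Finset.mem_singleton] at ha
    rw [Finset.mem_filter]
    rcases ha with rfl | rfl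
    · exact ⟨hi, hvi⟩
    · exact ⟨hj, hvj⟩
  simp only [Finset.sum_const, smul_eq_mul] at h2 h3
  rw [mul_comm k]; omega

open Classical in
lemma bad_one (hk : 3 ≤ k) (hkn : k ≤ n) (d : ℕ) (hn : k * d ≤ n) (U : Finset ι)
    (hU : U.Nonempty) (hUd : U.card ≤ d) :
    ((univ.filter fun x : ι → Ed n k => Bad U x).card : ℝ) ≤
      ((k * d : ℕ) : ℝ) ^ (k * d) * ((n:ℝ) ^ (U.card + 1))⁻¹ * Fintype.card (ι → Ed n k) := by
  set t := U.card with ht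
  have ht1 : 1 ≤ t := hU.card_pos
  set s := k * t / 2 with hs
  have hkt : k * t ≤ k * d := Nat.mul_le_mul_left k hUd
  have hsn : s ≤ n := by omega
  have hn0 : (0:ℝ) < n := by exact_mod_cast (by omega : 0 < n)
  have hn1 : (1:ℝ) ≤ n := by exact_mod_cast (by omega : 1 ≤ n)
  have hst : s + (t + 1) ≤ k * t := by
    have : 3 * t ≤ k * t := Nat.mul_le_mul_right t hk
    omega
  -- cover
  have hcov : (univ.filter fun x : ι → Ed n k => Bad U x) ⊆
      (Finset.powersetCard s (univ : Finset (Fin n))).biUnion fun S =>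
        univ.filter fun x : ι → Ed n k => ∀ i ∈ U, (x i).1 ⊆ S := by
    intro x hx
    have hb := bad_cover U x (Finset.mem_filter.1 hx).2
    rw [← ht] at hb
    have hle : (U.biUnion fun i => (x i).1).card ≤ s := by omega
    obtain ⟨S, hS1, _, hS2⟩ := Finset.exists_subsuperset_card_eq
      (Finset.subset_univ (U.biUnion fun i => (x i).1)) hle (by simpa using hsn)
    rw [Finset.mem_biUnion]
    refine ⟨S, by simp [Finset.mem_powersetCard, hS2], ?_⟩
    simp only [Finset.mem_filter, Finset.mem_univ, true_and]
    intro i hi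
    exact (Finset.subset_biUnion_of_mem (fun i => (x i).1) hi).trans hS1
  have hone : ∀ S ∈ Finset.powersetCard s (univ : Finset (Fin n)),
      ((univ.filter fun x : ι → Ed n k => ∀ i ∈ U, (x i).1 ⊆ S).card : ℝ) ≤
        (((s:ℝ) / n) ^ k) ^ t * Fintype.card (ι → Ed n k) := by
    intro S hS
    rw [Finset.mem_powersetCard] at hS
    have e : (univ.filter fun x : ι → Ed n k => ∀ i ∈ U, (x i).1 ⊆ S) =
        Fintype.piFinset fun i => if i ∈ U then (univ.filter fun e : Ed n k => e.1 ⊆ S)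
          else univ := by
      ext x
      simp only [Finset.mem_filter, Finset.mem_univ, true_and, Fintype.mem_piFinset]
      refine forall_congr' fun i => ?_
      split_ifs with h <;> simp [h]
    rw [e, Fintype.card_piFinset]
    push_cast
    have : ∀ i ∈ (univ : Finset ι), (((if i ∈ U then (univ.filter fun e : Ed n k => e.1 ⊆ S)
        else univ).card : ℕ) : ℝ) ≤ (if i ∈ U then ((s:ℝ) / n) ^ k else 1) * Fintype.card (Ed n k) := by
      intro i _
      split_ifs with h
      · rw [card_sub, hS.2, card_Ed, div_pow, div_mul_eq_mul_div, le_div_iff₀ (by positivity)]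
        have := choose_ratio hsn k
        rw [mul_comm ((s:ℝ) ^ k)]
        exact_mod_cast this
      · simp
    refine (Finset.prod_le_prod (fun _ _ => by positivity) this).trans (le_of_eq ?_)
    rw [Finset.prod_mul_distrib, Finset.prod_ite, Finset.prod_const, Finset.prod_const_one, mul_one,
      Finset.prod_const, Fintype.card_fun]
    simp [ht]
  have hcard : ((univ.filter fun x : ι → Ed n k => Bad U x).card : ℝ) ≤
      ∑ S ∈ Finset.powersetCard s (univ : Finset (Fin n)),
        ((univ.filter fun x : ι → Ed n k => ∀ i ∈ U, (x i).1 ⊆ S).card : ℝ) := by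
    exact_mod_cast (Finset.card_le_card hcov).trans Finset.card_biUnion_le
  refine hcard.trans ((Finset.sum_le_sum hone).trans ?_)
  rw [Finset.sum_const, Finset.card_powersetCard, Finset.card_univ, Fintype.card_fin, nsmul_eq_mul,
    ← mul_assoc]
  have hK : (0:ℝ) ≤ Fintype.card (ι → Ed n k) := by positivity
  refine mul_le_mul_of_nonneg_right ?_ hK
  have hch : ((n.choose s : ℕ) : ℝ) ≤ (n:ℝ) ^ s := by exact_mod_cast Nat.choose_le_pow n s
  have hA : (s:ℝ) ^ (k * t) ≤ ((k * d : ℕ) : ℝ) ^ (k * d) := by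
    have h1 : 1 ≤ k * d := by
      have : 3 * t ≤ k * t := Nat.mul_le_mul_right t hk
      omega
    have : s ^ (k * t) ≤ (k * d) ^ (k * d) := by
      calc s ^ (k * t) ≤ (k * d) ^ (k * t) := Nat.pow_le_pow_left (by omega) _
        _ ≤ _ := Nat.pow_le_pow_right h1 hkt
    exact_mod_cast this
  rw [← pow_mul, div_pow]
  calc ((n.choose s : ℕ) : ℝ) * ((s:ℝ) ^ (k * t) / (n:ℝ) ^ (k * t))
      ≤ (n:ℝ) ^ s * (((k * d : ℕ) : ℝ) ^ (k * d) / (n:ℝ) ^ (k * t)) := by gcongr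
    _ ≤ (n:ℝ) ^ s * (((k * d : ℕ) : ℝ) ^ (k * d) / (n:ℝ) ^ (s + (t + 1))) := by
        gcongr
    _ = _ := by
        rw [pow_add _ s]; field_simp

open Classical in
lemma bad_sum (hk : 3 ≤ k) (hkn : k ≤ n) (d : ℕ) (hn : k * d ≤ n) (R : ℝ) (hR : 1 ≤ R)
    (hm : (Fintype.card ι : ℝ) ≤ R * n) :
    ∑ U : Finset ι, (if U.Nonempty ∧ U.card ≤ d then
      ((univ.filter fun x : ι → Ed n k => Bad U x).card : ℝ) else 0) ≤
      (((k * d : ℕ) : ℝ) ^ (k * d) * (d + 1) * R ^ d / n) * Fintype.card (ι → Ed n k) := by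
  set A : ℝ := ((k * d : ℕ) : ℝ) ^ (k * d) with hA
  set K : ℝ := ((Fintype.card (ι → Ed n k) : ℕ) : ℝ) with hK
  have hn0 : (0:ℝ) < n := by exact_mod_cast (by omega : 0 < n)
  have h1 : ∀ U ∈ (univ : Finset (Finset ι)), (if U.Nonempty ∧ U.card ≤ d then
      ((univ.filter fun x : ι → Ed n k => Bad U x).card : ℝ) else 0) ≤
      (fun j : ℕ => if j ≤ d then A * ((n:ℝ) ^ (j + 1))⁻¹ * K else 0) U.card := by
    intro U _
    by_cases h : U.Nonempty ∧ U.card ≤ d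
    · simp only [h, and_self, if_true]
      exact bad_one hk hkn d hn U h.1 h.2
    · rw [if_neg h]
      dsimp only
      split_ifs <;> positivity
  refine (Finset.sum_le_sum h1).trans ?_
  rw [← Finset.powerset_univ, Finset.sum_powerset_apply_card
    (fun j : ℕ => if j ≤ d then A * ((n:ℝ) ^ (j + 1))⁻¹ * K else 0)]
  have h2 : ∀ j ∈ Finset.range ((univ : Finset ι).card + 1),
      (univ : Finset ι).card.choose j • (if j ≤ d then A * ((n:ℝ) ^ (j + 1))⁻¹ * K else 0) ≤
      if j ≤ d then A * R ^ d / n * K else 0 := by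
    intro j _
    split_ifs with hj
    · rw [nsmul_eq_mul, Finset.card_univ]
      have hc : (((Fintype.card ι).choose j : ℕ) : ℝ) ≤ (R * n) ^ j := by
        calc (((Fintype.card ι).choose j : ℕ) : ℝ) ≤ (Fintype.card ι : ℝ) ^ j := by
              exact_mod_cast Nat.choose_le_pow _ j
          _ ≤ _ := by gcongr
      calc (((Fintype.card ι).choose j : ℕ) : ℝ) * (A * ((n:ℝ) ^ (j + 1))⁻¹ * K)
          ≤ (R * n) ^ j * (A * ((n:ℝ) ^ (j + 1))⁻¹ * K) := by gcongr
        _ = A * R ^ j / n * K := by rw [mul_pow]; field_simp; ring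
        _ ≤ A * R ^ d / n * K := by gcongr
    · simp
  refine (Finset.sum_le_sum h2).trans ?_
  rw [← Finset.sum_filter, Finset.sum_const, nsmul_eq_mul]
  have h3 : (((Finset.range ((univ : Finset ι).card + 1)).filter fun j => j ≤ d).card : ℝ) ≤ d + 1 := by
    have : ((Finset.range ((univ : Finset ι).card + 1)).filter fun j => j ≤ d).card ≤
        (Finset.range (d + 1)).card := by
      apply Finset.card_le_card
      intro j hj
      have := (Finset.mem_filter.1 hj).2
      rw [Finset.mem_range]; omega
    rw [Finset.card_range] at this
    exact_mod_cast this
  calc _ ≤ ((d:ℝ) + 1) * (A * R ^ d / n * K) := by gcongr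
    _ = _ := by ring
end badc
end Frd

namespace Frd
open Finset
set_option linter.unusedSectionVars false
set_option linter.unusedSimpArgs false

section blowup

open Classical in
lemma edge_prob {n k : ℕ} (hkn : k ≤ n) (hk : 1 ≤ k) (P : Fin n → Prop) :
    (max 0 (pr P - (k:ℝ) / n)) ^ k ≤ pr (fun e : Ed n k => ∀ w ∈ e.1, P w) := by
  set S : Finset (Fin n) := univ.filter P with hS
  set r := S.card with hr
  have hn0 : (0:ℝ) < n := by exact_mod_cast (by omega : 0 < n)
  have e1 : pr P = (r:ℝ) / n := by unfold pr; rw [Fintype.card_fin]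
  have e2 : pr (fun e : Ed n k => ∀ w ∈ e.1, P w) = (r.choose k : ℝ) / (n.choose k) := by
    rw [hr, ← card_sub (k := k) S]
    unfold pr
    rw [card_Ed]
    congr 3
    ext e
    simp [hS, Finset.subset_iff]
  rw [e1, e2, ← sub_div]
  by_cases hrk : r ≤ k
  · have : ((r:ℝ) - k) / n ≤ 0 := by
      apply div_nonpos_of_nonpos_of_nonneg _ hn0.le
      have : (r:ℝ) ≤ k := by exact_mod_cast hrk
      linarith
    rw [max_eq_left this, zero_pow (by omega)]
    positivity
  · push Not at hrk
    have hge : 0 ≤ ((r:ℝ) - k) / n := by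
      apply div_nonneg _ hn0.le
      have : (k:ℝ) ≤ r := by exact_mod_cast hrk.le
      linarith
    have hc : (0:ℝ) < n.choose k := by exact_mod_cast Nat.choose_pos hkn
    rw [max_eq_right hge, div_pow, div_le_div_iff₀ (by positivity) hc]
    have e3 : (r:ℝ) - k = ((r - k : ℕ) : ℝ) := by rw [Nat.cast_sub hrk.le]
    rw [e3]
    have h1 : (r - k) ^ k ≤ r.descFactorial k :=
      (Nat.pow_le_pow_left (by omega) k).trans (Nat.pow_sub_le_descFactorial r k)
    have h2 : n.descFactorial k ≤ n ^ k := Nat.descFactorial_le_pow n k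
    have h3 : (r - k) ^ k * n.descFactorial k ≤ r.descFactorial k * n ^ k := Nat.mul_le_mul h1 h2
    rw [Nat.descFactorial_eq_factorial_mul_choose, Nat.descFactorial_eq_factorial_mul_choose] at h3
    have h4 : (r - k) ^ k * n.choose k ≤ r.choose k * n ^ k := by
      apply Nat.le_of_mul_le_mul_left _ (Nat.factorial_pos k)
      calc _ = (r - k) ^ k * (k.factorial * n.choose k) := by ring
        _ ≤ _ := h3
        _ = _ := by ring
    exact_mod_cast h4

lemma blow_step {n k : ℕ} (hkn : k ≤ n) (hk : 1 ≤ k) {Y : Type} [Fintype Y] [Nonempty Y]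
    (R : Y → Fin n → Prop) (β : ℝ) (h : β ≤ pr (fun z : Y × Fin n => R z.1 z.2))
    (hβ : (k:ℝ) / n ≤ β) :
    (β - (k:ℝ) / n) ^ k ≤ pr (fun z : Y × Ed n k => ∀ w ∈ z.2.1, R z.1 w) := by
  rw [pr_prod] at h ⊢
  simp only at h ⊢
  have hY : (0:ℝ) < Fintype.card Y := by exact_mod_cast Fintype.card_pos
  have hJ := Real.pow_arith_mean_le_arith_mean_pow univ (fun _ : Y => (Fintype.card Y : ℝ)⁻¹)
    (fun y => max 0 (pr (R y) - (k:ℝ) / n)) (fun _ _ => by positivity)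
    (by simp [hY.ne']) (fun _ _ => le_max_left _ _) k
  have h1 : β - (k:ℝ) / n ≤
      ∑ y : Y, (Fintype.card Y : ℝ)⁻¹ * max 0 (pr (R y) - (k:ℝ) / n) := by
    calc β - (k:ℝ) / n ≤ (∑ a, pr (R a)) / Fintype.card Y - (k:ℝ) / n := by
          have : (∑ a, pr (R a)) / Fintype.card Y = (∑ a, pr fun b => R a b) / Fintype.card Y := rfl
          linarith
      _ = ∑ y : Y, (Fintype.card Y : ℝ)⁻¹ * (pr (R y) - (k:ℝ) / n) := by
          rw [← Finset.mul_sum, Finset.sum_sub_distrib, Finset.sum_const, Finset.card_univ,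
            nsmul_eq_mul]
          field_simp
      _ ≤ _ := by
          gcongr
          exact le_max_right _ _
  calc (β - (k:ℝ) / n) ^ k ≤ _ := pow_le_pow_left₀ (by linarith) h1 k
    _ ≤ _ := hJ
    _ ≤ ∑ y : Y, (Fintype.card Y : ℝ)⁻¹ * pr (fun e : Ed n k => ∀ w ∈ e.1, R y w) := by
        gcongr
        exact edge_prob hkn hk _
    _ = _ := by rw [← Finset.mul_sum, inv_mul_eq_div]

def eqv1 (Y A : Type) (l : ℕ) : (Y × (Fin l → A)) × A ≃ Y × (Fin (l + 1) → A) where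
  toFun z := (z.1.1, Fin.cons z.2 z.1.2)
  invFun z := ((z.1, Fin.tail z.2), z.2 0)
  left_inv z := by simp
  right_inv z := by simp

def eqv2 (Y A : Type) (l : ℕ) : (Y × A) × (Fin l → A) ≃ Y × (Fin (l + 1) → A) where
  toFun z := (z.1.1, Fin.cons z.1.2 z.2)
  invFun z := ((z.1, z.2 0), Fin.tail z.2)
  left_inv z := by simp
  right_inv z := by simp

def eqv3 (Y A B : Type) : (Y × A) × B ≃ (Y × B) × A where
  toFun z := ((z.1.1, z.2), z.1.2)
  invFun z := ((z.1.1, z.2), z.1.2)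
  left_inv z := by simp
  right_inv z := by simp

theorem blow (k : ℕ) (hk : 1 ≤ k) (l : ℕ) : ∀ β : ℝ, 0 < β → ∃ β' : ℝ, 0 < β' ∧ ∃ n0 : ℕ,
    ∀ n, n0 ≤ n → k ≤ n → ∀ (Y : Type) [Fintype Y] [Nonempty Y] (G : Y → Prop)
      (F : Y → (Fin n → Bool) → Prop) (q : Fin l → Bool),
      β ≤ pr (fun z : Y × (Fin l → Fin n) => G z.1 ∧ ¬ ∃ c, F z.1 c ∧ ∀ j, c (z.2 j) = q j) →
      β' ≤ pr (fun z : Y × (Fin l → Ed n k) => G z.1 ∧ ¬ ∃ c, F z.1 c ∧ ∀ j, NM c (z.2 j)) := by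
  induction l with
  | zero =>
    intro β hβ
    refine ⟨β, hβ, 0, ?_⟩
    intro n _ hkn Y _ _ G F q h
    have e1 := pr_fst (β := Fin 0 → Fin n) (fun y : Y => G y ∧ ¬ ∃ c, F y c)
    have e2 := pr_fst (β := Fin 0 → Ed n k) (fun y : Y => G y ∧ ¬ ∃ c, F y c)
    simp only [IsEmpty.forall_iff, and_true] at h ⊢
    rw [e2, ← e1]; exact h
  | succ l ih =>
    intro β hβ
    obtain ⟨β', hβ', n0, hn0⟩ := ih ((β / 2) ^ k) (by positivity)
    refine ⟨β', hβ', max n0 (⌈2 * k / β⌉₊ + 1), ?_⟩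
    intro n hn hkn Y _ _ G F q h
    have hnn0 : n0 ≤ n := (le_max_left _ _).trans hn
    have hn2 : ⌈2 * k / β⌉₊ + 1 ≤ n := (le_max_right _ _).trans hn
    have hnpos : (0:ℝ) < n := by exact_mod_cast (by omega : 0 < n)
    have : Nonempty (Fin n) := ⟨⟨0, by omega⟩⟩
    have := Ed_nonempty hkn
    have hkb : (k:ℝ) / n ≤ β / 2 := by
      have h1 : 2 * k / β ≤ n := (Nat.le_ceil _).trans (Nat.cast_le.2 (by omega))
      rw [div_le_iff₀ hβ] at h1
      rw [div_le_iff₀ hnpos]; linarith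
    rw [← pr_equiv (eqv1 Y (Fin n) l)] at h
    have hs := blow_step hkn hk (Y := Y × (Fin l → Fin n))
      (fun y w => G y.1 ∧ ¬ ∃ c, F y.1 c ∧ ∀ j, c ((Fin.cons w y.2 : Fin (l+1) → Fin n) j) = q j)
      β h (by linarith)
    have hs2 : (β / 2) ^ k ≤ (β - (k:ℝ) / n) ^ k := pow_le_pow_left₀ (by positivity) (by linarith) k
    have hs3 := hs2.trans hs
    have key := hn0 n hnn0 hkn (Y × Ed n k) (fun y => G y.1) (fun y c => F y.1 c ∧ NM c y.2)
      (fun j => q j.succ) (by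
        refine hs3.trans ?_
        rw [← pr_equiv (eqv3 Y (Fin l → Fin n) (Ed n k))]
        apply pr_mono
        rintro ⟨⟨y, w⟩, e⟩ hz
        simp only [eqv3, Equiv.coe_fn_mk] at hz ⊢
        have hne : e.1.Nonempty := by
          rw [← Finset.card_pos, e.2]; omega
        obtain ⟨a, ha⟩ := hne
        refine ⟨(hz a ha).1, ?_⟩
        rintro ⟨c, ⟨hFc, u, hu, v, hv, huv⟩, hc⟩
        have hall : ∀ a ∈ e.1, c a ≠ q 0 := by
          intro a ha hca
          refine (hz a ha).2 ⟨c, hFc, ?_⟩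
          intro j
          refine Fin.cases ?_ (fun j => ?_) j
          · simpa using hca
          · simpa using hc j
        have h1 := hall u hu
        have h2 := hall v hv
        revert huv h1 h2
        cases c u <;> cases c v <;> cases q 0 <;> simp)
    refine key.trans ?_
    rw [← pr_equiv (eqv2 Y (Ed n k) l)]
    apply pr_mono
    rintro ⟨⟨y, e⟩, es⟩ ⟨hG, hz⟩
    refine ⟨hG, ?_⟩
    rintro ⟨c, hFc, hc⟩
    refine hz ⟨c, ⟨hFc, ?_⟩, fun j => ?_⟩
    · simpa [eqv2] using hc 0
    · simpa [eqv2] using hc j.succ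

end blowup
end Frd

namespace Frd
open Finset
set_option linter.unusedSectionVars false
set_option linter.unusedSimpArgs false

section nb

/-- no proper coloring with the prescribed pattern although colorable -/
def Bd {n k m L : ℕ} (q : Fin L → Bool) (w : Fin L → Fin n) (y : Fin m → Ed n k) : Prop :=
  CS univ y ∧ ¬ ∃ c : Fin n → Bool, (∀ i, NM c (y i)) ∧ ∀ j, c (w j) = q j

def edPerm {n k : ℕ} (pp : Equiv.Perm (Fin n)) : Ed n k ≃ Ed n k where
  toFun e := ⟨e.1.map pp.toEmbedding, by rw [Finset.card_map]; exact e.2⟩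
  invFun e := ⟨e.1.map pp.symm.toEmbedding, by rw [Finset.card_map]; exact e.2⟩
  left_inv e := by ext; simp
  right_inv e := by ext; simp

lemma NM_perm {n k : ℕ} (pp : Equiv.Perm (Fin n)) (c : Fin n → Bool) (e : Ed n k) :
    NM c (edPerm pp e) ↔ NM (fun v => c (pp v)) e := by
  unfold NM edPerm
  constructor
  · rintro ⟨u, hu, v, hv, huv⟩
    simp only [Equiv.coe_fn_mk, Finset.mem_map, Equiv.coe_toEmbedding] at hu hv
    obtain ⟨a, ha, rfl⟩ := hu
    obtain ⟨b, hb, rfl⟩ := hv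
    exact ⟨a, ha, b, hb, huv⟩
  · rintro ⟨u, hu, v, hv, huv⟩
    exact ⟨pp u, by simpa using hu, pp v, by simpa using hv, huv⟩

lemma exists_perm {n L : ℕ} {w0 w : Fin L → Fin n} (h0 : Function.Injective w0)
    (h : Function.Injective w) : ∃ pp : Equiv.Perm (Fin n), ∀ j, pp (w0 j) = w j := by
  classical
  let e : {x // x ∈ Set.range w0} ≃ {x // x ∈ Set.range w} :=
    (Equiv.ofInjective w0 h0).symm.trans (Equiv.ofInjective w h)
  refine ⟨e.extendSubtype, fun j => ?_⟩
  rw [Equiv.extendSubtype_apply_of_mem e (w0 j) ⟨j, rfl⟩]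
  have : (⟨w0 j, ⟨j, rfl⟩⟩ : {x // x ∈ Set.range w0}) = Equiv.ofInjective w0 h0 j := rfl
  rw [this]
  simp [e]

lemma Bd_perm {n k m L : ℕ} (q : Fin L → Bool) {w0 w : Fin L → Fin n}
    (h0 : Function.Injective w0) (h : Function.Injective w) :
    pr (fun y : Fin m → Ed n k => Bd q w0 y) ≤ pr (fun y : Fin m → Ed n k => Bd q w y) := by
  obtain ⟨pp, hpp⟩ := exists_perm h0 h
  rw [← pr_equiv (Equiv.arrowCongr (Equiv.refl (Fin m)) (edPerm pp)) (fun y => Bd q w y)]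
  apply pr_mono
  rintro y ⟨⟨c, hc⟩, hno⟩
  refine ⟨⟨fun v => c (pp.symm v), fun i hi => ?_⟩, ?_⟩
  · simp only [Equiv.arrowCongr_apply, Function.comp_apply, NM_perm]
    simpa using hc i hi
  · rintro ⟨c', hc', hq⟩
    refine hno ⟨fun v => c' (pp v), fun i => ?_, fun j => ?_⟩
    · have := hc' i
      simp only [Equiv.arrowCongr_apply, Function.comp_apply, NM_perm] at this
      simpa using this
    · simp only [hpp]; exact hq j

lemma inj_density {n L : ℕ} (hL : 2 * L ^ 2 ≤ n) (hLn : L ≤ n) (hn : 0 < n) :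
    (1:ℝ) / 2 ≤ (n.descFactorial L : ℝ) / (n:ℝ) ^ L := by
  have hn0 : (0:ℝ) < n := by exact_mod_cast hn
  have h1 : (n - L) ^ L ≤ n.descFactorial L :=
    (Nat.pow_le_pow_left (by omega) L).trans (Nat.pow_sub_le_descFactorial n L)
  have h2 : ((n:ℝ) - L) ^ L ≤ n.descFactorial L := by
    rw [← Nat.cast_sub hLn]; exact_mod_cast h1
  have h3 : 1 + (L:ℝ) * (-(L / n)) ≤ (1 + -((L:ℝ) / n)) ^ L := by
    apply one_add_mul_le_pow
    have : (L:ℝ) / n ≤ 1 := by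
      rw [div_le_one hn0]; exact_mod_cast hLn
    linarith
  have h4 : (L:ℝ) * (L / n) ≤ 1 / 2 := by
    rw [← mul_div_assoc, div_le_iff₀ hn0]
    have : 2 * (L:ℝ) ^ 2 ≤ n := by exact_mod_cast hL
    nlinarith
  calc (1:ℝ) / 2 ≤ (1 + -((L:ℝ) / n)) ^ L := by linarith
    _ = ((n:ℝ) - L) ^ L / (n:ℝ) ^ L := by rw [← div_pow]; congr 1; field_simp; ring
    _ ≤ _ := by gcongr

lemma card_inj (n L : ℕ) [DecidablePred fun w : Fin L → Fin n => Function.Injective w] :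
    (univ.filter fun w : Fin L → Fin n => Function.Injective w).card = n.descFactorial L := by
  classical
  have h := Fintype.card_embedding_eq (α := Fin L) (β := Fin n)
  rw [Fintype.card_fin, Fintype.card_fin] at h
  rw [← h, ← Fintype.card_congr (Equiv.subtypeInjectiveEquivEmbedding (Fin L) (Fin n)),
    Fintype.card_subtype]

theorem noboost (k : ℕ) (hk : 1 ≤ k) (d : ℕ) (ε : ℝ) (hε : 0 < ε) :
    ∃ β : ℝ, 0 < β ∧ ∃ n0 : ℕ, ∀ n, n0 ≤ n → k ≤ n → ∀ m : ℕ,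
      probTwoColorable k n m - probTwoColorable k n (m + k * d) < β →
      ∀ (W : Finset (Fin m)) (x : Fin m → Ed n k), W.card ≤ d → CS W x →
        probTwoColorable k n m - ε ≤ pr (fun y => CS univ ((univ \ W).piecewise y x)) := by
  classical
  obtain ⟨β, hβ, n1, hn1⟩ := blow k hk (k * d) (ε / 2) (by positivity)
  set L := k * d with hL
  refine ⟨β, hβ, max n1 (max (2 * L ^ 2) L), ?_⟩
  intro n hn hkn m hm W x hWd hW
  have hn1' : n1 ≤ n := (le_max_left _ _).trans hn
  have hn2 : 2 * L ^ 2 ≤ n := (le_max_left _ _).trans ((le_max_right _ _).trans hn)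
  have hn3 : L ≤ n := (le_max_right _ _).trans ((le_max_right _ _).trans hn)
  have hnp : 0 < n := by omega
  have := Ed_nonempty hkn
  by_contra hcon
  push Not at hcon
  obtain ⟨c0, hc0⟩ := hW
  have hSc : (W.biUnion fun i => (x i).1).card ≤ L := by
    refine Finset.card_biUnion_le.trans ?_
    calc ∑ i ∈ W, (x i).1.card = ∑ i ∈ W, k := Finset.sum_congr rfl fun i _ => (x i).2
      _ = W.card * k := by simp
      _ ≤ d * k := Nat.mul_le_mul_right k hWd
      _ = L := by rw [hL, mul_comm]
  obtain ⟨S, hS1, _, hS2⟩ := Finset.exists_subsuperset_card_eq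
      (Finset.subset_univ (W.biUnion fun i => (x i).1)) hSc (by simpa using hn3)
  set w0 : Fin L → Fin n := fun j => ((S.equivFinOfCardEq hS2).symm j).1 with hw0
  have hw0i : Function.Injective w0 := fun a b h =>
    (S.equivFinOfCardEq hS2).symm.injective (Subtype.ext h)
  have hw0S : ∀ v ∈ S, ∃ j, w0 j = v := fun v hv =>
    ⟨S.equivFinOfCardEq hS2 ⟨v, hv⟩, by simp [hw0]⟩
  set q : Fin L → Bool := fun j => c0 (w0 j) with hq
  have hb0 : ε ≤ pr (fun y : Fin m → Ed n k => Bd q w0 y) := by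
    have h1 := pr_split (fun y : Fin m → Ed n k => CS univ y)
      (fun y => CS univ ((univ \ W).piecewise y x))
    rw [← prob_eq] at h1
    have h2 : pr (fun y : Fin m → Ed n k => CS univ y ∧ ¬ CS univ ((univ \ W).piecewise y x)) ≤
        pr (fun y : Fin m → Ed n k => Bd q w0 y) := by
      apply pr_mono
      rintro y ⟨hy, hny⟩
      refine ⟨hy, ?_⟩
      rintro ⟨c, hc, hcq⟩
      apply hny
      refine ⟨c, fun i _ => ?_⟩
      by_cases hi : i ∈ W
      · rw [Finset.piecewise_eq_of_notMem _ _ _ (by simp [hi])]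
        obtain ⟨u, hu, v, hv, huv⟩ := hc0 i hi
        have hagree : ∀ a ∈ (x i).1, c a = c0 a := by
          intro a ha
          obtain ⟨j, hj⟩ := hw0S a (hS1 (Finset.mem_biUnion.2 ⟨i, hi, ha⟩))
          rw [← hj]; exact hcq j
        exact ⟨u, hu, v, hv, by rw [hagree u hu, hagree v hv]; exact huv⟩
      · rw [Finset.piecewise_eq_of_mem _ _ _ (by simp [hi])]
        exact hc i
    linarith
  have hdens : ε / 2 ≤ pr (fun z : (Fin m → Ed n k) × (Fin L → Fin n) => CS univ z.1 ∧
      ¬ ∃ c : Fin n → Bool, (∀ i, NM c (z.1 i)) ∧ ∀ j, c (z.2 j) = q j) := by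
    rw [← pr_equiv (Equiv.prodComm (Fin L → Fin n) (Fin m → Ed n k)), pr_prod]
    have hc : (Fintype.card (Fin L → Fin n) : ℝ) = (n:ℝ) ^ L := by simp
    rw [hc]
    have h1 : (n.descFactorial L : ℝ) * ε ≤ ∑ w : Fin L → Fin n,
        pr (fun y : Fin m → Ed n k => Bd q w y) := by
      rw [← card_inj, ← nsmul_eq_mul, ← Finset.sum_const]
      calc _ ≤ ∑ w ∈ univ.filter (fun w : Fin L → Fin n => Function.Injective w),
            pr (fun y : Fin m → Ed n k => Bd q w y) := by
            refine Finset.sum_le_sum fun w hw => hb0.trans ?_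
            exact Bd_perm q hw0i (Finset.mem_filter.1 hw).2
        _ ≤ _ := Finset.sum_le_sum_of_subset_of_nonneg (Finset.filter_subset _ _)
            fun _ _ _ => pr_nonneg _
    have hn0 : (0:ℝ) < n := by exact_mod_cast hnp
    calc ε / 2 = 1 / 2 * ε := by ring
      _ ≤ (n.descFactorial L : ℝ) / (n:ℝ) ^ L * ε :=
          mul_le_mul_of_nonneg_right (inj_density hn2 hn3 hnp) hε.le
      _ = (n.descFactorial L : ℝ) * ε / (n:ℝ) ^ L := by ring
      _ ≤ (∑ w : Fin L → Fin n, pr (fun y : Fin m → Ed n k => Bd q w y)) / (n:ℝ) ^ L := by gcongr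
      _ = _ := rfl
  have key := hn1 n hn1' hkn (Fin m → Ed n k) (fun y => CS univ y) (fun y c => ∀ i, NM c (y i))
    q hdens
  rw [pr_sdiff (P := fun z : (Fin m → Ed n k) × (Fin L → Ed n k) => CS univ z.1)
    (Q := fun z => ∃ c : Fin n → Bool, (∀ i, NM c (z.1 i)) ∧ ∀ j, NM c (z.2 j))
    (by rintro z ⟨c, hc, _⟩; exact ⟨c, fun i _ => hc i⟩), pr_fst (fun y : Fin m → Ed n k => CS univ y),
    ← prob_eq, ← pr_equiv (Equiv.sumArrowEquivProdArrow (Fin m) (Fin L) (Ed n k))] at key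
  have h2 := pr_CS (k := k) hkn (univ : Finset (Fin m ⊕ Fin L))
  rw [Finset.card_univ, Fintype.card_sum, Fintype.card_fin, Fintype.card_fin] at h2
  have h3 : pr (fun a : Fin m ⊕ Fin L → Ed n k => ∃ c : Fin n → Bool,
      (∀ i, NM c ((Equiv.sumArrowEquivProdArrow (Fin m) (Fin L) (Ed n k) a).1 i)) ∧
      ∀ j, NM c ((Equiv.sumArrowEquivProdArrow (Fin m) (Fin L) (Ed n k) a).2 j)) =
      probTwoColorable k n (m + L) := by
    rw [← h2]
    refine pr_congr fun a => ?_
    simp [CS, Equiv.sumArrowEquivProdArrow]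
  rw [h3] at key
  linarith
end nb
end Frd

namespace Frd
open Finset
set_option linter.unusedSectionVars false
set_option linter.unusedSimpArgs false

theorem core (k : ℕ) (hk : 3 ≤ k) (R c1 v : ℝ) (hR : 1 ≤ R) (hc1 : 0 ≤ c1) (hv : 0 < v) :
    ∃ D : ℕ, 1 ≤ D ∧ ∃ γ : ℝ, 0 < γ ∧ ∃ n0 : ℕ, ∀ n, n0 ≤ n → k ≤ n → ∀ m : ℕ, (m:ℝ) ≤ R * n →
      probTwoColorable k n (m - 1) - probTwoColorable k n m ≤ c1 / n →
      probTwoColorable k n (m - D) - probTwoColorable k n (m + D) ≤ γ →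
      probTwoColorable k n m - probTwoColorable k n m ^ 2 < v := by
  obtain ⟨d, ε, hε, hana⟩ := analytic (2 * R * c1) v (by positivity) hv
  obtain ⟨β, hβ, n1, hnb⟩ := noboost k (by omega) d (ε / 4) (by positivity)
  set A : ℝ := ((k * d : ℕ) : ℝ) ^ (k * d) * (d + 1) * R ^ d with hA
  refine ⟨d + k * d + 1, by omega, min (ε / 4) (β / 2), by positivity,
    max n1 (max (k * d) (⌈A / ε⌉₊ + 1)), ?_⟩
  intro n hn hkn m hmR hstep hwin
  have hn1 : n1 ≤ n := (le_max_left _ _).trans hn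
  have hn2 : k * d ≤ n := (le_max_left _ _).trans ((le_max_right _ _).trans hn)
  have hn3 : ⌈A / ε⌉₊ + 1 ≤ n := (le_max_right _ _).trans ((le_max_right _ _).trans hn)
  have hn0 : (0:ℝ) < n := by exact_mod_cast (by omega : 0 < n)
  have := Ed_nonempty hkn
  have hanti := prob_anti (k := k) hkn
  have hg1 : probTwoColorable k n (m - d) - probTwoColorable k n m ≤ ε / 4 := by
    have h1 := hanti (show m - (d + k * d + 1) ≤ m - d by omega)
    have h2 := hanti (show m ≤ m + (d + k * d + 1) by omega)
    linarith [min_le_left (ε / 4) (β / 2)]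
  have hg2 : probTwoColorable k n m - probTwoColorable k n (m + k * d) < β := by
    have h1 := hanti (show m - (d + k * d + 1) ≤ m by omega)
    have h2 := hanti (show m + k * d ≤ m + (d + k * d + 1) by omega)
    linarith [min_le_right (ε / 4) (β / 2)]
  have hK : (Fintype.card (Fin m → Ed n k) : ℝ) ≠ 0 := cardne
  have h := hana (Fin m) (Ed n k) (fS univ) (fS_range univ) (fun U x => Bad U x) ?_ ?_ ?_
  · have e : ∑ x : Fin m → Ed n k, fS univ x ^ 2 = ∑ x : Fin m → Ed n k, fS univ x :=
      Finset.sum_congr rfl fun x _ => fS_sq _ x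
    rw [e, sum_fS hkn, mul_div_cancel_right₀ _ hK] at h
    simpa using h
  · refine (influence hkn).trans ?_
    rw [Fintype.card_fin]
    refine mul_le_mul_of_nonneg_right ?_ (by positivity)
    calc 2 * (m:ℝ) * (probTwoColorable k n (m - 1) - probTwoColorable k n m)
        ≤ 2 * (m:ℝ) * (c1 / n) := by gcongr
      _ ≤ 2 * (R * n) * (c1 / n) := by gcongr
      _ = 2 * R * c1 := by field_simp
  · refine (bad_sum hk hkn d hn2 R hR (by simpa using hmR)).trans ?_
    refine mul_le_mul_of_nonneg_right ?_ (by positivity)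
    rw [← hA, div_le_iff₀ hn0]
    have : A / ε ≤ n := (Nat.le_ceil _).trans (Nat.cast_le.2 (by omega))
    rw [div_le_iff₀ hε] at this
    linarith
  · intro U x _ hUd hB
    obtain ⟨i, hi, hW⟩ := good hkn (by omega) d (ε / 4) (ε / 4) (by positivity)
      (by simpa using hg1) (fun W x hW hc => by
        have := hnb n hn1 hkn m hg2 W x hW hc
        simpa using this) U x hUd hB
    refine ⟨i, hi, fun W hWU hiW => (hW W hWU hiW).trans ?_⟩
    linarith

lemma tele (f : ℕ → ℝ) (hf : ∀ i, 0 ≤ f i ∧ f i ≤ 1) (b M e : ℕ) :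
    ∑ i ∈ Finset.range M, (f (b + i) - f (b + i + e)) ≤ e := by
  induction e with
  | zero => simp
  | succ e ih =>
    have h1 : ∑ i ∈ Finset.range M, (f (b + e + i) - f (b + e + (i + 1))) =
        f (b + e + 0) - f (b + e + M) := Finset.sum_range_sub' (fun i => f (b + e + i)) M
    have h2 : ∑ i ∈ Finset.range M, (f (b + i) - f (b + i + (e + 1))) =
        ∑ i ∈ Finset.range M, (f (b + i) - f (b + i + e)) +
        ∑ i ∈ Finset.range M, (f (b + e + i) - f (b + e + (i + 1))) := by
      rw [← Finset.sum_add_distrib]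
      refine Finset.sum_congr rfl fun i _ => ?_
      have a1 : b + e + i = b + i + e := by ring
      have a2 : b + e + (i + 1) = b + i + (e + 1) := by ring
      rw [a1, a2]; ring
    rw [h2, h1]
    push_cast
    linarith [(hf (b + e + 0)).2, (hf (b + e + M)).1]

lemma select (f : ℕ → ℝ) (hf : ∀ i, 0 ≤ f i ∧ f i ≤ 1) (hanti : Antitone f) (a M D : ℕ)
    (A γ : ℝ) (hD : 1 ≤ D) (hA : 0 < A) (hγ : 0 < γ) (h : A⁻¹ + 2 * D / γ < M) :
    ∃ j, a ≤ j ∧ j < a + M ∧ f (j + D - 1) - f (j + D) ≤ A ∧ f j - f (j + 2 * D) ≤ γ := by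
  by_contra hcon
  push Not at hcon
  have h1 : ∀ i ∈ Finset.range M, (1:ℝ) ≤ (f (a + (D - 1) + i) - f (a + (D - 1) + i + 1)) / A +
      (f (a + i) - f (a + i + 2 * D)) / γ := by
    intro i hi
    rw [Finset.mem_range] at hi
    have e1 : a + (D - 1) + i = a + i + D - 1 := by omega
    have e2 : a + (D - 1) + i + 1 = a + i + D := by omega
    rw [e2, e1]
    have n1 : 0 ≤ (f (a + i + D - 1) - f (a + i + D)) / A := by
      have := hanti (show a + i + D - 1 ≤ a + i + D by omega)
      apply div_nonneg _ hA.le; linarith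
    have n2 : 0 ≤ (f (a + i) - f (a + i + 2 * D)) / γ := by
      have := hanti (show a + i ≤ a + i + 2 * D by omega)
      apply div_nonneg _ hγ.le; linarith
    by_cases hc : f (a + i + D - 1) - f (a + i + D) ≤ A
    · have := hcon (a + i) (by omega) (by omega) hc
      have : 1 ≤ (f (a + i) - f (a + i + 2 * D)) / γ := by rw [one_le_div hγ]; exact this.le
      linarith
    · push Not at hc
      have : 1 ≤ (f (a + i + D - 1) - f (a + i + D)) / A := by rw [one_le_div hA]; exact hc.le
      linarith
  have h2 := Finset.sum_le_sum h1
  rw [Finset.sum_add_distrib, ← Finset.sum_div, ← Finset.sum_div] at h2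
  have t1 := tele f hf (a + (D - 1)) M 1
  have t2 := tele f hf a M (2 * D)
  have t1' : (∑ i ∈ Finset.range M, (f (a + (D - 1) + i) - f (a + (D - 1) + i + 1))) / A ≤ A⁻¹ := by
    rw [inv_eq_one_div]; gcongr; simpa using t1
  have t2' : (∑ i ∈ Finset.range M, (f (a + i) - f (a + i + 2 * D))) / γ ≤ 2 * D / γ := by
    gcongr; simpa using t2
  simp only [Finset.sum_const, Finset.card_range, nsmul_eq_mul, mul_one] at h2
  linarith

end Frd

/-- Corollary of Friedgut's sharp threshold theorem: if the liminf as n → ∞ of the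
probability that H_k(n, ⌈r*n⌉) is 2-colorable is strictly positive, then for every real
r with 0 < r < r*, the probability that H_k(n, ⌈rn⌉) is 2-colorable tends to 1. -/
theorem friedgut_corollary (k : ℕ) (hk : 3 ≤ k) (rstar : ℝ) (hrstar : 0 < rstar)
    (hliminf : 0 < Filter.liminf (fun n : ℕ => probTwoColorable k n ⌈rstar * n⌉₊) atTop) :
    ∀ r : ℝ, 0 < r → r < rstar →
      Tendsto (fun n : ℕ => probTwoColorable k n ⌈r * n⌉₊) atTop (nhds 1) := by
  intro r hr hrr
  obtain ⟨δ, hδ0, hδ⟩ := exists_between hliminf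
  have hev : ∀ᶠ n : ℕ in atTop, δ < probTwoColorable k n ⌈rstar * n⌉₊ := by
    refine eventually_lt_of_lt_liminf hδ ?_
    exact isBoundedUnder_of ⟨0, fun n => Frd.prob_nonneg _⟩
  obtain ⟨N1, hN1⟩ := eventually_atTop.1 hev
  by_contra hcon
  rw [Metric.tendsto_atTop] at hcon
  push Not at hcon
  obtain ⟨η, hη, hfreq⟩ := hcon
  have hΔ : 0 < rstar - r := by linarith
  obtain ⟨D, hD, γ, hγ, n0, hcore⟩ := Frd.core k hk (rstar + 1) (2 / (rstar - r)) (δ * η)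
    (by linarith) (by positivity) (by positivity)
  set X : ℝ := 2 * (2 * D / γ + 1 + D) / (rstar - r) with hX
  obtain ⟨n, hn, hdist⟩ := hfreq (max N1 (max n0 (max k (⌈X⌉₊ + 1))))
  have g1 : N1 ≤ n := (le_max_left _ _).trans hn
  have hn' := (le_max_right _ _).trans hn
  have g2 : n0 ≤ n := (le_max_left _ _).trans hn'
  have hn'' := (le_max_right _ _).trans hn'
  have g3 : k ≤ n := (le_max_left _ _).trans hn''
  have g4 : ⌈X⌉₊ + 1 ≤ n := (le_max_right _ _).trans hn''
  have hnpos : (0:ℝ) < n := by exact_mod_cast (by omega : 0 < n)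
  have hn1 : (1:ℝ) ≤ n := by exact_mod_cast (by omega : 1 ≤ n)
  have hXn : X < n := lt_of_le_of_lt (Nat.le_ceil _) (Nat.cast_lt.2 (by omega))
  rw [hX, div_lt_iff₀ hΔ] at hXn
  set f : ℕ → ℝ := probTwoColorable k n with hf
  have hf01 : ∀ i, 0 ≤ f i ∧ f i ≤ 1 := fun i => ⟨Frd.prob_nonneg i, Frd.prob_le_one i⟩
  have hanti : Antitone f := Frd.prob_anti g3
  set a := ⌈r * n⌉₊ with ha
  set b := ⌈rstar * n⌉₊ with hb
  have hfa : f a ≤ 1 - η := by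
    rw [Real.dist_eq, abs_sub_comm, abs_of_nonneg (by linarith [(hf01 a).2])] at hdist
    linarith
  have hfb : δ < f b := hN1 n g1
  have hab1 : (a:ℝ) < r * n + 1 := Nat.ceil_lt_add_one (by positivity)
  have hab2 : rstar * n ≤ b := Nat.le_ceil _
  have hab3 : (b:ℝ) < rstar * n + 1 := Nat.ceil_lt_add_one (by positivity)
  have hM : (b:ℝ) - a - D ≤ ((b - a - D : ℕ) : ℝ) := by
    have : (b:ℝ) ≤ ((b - a - D : ℕ) : ℝ) + a + D := by exact_mod_cast (by omega)
    linarith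
  have hlt : (2 / (rstar - r) / n)⁻¹ + 2 * D / γ < ((b - a - D : ℕ) : ℝ) := by
    have e : (2 / (rstar - r) / n)⁻¹ = (rstar - r) * n / 2 := by field_simp
    rw [e]
    nlinarith
  have hMpos : 0 < b - a - D := by
    have : (0:ℝ) < ((b - a - D : ℕ) : ℝ) := lt_of_le_of_lt (by positivity) hlt
    exact_mod_cast this
  obtain ⟨j, hj1, hj2, hs1, hs2⟩ := Frd.select f hf01 hanti a (b - a - D) D _ γ hD
    (by positivity) hγ hlt
  have hm1 : a ≤ j + D := by omega
  have hm2 : j + D ≤ b := by omega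
  have hfin := hcore n g2 g3 (j + D) (by
    have : ((j + D : ℕ) : ℝ) ≤ b := by exact_mod_cast hm2
    nlinarith) hs1 (by
    have e1 : j + D - D = j := by omega
    have e2 : j + D + D = j + 2 * D := by omega
    rw [e1, e2]; exact hs2)
  have l1 : f (j + D) ≤ 1 - η := (hanti hm1).trans hfa
  have l2 : δ < f (j + D) := lt_of_lt_of_le hfb (hanti hm2)
  change f (j + D) - f (j + D) ^ 2 < δ * η at hfin
  nlinarith
end

section
/- Let f be a real-valued, strictly positive, real-analytic function on [0,1], and for each n let S_n = Σ_{z=0}^{n} C(n,z) · f(z/n)^n. Define g on [0,1] by g(α) = f(α) / (α^α (1−α)^{1−α}), with the convention 0^0 = 1. If there exists α_max ∈ (0,1) such that g(α_max) = g_max > g(α) for all α ≠ α_max in [0,1], and g''(α_max) < 0, then there exist constants B > 0 and C > 0 such that for all sufficiently large n: B · g_max^n ≤ S_n ≤ C · g_max^n. -/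
open Filter Real

lemma stir_up (k : ℕ) (hk : 1 ≤ k) : (k.factorial : ℝ) ≤ exp 1 * (√k * (k / exp 1) ^ k) := by
  have h := Stirling.stirlingSeq'_antitone (Nat.zero_le (k-1))
  simp only [Function.comp, Nat.succ_eq_add_one, Nat.sub_add_cancel hk, zero_add,
    Stirling.stirlingSeq_one] at h
  have hk' : (0:ℝ) < k := by exact_mod_cast hk
  rw [Stirling.stirlingSeq, div_le_iff₀ (by positivity), Real.sqrt_mul (by norm_num)] at h
  refine h.trans (le_of_eq ?_)
  have : √(2:ℝ) ≠ 0 := by positivity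
  field_simp

lemma stir_lo (k : ℕ) : 2 * (√k * (k / exp 1) ^ k) ≤ (k.factorial : ℝ) := by
  refine le_trans ?_ (Stirling.le_factorial_stirling k)
  rw [← mul_assoc, Real.sqrt_mul (by positivity)]
  gcongr
  apply Real.le_sqrt_of_sq_le
  nlinarith [Real.pi_gt_three]

/-- binomial probability at its mean -/
noncomputable def binP (n z : ℕ) : ℝ :=
  (n.choose z : ℝ) * (((z:ℝ)/n)^z * (1 - (z:ℝ)/n)^(n-z))

lemma binP_eq (z m : ℕ) (hz : 1 ≤ z) : 
    binP (z+m) z * ((z.factorial : ℝ) * m.factorial * (((z+m:ℕ):ℝ)/exp 1)^(z+m)) =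
     (z+m).factorial * (((z:ℝ)/exp 1)^z * ((m:ℝ)/exp 1)^m) := by
  have h : ((z+m).choose z : ℝ) * z.factorial * m.factorial = (z+m).factorial := by
    have := Nat.choose_mul_factorial_mul_factorial (Nat.le_add_right z m)
    rw [Nat.add_sub_cancel_left] at this
    exact_mod_cast this
  have hN : (0:ℝ) < z + m := by positivity
  have h1 : (1 - (z:ℝ)/((z+m:ℕ):ℝ)) = m / ((z+m:ℕ):ℝ) := by
    push_cast; field_simp; ring
  rw [binP, h1, Nat.add_sub_cancel_left, ← h]
  push_cast
  simp only [div_pow, pow_add]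
  field_simp

lemma binP_nonneg (n z : ℕ) (h : z ≤ n) : 0 ≤ binP n z := by
  have : (z:ℝ)/n ≤ 1 := div_le_one_of_le₀ (by exact_mod_cast h) (by positivity)
  have h2 : 0 ≤ 1 - (z:ℝ)/n := by linarith
  unfold binP; positivity

lemma binP_le_one (n z : ℕ) (h : z ≤ n) : binP n z ≤ 1 := by
  have h1 : (z:ℝ)/n ≤ 1 := div_le_one_of_le₀ (by exact_mod_cast h) (by positivity)
  have h2 : 0 ≤ 1 - (z:ℝ)/n := by linarith
  have h3 := add_pow ((z:ℝ)/n) (1 - (z:ℝ)/n) n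
  rw [add_sub_cancel, one_pow] at h3
  rw [h3]
  have := Finset.single_le_sum (f := fun k => ((z:ℝ)/n)^k * (1 - (z:ℝ)/n)^(n-k) * (n.choose k : ℝ))
    (s := Finset.range (n+1)) (fun i _ => by positivity) (Finset.mem_range.2 (Nat.lt_succ_of_le h))
  refine le_trans (le_of_eq ?_) this
  simp only [binP]; ring

lemma binP_up (z m : ℕ) (hz : 1 ≤ z) (hm : 1 ≤ m) :
    binP (z+m) z * (√z * √m) ≤ exp 1 * √((z+m:ℕ):ℝ) := by
  have e := binP_eq z m hz
  have hP := binP_nonneg (z+m) z (by omega)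
  have hz' : (0:ℝ) < z := by positivity
  have hm' : (0:ℝ) < m := by positivity
  set N := z+m with hN
  have hN' : (0:ℝ) < (N:ℝ) := by positivity
  set A := ((z:ℝ)/exp 1)^z
  set B := ((m:ℝ)/exp 1)^m
  set D := ((N:ℝ)/exp 1)^N
  have hA : 0 < A := by positivity
  have hB : 0 < B := by positivity
  have hD : 0 < D := by positivity
  have a := stir_lo z
  have b := stir_lo m
  have c := stir_up N (by omega)
  have k1 : binP N z * ((2 * (√z * A)) * (2 * (√m * B)) * D) ≤ (exp 1 * (√N * D)) * (A*B) := by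
    calc _ ≤ binP N z * ((z.factorial : ℝ) * m.factorial * D) := by gcongr
      _ = _ := e
      _ ≤ _ := by gcongr
  have k2 : (binP N z * (√z * √m) * 4) * (A*B*D) ≤ (exp 1 * √N) * (A*B*D) := by linarith
  have k3 := le_of_mul_le_mul_right k2 (by positivity)
  have : 0 ≤ binP N z * (√z * √m) := by positivity
  linarith

lemma binP_lo (z m : ℕ) (hz : 1 ≤ z) (hm : 1 ≤ m) :
    2 / (exp 1)^2 / √((z+m:ℕ):ℝ) ≤ binP (z+m) z := by
  have e := binP_eq z m hz
  have hP := binP_nonneg (z+m) z (by omega)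
  have hz' : (0:ℝ) < z := by positivity
  have hm' : (0:ℝ) < m := by positivity
  set N := z+m with hN
  have hN' : (0:ℝ) < (N:ℝ) := by positivity
  have hzN : (z:ℝ) ≤ N := by exact_mod_cast (by omega)
  have hmN : (m:ℝ) ≤ N := by exact_mod_cast (by omega)
  set A := ((z:ℝ)/exp 1)^z
  set B := ((m:ℝ)/exp 1)^m
  set D := ((N:ℝ)/exp 1)^N
  have hA : 0 < A := by positivity
  have hB : 0 < B := by positivity
  have hD : 0 < D := by positivity
  have a := stir_up z hz
  have b := stir_up m hm
  have c := stir_lo N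
  have k1 : (2 * (√N * D)) * (A*B) ≤ binP N z * ((exp 1 * (√N * A)) * (exp 1 * (√N * B)) * D)  := by
    calc _ ≤ (N.factorial : ℝ) * (A * B) := by gcongr
      _ = _ := e.symm
      _ ≤ binP N z * ((exp 1 * (√z * A)) * (exp 1 * (√m * B)) * D) := by gcongr
      _ ≤ _ := by gcongr
  have k2 : 2 * (√N * (A*B*D)) ≤ (binP N z * (√N * (exp 1)^2)) * (√N * (A*B*D)) := by linarith
  have k3 := le_of_mul_le_mul_right k2 (by positivity)
  rw [div_div, div_le_iff₀ (by positivity)]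
  linarith

lemma geo_sum (x : ℝ) (hx : 0 < x) (N : ℕ) : ∑ i ∈ Finset.range N, exp (-(i*x)) ≤ 1 + 1/x := by
  have h : ∀ i:ℕ, exp (-(i*x)) = (exp (-x))^i := by
    intro i; rw [← Real.exp_nat_mul]; congr 1; ring
  simp_rw [h]
  have h1 : exp (-x) < 1 := by rw [Real.exp_lt_one_iff]; linarith
  have h0 : exp (-x) ≤ 1/(1+x) := by
    rw [Real.exp_neg, inv_eq_one_div]
    gcongr
    linarith [Real.add_one_le_exp x]
  rw [geom_sum_eq h1.ne]
  rw [← neg_div_neg_eq, div_le_iff₀ (by linarith)]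
  have h2 : (1+1/x) * (1 - 1/(1+x)) = 1 := by field_simp; ring
  have : (1+1/x) * (1 - 1/(1+x)) ≤ (1+1/x) * (1 - exp (-x)) := by gcongr
  have : 0 < exp (-x) ^ N := by positivity
  linarith

lemma geo_sum2 (x m : ℝ) (hx : 0 < x) (hm : 0 ≤ m) (N : ℕ) :
    ∑ z ∈ Finset.range N, exp (-(|(z:ℝ)-m| * x)) ≤ exp x * (2 * (1 + 1/x)) := by
  set k := ⌊m⌋₊
  have hk1 : (k:ℝ) ≤ m := Nat.floor_le hm
  have hk2 : m < k+1 := Nat.lt_floor_add_one m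
  have h1 : ∑ z ∈ Finset.range N, exp (-(|(z:ℝ)-m| * x)) ≤ 
     ∑ z ∈ Finset.range (k+N), exp (-(|(z:ℝ)-m| * x)) := by
    apply Finset.sum_le_sum_of_subset_of_nonneg
    · intro i; simp; omega
    · intros; positivity
  refine h1.trans ?_
  rw [Finset.sum_range_add, two_mul, mul_add]
  have g1 := geo_sum x hx k
  have g2 := geo_sum x hx N
  have ex : 1 ≤ exp x := Real.one_le_exp hx.le
  have gp : 0 < 1 + 1/x := by positivity
  refine add_le_add ?_ ?_
  · rw [← Finset.sum_range_reflect]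
    calc _ ≤ ∑ j ∈ Finset.range k, exp (-(j*x)) := by
          apply Finset.sum_le_sum
          intro j hj
          have hj := Finset.mem_range.1 hj
          rw [Real.exp_le_exp, neg_le_neg_iff]
          gcongr
          have : ((k - 1 - j : ℕ) : ℝ) = k - 1 - j := by
            rw [Nat.cast_sub (by omega), Nat.cast_sub (by omega)]; simp
          rw [this, abs_sub_comm]
          refine le_trans ?_ (le_abs_self _)
          linarith
      _ ≤ _ := by nlinarith
  · calc _ ≤ ∑ j ∈ Finset.range N, exp x * exp (-(j*x)) := by
          apply Finset.sum_le_sum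
          intro j hj
          rw [← Real.exp_add, Real.exp_le_exp]
          have : (j:ℝ) - 1 ≤ |((k+j:ℕ):ℝ) - m| := by
            refine le_trans ?_ (le_abs_self _)
            push_cast; linarith
          nlinarith
      _ ≤ _ := by rw [← Finset.mul_sum]; gcongr

lemma gauss_sum (κ : ℝ) (hκ : 0 < κ) (n : ℕ) (hn : 1 ≤ n) (m : ℝ) (hm : 0 ≤ m) (N : ℕ) :
    ∑ z ∈ Finset.range N, exp (-(κ * ((z:ℝ)-m)^2 / n)) ≤ (exp (1/(4*κ)) * (exp 1 * 4)) * √n := by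
  have hs : 1 ≤ √(n:ℝ) := Real.one_le_sqrt.2 (by exact_mod_cast hn)
  have hss : √(n:ℝ) * √n = n := Real.mul_self_sqrt (by positivity)
  calc _ ≤ ∑ z ∈ Finset.range N, exp (1/(4*κ)) * exp (-(|(z:ℝ)-m| * (1/√n))) := by
        apply Finset.sum_le_sum
        intro z _
        rw [← Real.exp_add, Real.exp_le_exp, ← sq_abs]
        set t := |(z:ℝ)-m|
        have e1 : κ * t^2 / n = κ * (t*(1/√n))^2 := by
          rw [mul_pow, div_pow, Real.sq_sqrt (by positivity)]; ring
        rw [e1]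
        set u := t*(1/√n)
        have : 1/(4*κ) + -u + κ*u^2 = κ * (u - 1/(2*κ))^2 := by field_simp; ring
        have : 0 ≤ κ * (u - 1/(2*κ))^2 := by positivity
        linarith
    _ ≤ exp (1/(4*κ)) * (exp (1/√n) * (2 * (1 + 1/(1/√n)))) := by
        rw [← Finset.mul_sum]; gcongr
        exact geo_sum2 _ m (by positivity) hm N
    _ ≤ exp (1/(4*κ)) * (exp 1 * (2 * (√n + √n))) := by
        gcongr
        · exact div_le_one_of_le₀ hs (by positivity)
        · simp
    _ = _ := by ring

lemma taylor2 (g : ℝ → ℝ) (p : ℝ) (hg : ContDiffAt ℝ 2 g p) (h0 : deriv g p = 0) (ε : ℝ) (hε : 0 < ε) :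
    ∃ δ > 0, ∀ x, |x - p| < δ → |g x - g p - deriv (deriv g) p / 2 * (x-p)^2| ≤ ε * (x-p)^2 := by
  have hd : HasDerivAt (deriv g) (deriv (deriv g) p) p := by
    have h1 : ContDiffAt ℝ 1 (deriv g) p := hg.derivWithin (m := 1) (by norm_num)
    exact (h1.differentiableAt (by norm_num)).hasDerivAt
  have he : ∀ᶠ x in nhds p, DifferentiableAt ℝ g x := by
    have := hg.eventually (by simp)
    filter_upwards [this] with x hx using hx.differentiableAt (by norm_num)
  obtain ⟨r, hr, hball⟩ := Metric.eventually_nhds_iff_ball.1 he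
  set d := deriv (deriv g) p
  have key := Convex.isLittleO_pow_succ_real (f := fun x => g x - d/2*(x-p)^2)
    (f' := fun x => deriv g x - d * (x-p)) (convex_ball p r) (Metric.mem_ball_self hr) (n := 1) 
    (by
      intro x hx
      have h1 := (hball x hx).hasDerivAt
      have h2 : HasDerivAt (fun x => d/2*(x-p)^2) (d*(x-p)) x := by
        have := (((hasDerivAt_id x).sub_const p).pow 2).const_mul (d/2)
        convert! this using 1
        simp; ring
      exact (h1.sub h2).hasDerivWithinAt)
    (by
      have := hd.isLittleO
      simp only [h0, smul_eq_mul, sub_zero] at this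
      refine Asymptotics.IsLittleO.mono ?_ nhdsWithin_le_nhds
      simpa [mul_comm] using this)
  rw [nhdsWithin_eq_nhds.2 (Metric.ball_mem_nhds p hr)] at key
  have := key.def hε
  obtain ⟨δ, hδ, h⟩ := Metric.eventually_nhds_iff_ball.1 this
  refine ⟨δ, hδ, fun x hx => ?_⟩
  have := h x (by simpa [Real.dist_eq] using hx)
  simp only [Real.norm_eq_abs] at this
  norm_num only [sub_self] at this
  rw [abs_of_nonneg (sq_nonneg (x-p))] at this
  refine le_trans (le_of_eq ?_) this
  congr 1; ring

lemma upper_pt (p c : ℝ) (hp : p ∈ Set.Ioo (0:ℝ) 1) (hc : 0 < c) :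
    ∃ K > 0, ∀ n z : ℕ, 1 ≤ n → z ≤ n →
      binP n z * exp (-(c * ((z:ℝ)-n*p)^2/n)) ≤ K/√n * exp (-(c/2 * ((z:ℝ)-n*p)^2/n)) := by
  obtain ⟨δ, hδ, hδ1, hδ2⟩ : ∃ δ > 0, 2*δ ≤ p ∧ 2*δ ≤ 1-p :=
    ⟨min p (1-p) / 2, by have := lt_min hp.1 (sub_pos.2 hp.2); linarith,
      by linarith [min_le_left p (1-p)], by linarith [min_le_right p (1-p)]⟩
  refine ⟨exp 1/δ + 1/(c/2*δ^2), by positivity, fun n z hn hz => ?_⟩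
  have hn0 : (1:ℝ) ≤ n := by exact_mod_cast hn
  have hP := binP_nonneg n z hz
  have hP1 := binP_le_one n z hz
  have hs : 1 ≤ √(n:ℝ) := Real.one_le_sqrt.2 hn0
  have hss : √(n:ℝ) * √n = n := Real.mul_self_sqrt (by positivity)
  have hsplit : exp (-(c * ((z:ℝ)-n*p)^2/n)) =
      exp (-(c/2 * ((z:ℝ)-n*p)^2/n)) * exp (-(c/2 * ((z:ℝ)-n*p)^2/n)) := by
    rw [← Real.exp_add]; congr 1; ring
  have hle1 : exp (-(c/2 * ((z:ℝ)-n*p)^2/n)) ≤ 1 := by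
    rw [Real.exp_le_one_iff, neg_nonpos]; positivity
  rw [hsplit, ← mul_assoc]
  gcongr
  rw [add_div]
  by_cases hcase : δ*n ≤ z ∧ (z:ℝ) ≤ n - δ*n
  · obtain ⟨ha, hb⟩ := hcase
    obtain ⟨m, rfl⟩ := Nat.exists_eq_add_of_le hz
    have hδn : 0 < δ * ((z+m:ℕ):ℝ) := by positivity
    have hb' : δ * ((z+m:ℕ):ℝ) ≤ m := by push_cast at hb ⊢; linarith
    have hz1 : 1 ≤ z := by
      have : (0:ℝ) < z := by linarith
      exact_mod_cast this
    have hm1 : 1 ≤ m := by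
      have : (0:ℝ) < m := by linarith
      exact_mod_cast this
    have h1 := binP_up z m hz1 hm1
    set N := z+m
    have h2 : δ * N ≤ √z * √m := by
      calc _ = √(δ*N) * √(δ*N) := (Real.mul_self_sqrt hδn.le).symm
        _ ≤ _ := by gcongr
    have h3 : binP N z * (δ * N) ≤ exp 1 * √N := le_trans (by gcongr) h1
    have h4 : binP N z ≤ exp 1/δ/√N := by
      rw [div_div, le_div_iff₀ (by positivity)]
      have : (binP N z * (δ * √N)) * √N ≤ exp 1 * √N := by
        calc _ = binP N z * (δ * (√N * √N)) := by ring
          _ ≤ _ := by rw [hss]; exact h3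
      exact le_of_mul_le_mul_right this (by positivity)
    have : binP N z * exp (-(c/2 * ((z:ℝ)-N*p)^2/N)) ≤ binP N z := mul_le_of_le_one_right hP hle1
    have : 0 ≤ 1/(c/2*δ^2)/√N := by positivity
    linarith
  · have hfar : (δ*n)^2 ≤ ((z:ℝ)-n*p)^2 := by
      rw [sq_le_sq, abs_of_pos (by positivity), le_abs]
      rw [not_and_or, not_le, not_le] at hcase
      rcases hcase with h | h
      · right; nlinarith
      · left; nlinarith
    have h1 : exp (-(c/2 * ((z:ℝ)-n*p)^2/n)) ≤ exp (-(c/2*δ^2 * n)) := by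
      rw [Real.exp_le_exp, neg_le_neg_iff, le_div_iff₀ (by positivity)]
      calc _ = c/2 * (δ*n)^2 := by ring
        _ ≤ _ := by gcongr
    have h2 : exp (-(c/2*δ^2 * n)) ≤ 1/(c/2*δ^2)/√n := by
      rw [Real.exp_neg, div_div, inv_eq_one_div]
      gcongr
      have := Real.add_one_le_exp (c/2*δ^2*n)
      have : c/2*δ^2*√n ≤ c/2*δ^2*n := by gcongr; nlinarith
      linarith
    have h3 : binP n z * exp (-(c/2 * ((z:ℝ)-n*p)^2/n)) ≤ exp (-(c/2 * ((z:ℝ)-n*p)^2/n)) :=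
      mul_le_of_le_one_left (by positivity) hP1
    have : 0 ≤ exp 1/δ/√n := by positivity
    linarith

lemma pow_w (n z : ℕ) (hn : 1 ≤ n) (hz : z ≤ n) (x : ℝ) (hx : x = (z:ℝ)/n) :
    (x ^ x * (1 - x) ^ (1 - x)) ^ n = x ^ z * (1-x)^(n-z) := by
  have hn0 : (1:ℝ) ≤ n := by exact_mod_cast hn
  have h1 : x ≤ 1 := hx ▸ div_le_one_of_le₀ (by exact_mod_cast hz) (by positivity)
  have h0 : 0 ≤ x := by rw [hx]; positivity
  have e1 : x * n = z := by rw [hx]; field_simp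
  have e2 : (1-x) * n = (n-z:ℕ) := by rw [sub_mul, e1, Nat.cast_sub hz, one_mul]
  rw [mul_pow, ← Real.rpow_natCast, ← Real.rpow_natCast (_ ^ _), ← Real.rpow_mul h0,
    ← Real.rpow_mul (by linarith), e1, e2, Real.rpow_natCast, Real.rpow_natCast]

lemma w_pos (x : ℝ) (hx : x ∈ Set.Icc (0:ℝ) 1) : 0 < x ^ x * (1 - x) ^ (1 - x) := by
  have key : ∀ y : ℝ, 0 ≤ y → 0 < y ^ y := by
    intro y hy
    rcases hy.eq_or_lt with h | h
    · subst h; simp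
    · positivity
  exact mul_pos (key x hx.1) (key (1-x) (by linarith [hx.2]))

lemma self_cont : ContinuousOn (fun x : ℝ => x ^ x) (Set.Ici 0) := by
  have : ContinuousOn (fun x : ℝ => exp (x * log x)) (Set.Ici 0) :=
    (Real.continuous_exp.comp Real.continuous_mul_log).continuousOn
  refine this.congr fun x hx => ?_
  rcases (show (0:ℝ) ≤ x from hx).eq_or_lt with h | h
  · subst h; simp
  · simp only [Real.rpow_def_of_pos h, mul_comm]

lemma global_up (f g : ℝ → ℝ) (hf : ContinuousOn f (Set.Icc 0 1))
    (hg : ∀ α : ℝ, g α = f α / (α ^ α * (1 - α) ^ (1 - α))) (p G : ℝ) (hG : 0 < G)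
    (hp : p ∈ Set.Ioo (0:ℝ) 1)
    (hunique : ∀ α ∈ Set.Icc (0 : ℝ) 1, α ≠ p → g α < G) (a δ : ℝ) (ha : 0 < a) (hδ : 0 < δ)
    (hloc : ∀ x, |x-p| < δ → g x ≤ G - a * (x-p)^2) :
    ∃ c > 0, ∀ x ∈ Set.Icc (0:ℝ) 1, g x ≤ G * exp (-(c * (x-p)^2)) := by
  have hcont : ContinuousOn g (Set.Icc 0 1) := by
    have h2 : ContinuousOn (fun x : ℝ => (1-x)^(1-x)) (Set.Icc 0 1) :=
      self_cont.comp (t := Set.Ici 0) (f := fun x : ℝ => 1 - x) (by fun_prop)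
        (fun x hx => by simpa using hx.2)
    have h3 := hf.div ((self_cont.mono (fun x hx => hx.1)).mul h2) (fun x hx => (w_pos x hx).ne')
    exact h3.congr fun x _ => hg x
  obtain ⟨M, hM0, hM, hfar⟩ : ∃ M, 0 < M ∧ M < G ∧ ∀ x ∈ Set.Icc (0:ℝ) 1, δ ≤ |x-p| → g x ≤ M := by
    have hK : IsCompact (Set.Icc (0:ℝ) 1 ∩ {x | δ ≤ |x-p|}) :=
      isCompact_Icc.inter_right (isClosed_le continuous_const (by fun_prop))
    rcases (Set.Icc (0:ℝ) 1 ∩ {x | δ ≤ |x-p|}).eq_empty_or_nonempty with he | hne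
    · refine ⟨G/2, by positivity, by linarith, fun x hx h => ?_⟩
      exact absurd (show x ∈ (Set.Icc (0:ℝ) 1 ∩ {x | δ ≤ |x-p|}) from ⟨hx, h⟩) (by simp [he])
    · obtain ⟨y, hy, hmax⟩ := hK.exists_isMaxOn hne (hcont.mono Set.inter_subset_left)
      have hyG : g y < G := by
        refine hunique y hy.1 ?_
        rintro rfl
        have := hy.2
        simp at this; linarith
      refine ⟨max (g y) (G/2), lt_max_of_lt_right (by positivity), max_lt hyG (by linarith),
        fun x hx h => le_max_of_le_left (hmax ⟨hx, h⟩)⟩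
  have hlog : 0 < log (G/M) := Real.log_pos (by rwa [one_lt_div hM0])
  refine ⟨min (a/G) (log (G/M)), by positivity, fun x hx => ?_⟩
  by_cases h : |x-p| < δ
  · have h1 := hloc x h
    have h2 := Real.add_one_le_exp (-(min (a/G) (log (G/M)) * (x-p)^2))
    have h3 : min (a/G) (log (G/M)) * (x-p)^2 ≤ a/G * (x-p)^2 := by gcongr; exact min_le_left _ _
    have h4 : G * (1 - a/G*(x-p)^2) = G - a * (x-p)^2 := by field_simp
    have h5 : G * (1 - a/G*(x-p)^2) ≤ G * exp (-(min (a/G) (log (G/M)) * (x-p)^2)) := by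
      gcongr; linarith
    linarith
  · refine (hfar x hx (not_lt.1 h)).trans ?_
    have h1 : (x-p)^2 ≤ 1 := by
      rw [sq_le_one_iff_abs_le_one, abs_le]
      constructor <;> linarith [hx.1, hx.2, hp.1, hp.2]
    have h2 : min (a/G) (log (G/M)) * (x-p)^2 ≤ log (G/M) := by
      calc _ ≤ log (G/M) * 1 := by gcongr; exact min_le_right _ _
        _ = _ := mul_one _
    calc M = G * exp (-log (G/M)) := by
          rw [Real.exp_neg, Real.exp_log (by positivity)]; field_simp
      _ ≤ _ := by gcongr

set_option maxHeartbeats 1000000 in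
theorem binomial_sum_laplace_bound (f : ℝ → ℝ)
    (hf_analytic : AnalyticOnNhd ℝ f (Set.Icc 0 1))
    (hf_pos : ∀ x ∈ Set.Icc (0 : ℝ) 1, 0 < f x)
    (g : ℝ → ℝ)
    (hg : ∀ α : ℝ, g α = f α / (α ^ α * (1 - α) ^ (1 - α)))
    (αmax gmax : ℝ) (hαmax : αmax ∈ Set.Ioo (0 : ℝ) 1)
    (hgmax : g αmax = gmax)
    (hunique : ∀ α ∈ Set.Icc (0 : ℝ) 1, α ≠ αmax → g α < gmax)
    (hconc : deriv (deriv g) αmax < 0) :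
    ∃ B > (0 : ℝ), ∃ C > (0 : ℝ), ∀ᶠ n : ℕ in atTop,
      B * gmax ^ n ≤ (∑ z ∈ Finset.range (n + 1), (n.choose z : ℝ) * f ((z : ℝ) / n) ^ n) ∧
      (∑ z ∈ Finset.range (n + 1), (n.choose z : ℝ) * f ((z : ℝ) / n) ^ n) ≤ C * gmax ^ n := by
  have hpI : αmax ∈ Set.Icc (0:ℝ) 1 := ⟨hαmax.1.le, hαmax.2.le⟩
  have hp0 := hαmax.1
  have hp1 := hαmax.2
  have hgpos : ∀ x ∈ Set.Icc (0:ℝ) 1, 0 < g x := fun x hx => by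
    rw [hg]; exact div_pos (hf_pos x hx) (w_pos x hx)
  have hG : 0 < gmax := hgmax ▸ hgpos _ hpI
  have hcd : ContDiffAt ℝ 2 g αmax := by
    have h1 : ContDiffAt ℝ 2 f αmax := (hf_analytic αmax hpI).contDiffAt
    have h2 : ContDiffAt ℝ 2 (fun x : ℝ => x ^ x) αmax :=
      contDiffAt_id.rpow contDiffAt_id hp0.ne'
    have h4 : ContDiffAt ℝ 2 (fun x : ℝ => 1 - x) αmax := contDiffAt_const.sub contDiffAt_id
    have h3 : ContDiffAt ℝ 2 (fun x : ℝ => (1-x) ^ (1-x)) αmax :=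
      h4.rpow h4 (by linarith)
    have := h1.div (h2.mul h3) (w_pos _ hpI).ne'
    exact this.congr_of_eventuallyEq (Eventually.of_forall hg)
  have hd0 : deriv g αmax = 0 := by
    apply IsLocalMax.deriv_eq_zero
    filter_upwards [Icc_mem_nhds hp0 hp1] with x hx
    rcases eq_or_ne x αmax with rfl | h
    · exact le_rfl
    · rw [hgmax]; exact (hunique x hx h).le
  obtain ⟨a, ha, had⟩ : ∃ a > 0, deriv (deriv g) αmax = -(4*a) :=
    ⟨-deriv (deriv g) αmax / 4, by linarith, by ring⟩
  obtain ⟨δ, hδ, hT⟩ := taylor2 g αmax hcd hd0 a ha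
  rw [had, hgmax] at hT
  obtain ⟨c, hc, hup⟩ := global_up f g hf_analytic.continuousOn hg αmax gmax hG hαmax hunique a δ ha hδ
    (fun x hx => by have := (abs_le.1 (hT x hx)).2; linarith)
  have hlo : ∀ x, |x-αmax| < δ → gmax - 3*a*(x-αmax)^2 ≤ g x := fun x hx => by
    have := (abs_le.1 (hT x hx)).1; linarith
  obtain ⟨K, hK, hKb⟩ := upper_pt αmax c hαmax hc
  have hmem : ∀ n z : ℕ, z ≤ n → (z:ℝ)/n ∈ Set.Icc (0:ℝ) 1 := fun n z hz =>
    ⟨by positivity, div_le_one_of_le₀ (by exact_mod_cast hz) (by positivity)⟩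
  have hterm : ∀ n z : ℕ, 1 ≤ n → z ≤ n →
      (n.choose z : ℝ) * f ((z : ℝ) / n) ^ n = binP n z * g ((z:ℝ)/n)^n := by
    intro n z hn hz
    have hw := w_pos _ (hmem n z hz)
    rw [hg, div_pow, binP, ← pow_w n z hn hz _ rfl]
    generalize ((z:ℝ)/n) ^ ((z:ℝ)/n) * (1 - (z:ℝ)/n) ^ (1 - (z:ℝ)/n) = w at hw
    field_simp
  refine ⟨2 / (exp 1)^2 * exp (-(2*(3*a/gmax))) / 2, by positivity,
    K * (exp (1/(4*(c/2))) * (exp 1 * 4)), by positivity, ?_⟩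
  have htend : Tendsto (fun n : ℕ => √(n:ℝ)) atTop atTop :=
    Real.tendsto_sqrt_atTop.comp tendsto_natCast_atTop_atTop
  filter_upwards [eventually_ge_atTop 1, htend.eventually_gt_atTop (1/δ),
    htend.eventually_gt_atTop (1/(1-αmax)), htend.eventually_ge_atTop (2*(3*a/gmax)),
    htend.eventually_ge_atTop 2] with n hn e1 e2 e3 e4
  have hn0 : (1:ℝ) ≤ n := by exact_mod_cast hn
  have hs0 : 0 < √(n:ℝ) := by linarith
  have hss : √(n:ℝ) * √n = n := Real.mul_self_sqrt (by positivity)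
  have hsn : √(n:ℝ) ≤ n := by nlinarith
  constructor
  · set s := ⌊√(n:ℝ)⌋₊ with hs
    set k := ⌈n*αmax⌉₊ with hk
    have hs1 : (s:ℝ) ≤ √n := Nat.floor_le hs0.le
    have hs2 : √n < s + 1 := Nat.lt_floor_add_one _
    have hk1 : n*αmax ≤ k := Nat.le_ceil _
    have hk2 : (k:ℝ) < n*αmax + 1 := Nat.ceil_lt_add_one (by positivity)
    have hknat : 1 ≤ k := Nat.ceil_pos.2 (by positivity)
    have hsqn : √(n:ℝ) < n * (1-αmax) := by
      rw [div_lt_iff₀ (by linarith)] at e2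
      nlinarith
    have hb : ∀ i < s, k + i < n ∧ |((k+i:ℕ):ℝ) - n*αmax| ≤ √n := by
      intro i hi
      have hi' : (i:ℝ) + 1 ≤ s := by exact_mod_cast hi
      have hi0 : (0:ℝ) ≤ i := by positivity
      refine ⟨?_, ?_⟩
      · have : (k:ℝ) + i < n := by nlinarith
        exact_mod_cast this
      · push_cast
        rw [abs_le]; constructor <;> linarith
    have hkn : k + s ≤ n + 1 := by
      rcases Nat.eq_zero_or_pos s with h | h
      · have : (s:ℝ) = 0 := by simp [h]
        linarith
      · have := (hb (s-1) (by omega)).1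
        omega
    have hsub : ∑ i ∈ Finset.range s, (n.choose (k+i) : ℝ) * f (((k+i:ℕ) : ℝ) / n) ^ n ≤
        ∑ z ∈ Finset.range (n + 1), (n.choose z : ℝ) * f ((z : ℝ) / n) ^ n := by
      calc _ ≤ ∑ z ∈ Finset.range (k+s), (n.choose z : ℝ) * f ((z : ℝ) / n) ^ n := by
            rw [Finset.sum_range_add]
            refine le_add_of_nonneg_left (Finset.sum_nonneg fun z hz => ?_)
            have := hf_pos _ (hmem n z (by have := Finset.mem_range.1 hz; omega))
            positivity
        _ ≤ _ := by
            apply Finset.sum_le_sum_of_subset_of_nonneg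
            · intro z; simp; omega
            · intro z hz _
              have := hf_pos _ (hmem n z (by have := Finset.mem_range.1 hz; omega))
              positivity
    refine le_trans ?_ hsub
    set y := 3*a/gmax with hy
    have hy0 : 0 < y := by positivity
    have hpt : ∀ i ∈ Finset.range s, 2 / (exp 1)^2 / √n * (gmax^n * exp (-(2*y))) ≤
        (n.choose (k+i) : ℝ) * f (((k+i:ℕ) : ℝ) / n) ^ n := by
      intro i hi
      obtain ⟨b1, b2⟩ := hb i (Finset.mem_range.1 hi)
      rw [hterm n (k+i) hn b1.le]
      have hPlo : 2 / (exp 1)^2 / √n ≤ binP n (k+i) := by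
        obtain ⟨m, hm⟩ := Nat.exists_eq_add_of_le b1.le
        have := binP_lo (k+i) m (by omega) (by omega)
        rwa [← hm] at this
      set x := ((k+i:ℕ):ℝ)/n with hx
      have hxp : x - αmax = (((k+i:ℕ):ℝ) - n*αmax)/n := by rw [hx]; field_simp
      have hxs : (x-αmax)^2 ≤ 1/n := by
        rw [hxp, div_pow, div_le_div_iff₀ (by positivity) (by positivity)]
        have := sq_le_sq' (by linarith [abs_nonneg (((k+i:ℕ):ℝ) - n*αmax)]) b2
        rw [sq_abs, Real.sq_sqrt (by positivity)] at this
        nlinarith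
      have hxd : |x-αmax| < δ := by
        rw [hxp, abs_div, abs_of_pos (show (0:ℝ) < n by linarith), div_lt_iff₀ (by linarith)]
        rw [div_lt_iff₀ hδ] at e1
        have := mul_lt_mul_of_pos_left e1 hs0
        rw [← mul_assoc, hss] at this
        linarith
      have hyn : y/n ≤ 1/2 := by
        rw [div_le_iff₀ (by linarith)]; linarith
      have hyn0 : 0 < y/n := by positivity
      have hg1 : gmax * (1 - y/n) ≤ g x := by
        refine le_trans ?_ (hlo x hxd)
        have : 3*a*(x-αmax)^2 ≤ 3*a*(1/n) := by gcongr
        have : gmax * (1-y/n) = gmax - 3*a*(1/n) := by rw [hy]; field_simp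
        linarith
      have hexp : exp (-(2*(y/n))) ≤ 1 - y/n := by
        rw [Real.exp_neg, inv_le_comm₀ (by positivity) (by linarith)]
        have := Real.add_one_le_exp (2*(y/n))
        refine le_trans ?_ this
        rw [inv_le_iff_one_le_mul₀ (by linarith)]
        nlinarith
      have hpw : gmax^n * exp (-(2*y)) ≤ g x ^ n := by
        calc _ = (gmax * exp (-(2*(y/n))))^n := by
              rw [mul_pow, ← Real.exp_nat_mul]; congr 2; field_simp
          _ ≤ _ := by
              gcongr
              exact le_trans (by gcongr) hg1
      have hPn := binP_nonneg n (k+i) b1.le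
      gcongr
    have hsum := Finset.card_nsmul_le_sum _ _ _ hpt
    rw [Finset.card_range, nsmul_eq_mul] at hsum
    refine le_trans ?_ hsum
    have hs3 : √n/2 ≤ s := by linarith
    calc _ = √n/2 * (2 / (exp 1)^2 / √n * (gmax^n * exp (-(2*y)))) := by field_simp
      _ ≤ _ := by gcongr
  · calc _ ≤ ∑ z ∈ Finset.range (n+1), gmax^n * (K/√n) * exp (-(c/2 * ((z:ℝ)-n*αmax)^2/n)) := by
          apply Finset.sum_le_sum
          intro z hz
          have hz' : z ≤ n := by have := Finset.mem_range.1 hz; omega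
          rw [hterm n z hn hz']
          have hP := binP_nonneg n z hz'
          have h1 : g ((z:ℝ)/n)^n ≤ gmax^n * exp (-(c * ((z:ℝ)-n*αmax)^2/n)) := by
            calc _ ≤ (gmax * exp (-(c * ((z:ℝ)/n-αmax)^2)))^n := by
                  gcongr
                  · exact (hgpos _ (hmem n z hz')).le
                  · exact hup _ (hmem n z hz')
              _ = _ := by
                  rw [mul_pow, ← Real.exp_nat_mul]; congr 2; field_simp
          calc _ ≤ binP n z * (gmax^n * exp (-(c * ((z:ℝ)-n*αmax)^2/n))) := by gcongr
            _ = gmax^n * (binP n z * exp (-(c * ((z:ℝ)-n*αmax)^2/n))) := by ring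
            _ ≤ gmax^n * (K/√n * exp (-(c/2 * ((z:ℝ)-n*αmax)^2/n))) := by
                exact mul_le_mul_of_nonneg_left (hKb n z hn hz') (by positivity)
            _ = _ := by ring
      _ ≤ gmax^n * (K/√n) * ((exp (1/(4*(c/2))) * (exp 1 * 4)) * √n) := by
          rw [← Finset.mul_sum]; gcongr
          exact gauss_sum (c/2) (by positivity) n hn _ (by positivity) _
      _ = _ := by field_simp
end

section
/- For every ε > 0 there exists k₀ = k₀(ε) such that for all integers k ≥ k₀ and every real r with 0 < r ≤ 2^{k-1} ln 2 − (ln 2)/2 − (1+ε)/2, the function ℓ_r satisfies: ℓ_r(1/2) = 1, ℓ_r(α) < 1 for every α ∈ [0,1] with α ≠ 1/2, and ℓ_r''(1/2) < 0. -/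
open Real

/-- `p(α) = 1 − 2^{1−k}(2 − α^k − (1−α)^k)`, the probability that a random NAE
`k`-clause is satisfied by both assignments of an overlapping pair. -/
noncomputable def naeP (k : ℕ) (α : ℝ) : ℝ :=
  1 - (2 : ℝ) ^ (1 - (k : ℝ)) * (2 - α ^ k - (1 - α) ^ k)

/-- `ℓ_r(α) = (1/(2 α^α (1−α)^{1−α})) (p(α)/(1−2^{1−k})²)^r`, with the convention
`0^0 = 1` (satisfied by `Real.rpow`). -/
noncomputable def naeL (k : ℕ) (r : ℝ) (α : ℝ) : ℝ :=
  1 / (2 * α ^ α * (1 - α) ^ (1 - α)) *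
    (naeP k α / (1 - (2 : ℝ) ^ (1 - (k : ℝ))) ^ 2) ^ r

/-- the logarithm of `ℓ_r`, with `q = 2^{1-k}`. -/
noncomputable def naeG (k : ℕ) (r q : ℝ) (α : ℝ) : ℝ :=
  -Real.log 2 - α * Real.log α - (1 - α) * Real.log (1 - α) +
    r * (Real.log (1 - q * (2 - α ^ k - (1 - α) ^ k)) - 2 * Real.log (1 - q))

lemma naeq_mul (k : ℕ) (hk : 1 ≤ k) : (2 : ℝ) ^ (k - 1) * (2 : ℝ) ^ (1 - (k : ℝ)) = 1 := by
  rw [← Real.rpow_natCast, ← Real.rpow_add (by norm_num), Nat.cast_sub hk]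
  simp

lemma naeq_eq (k : ℕ) : (2 : ℝ) ^ (1 - (k : ℝ)) = 2 * (1 / 2 : ℝ) ^ k := by
  rw [Real.rpow_sub (by norm_num), Real.rpow_one, Real.rpow_natCast]
  simp [div_eq_mul_inv]

lemma rpow_self_exp (x : ℝ) (hx : 0 ≤ x) : x ^ x = Real.exp (x * Real.log x) := by
  rcases hx.eq_or_lt with h | h
  · rw [← h]; simp
  · rw [Real.rpow_def_of_pos h, mul_comm]

lemma naeL_eq_exp (k : ℕ) (r α : ℝ) (h0 : 0 ≤ α) (h1 : α ≤ 1)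
    (hP : 0 < 1 - (2 : ℝ) ^ (1 - (k : ℝ)) * (2 - α ^ k - (1 - α) ^ k))
    (hq : (2 : ℝ) ^ (1 - (k : ℝ)) < 1) :
    naeL k r α = Real.exp (naeG k r ((2 : ℝ) ^ (1 - (k : ℝ))) α) := by
  unfold naeL naeP naeG
  generalize (2 : ℝ) ^ (1 - (k : ℝ)) = q at *
  have hq' : 0 < 1 - q := by linarith
  rw [rpow_self_exp α h0, rpow_self_exp (1 - α) (by linarith),
    Real.rpow_def_of_pos (by positivity), Real.log_div hP.ne' (by positivity), Real.log_pow]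
  nth_rewrite 1 [← Real.exp_log (show (0 : ℝ) < 2 by norm_num)]
  rw [← Real.exp_add, ← Real.exp_add, one_div, ← Real.exp_neg, ← Real.exp_add]
  congr 1
  push_cast
  ring

lemma nae_d (u : ℝ) (hu : 0 ≤ u) (hu1 : u ≤ 1) (k : ℕ) :
    (1 + u) ^ k - (1 - u) ^ k ≤ 2 * u * k * (1 + u) ^ k := by
  induction k with
  | zero => simp
  | succ k ih =>
    have h1 : (1 - u) ^ k ≤ (1 + u) ^ k := pow_le_pow_left₀ (by linarith) (by linarith) k
    have h2 : (0 : ℝ) ≤ (1 + u) ^ k := by positivity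
    rw [pow_succ, pow_succ]
    push_cast
    have h3 := mul_le_mul_of_nonneg_left h1 hu
    have h4 : 0 ≤ 2 * u * (k + 1) * (1 + u) ^ k * u := by positivity
    nlinarith

lemma nae_a (u : ℝ) (hu : 0 ≤ u) (hu1 : u ≤ 1) (k : ℕ) :
    (1 + u) ^ k + (1 - u) ^ k - 2 ≤ k ^ 2 * u ^ 2 * (1 + u) ^ k := by
  induction k with
  | zero => norm_num
  | succ k ih =>
    have h1 := mul_le_mul_of_nonneg_left (nae_d u hu hu1 k) hu
    have h2 : (0 : ℝ) ≤ (1 + u) ^ k := by positivity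
    rw [pow_succ (1 + u), pow_succ (1 - u)]
    push_cast
    have h4 : 0 ≤ (k + 1 : ℝ) ^ 2 * u ^ 2 * (1 + u) ^ k * u := by positivity
    have h5 : 0 ≤ u ^ 2 * (1 + u) ^ k := by positivity
    nlinarith

/-- quantitative entropy bound -/
lemma nae_ent (u : ℝ) (hu : 0 ≤ u) (hu1 : u < 1) :
    u ^ 2 / 3 ≤ (1 + u) * Real.log (1 + u) + (1 - u) * Real.log (1 - u) := by
  have h1 := Real.le_log_one_add_of_nonneg hu
  have h2 := Real.one_sub_inv_le_log_of_pos (show 0 < 1 - u by linarith)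
  have h3 := mul_le_mul_of_nonneg_left h1 (show 0 ≤ 1 + u by linarith)
  have h4 := mul_le_mul_of_nonneg_left h2 (show 0 ≤ 1 - u by linarith)
  have h5 : (1 - u) * (1 - (1 - u)⁻¹) = -u := by
    have : 1 - u ≠ 0 := by linarith
    field_simp; ring
  have h6 : u ^ 2 / 3 ≤ (1 + u) * (2 * u / (u + 2)) - u := by
    have : (1 + u) * (2 * u / (u + 2)) - u = u ^ 2 / (u + 2) := by field_simp; ring
    rw [this]
    apply div_le_div_of_nonneg_left <;> nlinarith
  linarith

/-- tangent bound for `-x log x` -/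
lemma nae_tan (d c : ℝ) (hd : 0 ≤ d) (hc : 0 < c) :
    -(d * Real.log d) ≤ c - d - d * Real.log c := by
  rcases hd.eq_or_lt with h | h
  · rw [← h]; simp; exact hc.le
  · have h1 := Real.log_le_sub_one_of_pos (show 0 < c / d by positivity)
    rw [Real.log_div hc.ne' h.ne'] at h1
    have h2 := mul_le_mul_of_nonneg_left h1 hd
    have : d * (c / d - 1) = c - d := by field_simp
    nlinarith

lemma nae_log (q : ℝ) (h0 : 0 < q) (h1 : q ≤ 1 / 4) :
    -Real.log (1 - q) ≤ q + q ^ 2 / 2 + 2 * q ^ 3 := by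
  have h := Real.abs_log_sub_add_sum_range_le (x := q) (by rw [abs_of_pos h0]; linarith) 2
  rw [abs_of_pos h0] at h
  have h2 := (abs_le.1 h).1
  simp [Finset.sum_range_succ] at h2
  have h3 : q ^ 3 / (1 - q) ≤ 2 * q ^ 3 := by
    rw [div_le_iff₀ (by linarith)]
    have : 0 < q ^ 3 := by positivity
    nlinarith
  norm_num at h2
  linarith

/-- upper bounds for the entropy near the endpoint -/
lemma nae_w (k : ℕ) (hk : 3 ≤ k) (d : ℝ) (h0 : 0 ≤ d) (h1 : d ≤ 1 / 2) :
    Real.exp (-(k * d)) + d ^ 2 ≥ d ^ k + (1 - d) ^ k := by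
  have h2 : d ^ k ≤ d ^ 2 := pow_le_pow_of_le_one h0 (by linarith) (by omega)
  have h3 : (1 - d) ^ k ≤ Real.exp (-(k * d)) := by
    have := pow_le_pow_left₀ (by linarith) (Real.one_sub_le_exp_neg d) k
    rw [← Real.exp_nat_mul] at this
    have e : (k : ℝ) * -d = -(k * d) := by ring
    rwa [e] at this
  linarith

lemma nae_exp_quad (y : ℝ) (h0 : 0 ≤ y) : Real.exp (-y) ≤ 1 - y + y ^ 2 / 2 := by
  have h1 := Real.quadratic_le_exp_of_nonneg h0
  rw [Real.exp_neg]
  have : 0 < 1 + y + y ^ 2 / 2 := by positivity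
  calc (Real.exp y)⁻¹ ≤ (1 + y + y ^ 2 / 2)⁻¹ := by gcongr
    _ ≤ _ := by
      rw [inv_le_iff_one_le_mul₀ this]
      nlinarith [sq_nonneg (y ^ 2)]

set_option maxHeartbeats 2000000 in
lemma nae_main (k : ℕ) (hk : 3 ≤ k) (q ε r d : ℝ) (hε : 0 < ε)
    (hq0 : 0 < q) (hq1 : q ≤ 1 / 4) (hqk : (2 : ℝ) ^ (k - 1) * q = 1)
    (hr0 : 0 < r)
    (hr : r ≤ (2 : ℝ) ^ (k - 1) * Real.log 2 - Real.log 2 / 2 - (1 + ε) / 2)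
    (E2 : Real.exp (Real.log 2 / k + q * (Real.log 2 / 2 + (1 + ε) / 2) * k) +
      4 * q * Real.log 2 < 1 + ε)
    (E3 : q * (Real.log 2 / 2 + (1 + ε) / 2) ≤ 0.09)
    (E4 : 3 * Real.log k + 1 < 0.2 * k)
    (E5 : 3 * (k : ℝ) ^ 2 * 0.99 ^ k < 1 / 6)
    (hd0 : 0 ≤ d) (hd1 : d < 1 / 2) :
    naeG k r q d < 0 := by
  have hl2 := Real.log_two_gt_d9
  have hl2' := Real.log_two_lt_d9
  have hkR : (3 : ℝ) ≤ k := by exact_mod_cast hk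
  set C := Real.log 2 / 2 + (1 + ε) / 2 with hC
  have hC0 : 0 < C := by positivity
  set R := (2 : ℝ) ^ (k - 1) * Real.log 2 - C with hR
  have hrR : r ≤ R := by rw [hR, hC]; linarith
  have hRq : R * q = Real.log 2 - q * C := by rw [hR]; linear_combination Real.log 2 * hqk
  -- s ≥ 0
  have hs0 : q ≤ d ^ k + (1 - d) ^ k := by
    have h := add_pow_le hd0 (show 0 ≤ 1 - d by linarith) k
    simp only [add_sub_cancel, one_pow] at h
    have := mul_le_mul_of_nonneg_left h hq0.le
    have e : q * (2 ^ (k - 1) * (d ^ k + (1 - d) ^ k)) = d ^ k + (1 - d) ^ k := by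
      linear_combination (d ^ k + (1 - d) ^ k) * hqk
    linarith
  set S := d ^ k + (1 - d) ^ k with hS
  have hS1 : S ≤ 1 := by
    have a := pow_le_of_le_one hd0 (by linarith) (show k ≠ 0 by omega)
    have b := pow_le_of_le_one (show 0 ≤ 1 - d by linarith) (by linarith) (show k ≠ 0 by omega)
    linarith
  have hP : 1 - q * (2 - d ^ k - (1 - d) ^ k) = (1 - q) ^ 2 + q * (S - q) := by rw [hS]; ring
  have hq' : 0 < 1 - q := by linarith
  have hPpos : 0 < (1 - q) ^ 2 + q * (S - q) := by
    have : 0 ≤ q * (S - q) := mul_nonneg hq0.le (by linarith)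
    positivity
  unfold naeG
  rw [hP]
  set L := Real.log ((1 - q) ^ 2 + q * (S - q)) - 2 * Real.log (1 - q) with hL
  have hL' : L = Real.log (((1 - q) ^ 2 + q * (S - q)) / (1 - q) ^ 2) := by
    rw [Real.log_div hPpos.ne' (by positivity), Real.log_pow, hL]; push_cast; ring
  have hL0 : 0 ≤ L := by
    rw [hL']
    apply Real.log_nonneg
    rw [one_le_div (by positivity)]
    have : 0 ≤ q * (S - q) := mul_nonneg hq0.le (by linarith)
    linarith
  have hrL : r * L ≤ R * L := mul_le_mul_of_nonneg_right hrR hL0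
  have hR0 : 0 < R := by linarith
  have hqC : 0 < q * C := by positivity
  by_cases hA : 1 / 100 ≤ d
  · -- regime A
    set u := 1 - 2 * d with hu
    have hent := nae_ent u (by linarith) (by linarith)
    have e1 : 1 + u = 2 * (1 - d) := by rw [hu]; ring
    have e2 : 1 - u = 2 * d := by rw [hu]; ring
    have ha := nae_a u (by linarith) (by linarith) k
    rw [e1, e2] at hent ha
    rw [Real.log_mul (by norm_num) (by linarith), Real.log_mul (by norm_num) (by linarith)] at hent
    rw [mul_pow, mul_pow] at ha
    have e3 : (2 : ℝ) ^ k = 2 * 2 ^ (k - 1) := by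
      rw [← pow_succ']; congr 1; omega
    have hss : S - q ≤ k ^ 2 * u ^ 2 * (1 - d) ^ k := by
      rw [e3] at ha
      have := mul_le_mul_of_nonneg_left ha hq0.le
      have e4 : q * (2 * 2 ^ (k - 1) * (1 - d) ^ k + 2 * 2 ^ (k - 1) * d ^ k - 2) = 2 * (S - q) := by
        rw [hS]; linear_combination 2 * ((1 - d) ^ k + d ^ k) * hqk
      have e5 : q * (k ^ 2 * u ^ 2 * (2 * 2 ^ (k - 1) * (1 - d) ^ k)) =
          2 * (k ^ 2 * u ^ 2 * (1 - d) ^ k) := by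
        linear_combination 2 * (k ^ 2 * u ^ 2 * (1 - d) ^ k) * hqk
      linarith
    have h99 : (1 - d) ^ k ≤ 0.99 ^ k := pow_le_pow_left₀ (by linarith) (by linarith) k
    have hu2 : 0 < u ^ 2 := by have : 0 < u := by linarith
                               positivity
    have hss2 : S - q ≤ u ^ 2 * (1 / 18) := by
      have : k ^ 2 * u ^ 2 * (1 - d) ^ k ≤ u ^ 2 * (k ^ 2 * 0.99 ^ k) := by
        have := mul_le_mul_of_nonneg_left h99 (show 0 ≤ (k : ℝ) ^ 2 * u ^ 2 by positivity)
        linarith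
      have h : u ^ 2 * ((k : ℝ) ^ 2 * 0.99 ^ k) ≤ u ^ 2 * (1 / 18) := by
        apply mul_le_mul_of_nonneg_left _ hu2.le
        linarith
      linarith
    have hLx : L ≤ 2 * (q * (S - q)) := by
      rw [hL']
      refine (Real.log_le_sub_one_of_pos (by positivity)).trans ?_
      rw [sub_le_iff_le_add, div_le_iff₀ (by positivity)]
      have : 0 ≤ q * (S - q) := mul_nonneg hq0.le (by linarith)
      have h9 : 9 / 16 ≤ (1 - q) ^ 2 := by nlinarith
      have := mul_le_mul_of_nonneg_left h9 this
      linarith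
    have hRL : R * L ≤ R * q * (2 * (S - q)) := by
      have := mul_le_mul_of_nonneg_left hLx hR0.le
      linarith
    have hRL2 : R * q * (2 * (S - q)) ≤ 0.7 * (2 * (S - q)) := by
      apply mul_le_mul_of_nonneg_right _ (by linarith)
      rw [hRq]; linarith
    linarith
  · push Not at hA
    have hLb : L ≤ q + q ^ 2 / 2 + 2 * q ^ 3 - q * (1 - S) := by
      have hx : (1 - q) ^ 2 + q * (S - q) = (1 - q) * (1 - q * (1 - S) / (1 - q)) := by
        field_simp; ring
      have hpos : 0 < 1 - q * (1 - S) / (1 - q) := by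
        rw [hx] at hPpos
        exact (mul_pos_iff_of_pos_left hq').1 hPpos
      rw [hL, hx, Real.log_mul hq'.ne' hpos.ne']
      have h1 := Real.log_le_sub_one_of_pos hpos
      have h2 : q * (1 - S) ≤ q * (1 - S) / (1 - q) := by
        rw [le_div_iff₀ hq']
        have : 0 ≤ q * (1 - S) := mul_nonneg hq0.le (by linarith)
        nlinarith
      have := nae_log q hq0 hq1
      linarith
    have hRL : R * L ≤ Real.log 2 - q * (1 + ε) / 2 + 2 * q ^ 2 * Real.log 2
        - (Real.log 2 - q * C) * (1 - S) := by
      have h1 := mul_le_mul_of_nonneg_left hLb hR0.le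
      have h2 : R * (q + q ^ 2 / 2 + 2 * q ^ 3 - q * (1 - S)) =
        R * q * (1 + q / 2 + 2 * q ^ 2 - (1 - S)) := by ring
      rw [h2, hRq] at h1
      have h3 : 0 ≤ q * C * (q / 2 + 2 * q ^ 2) := by positivity
      have h4 : q * C = q * (Real.log 2 / 2) + q * (1 + ε) / 2 := by rw [hC]; ring
      linarith only [h1, h3, h4]
    have hH2 : -((1 - d) * Real.log (1 - d)) ≤ d := by
      have h2 := Real.one_sub_inv_le_log_of_pos (show 0 < 1 - d by linarith)
      have h4 := mul_le_mul_of_nonneg_left h2 (show 0 ≤ 1 - d by linarith)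
      have h5 : (1 - d) * (1 - (1 - d)⁻¹) = -d := by
        have : 1 - d ≠ 0 := by linarith
        field_simp; ring
      linarith
    have hw := nae_w k hk d hd0 hd1.le
    rw [← hS] at hw
    by_cases hB : 1 / (k : ℝ) ^ 3 ≤ d
    · -- regime B
      have hlow : 0.6 ≤ Real.log 2 - q * C := by linarith
      have hfirst : -(q * (1 + ε) / 2) + 2 * q ^ 2 * Real.log 2 ≤ 0 := by
        have i0 : 0 < q * ε := by positivity
        have i1 := mul_le_mul_of_nonneg_right hq1 (show 0 ≤ Real.log 2 by linarith only [hl2])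
        have i2 : q * Real.log 2 ≤ 1 / 4 := by linarith only [i1, hl2']
        have i3 := mul_le_mul_of_nonneg_left i2 hq0.le
        linarith only [i0, i3]
      have hdpos : 0 < d := lt_of_lt_of_le (by positivity) hB
      have hlw : 0.6 * (1 - S) ≤ (Real.log 2 - q * C) * (1 - S) :=
        mul_le_mul_of_nonneg_right hlow (by linarith)
      by_cases hy : (k : ℝ) * d ≤ 1
      · have hlogd : -Real.log d ≤ 3 * Real.log k := by
          have := Real.log_le_log (by positivity) hB
          rw [one_div, Real.log_inv, Real.log_pow] at this
          push_cast at this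
          linarith
        have hq2 := nae_exp_quad (k * d) (by positivity)
        have h1 : d * (-Real.log d + 1) < d * (0.2 * k) :=
          mul_lt_mul_of_pos_left (by linarith) hdpos
        have h2 : 0.6 * (1 - S) ≥ 0.2 * (k * d) := by
          have i1 := mul_le_mul_of_nonneg_left hy (show 0 ≤ k * d by positivity)
          have i2 := mul_le_mul_of_nonneg_left hA.le hd0
          have i3 := mul_le_mul_of_nonneg_right hkR hd0
          have j1 : (k * d) ^ 2 ≤ k * d := by linarith only [i1]
          have j2 : d ^ 2 ≤ 0.01 * d := by linarith only [i2]
          linarith only [j1, j2, i3, hq2, hw, hd0]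
        linarith only [h1, h2, hlw, hfirst, hRL, hrL, hH2]
      · push Not at hy
        have h1 : Real.exp (-(k * d)) ≤ Real.exp (-1) := Real.exp_le_exp.2 (by linarith)
        have h2 := Real.exp_neg_one_lt_d9
        have h3 := nae_tan d 0.01 hd0 (by norm_num)
        have h4 : -Real.log 0.01 ≤ 7 := by
          have : (0.01 : ℝ) ≥ (2 ^ 7)⁻¹ := by norm_num
          have := Real.log_le_log (by positivity) this
          rw [Real.log_inv, Real.log_pow] at this
          push_cast at this
          linarith
        have h5 : d * (-Real.log 0.01) ≤ d * 7 := mul_le_mul_of_nonneg_left h4 hd0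
        have i2 := mul_le_mul_of_nonneg_left hA.le hd0
        have : d ^ 2 ≤ 0.01 * d := by linarith only [i2]
        linarith only [h1, h2, h3, h5, this, hA, hw, hlw, hfirst, hRL, hrL, hH2]
    · -- regime C
      push Not at hB
      have hk0 : (0 : ℝ) < k := by linarith
      have hq2 := nae_exp_quad (k * d) (by positivity)
      have hkd : (k : ℝ) ^ 3 * d ≤ 1 := by
        rw [lt_div_iff₀ (by positivity)] at hB
        linarith
      have hkd2 : (k : ℝ) ^ 2 * d ^ 2 ≤ d / k := by
        rw [le_div_iff₀ hk0]
        have := mul_le_mul_of_nonneg_left hkd hd0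
        linarith only [this]
      have hwl : d * (k - 1 / k) ≤ 1 - S := by
        have : d ^ 2 ≤ (k : ℝ) ^ 2 * d ^ 2 / 2 := by
          have : (2 : ℝ) ≤ (k : ℝ) ^ 2 := by nlinarith
          have := mul_le_mul_of_nonneg_right this (sq_nonneg d)
          linarith only [this]
        have e : d * (k - 1 / k) = k * d - d / k := by ring
        rw [e]
        linarith only [this, hkd2, hq2, hw]
      have hlow : 0 ≤ Real.log 2 - q * C := by linarith
      have h1 := mul_le_mul_of_nonneg_left hwl hlow
      set θ := Real.log 2 / k + q * C * k with hθ
      have h2 : d * (k * Real.log 2 - θ) ≤ (Real.log 2 - q * C) * (d * (k - 1 / k)) := by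
        have : (Real.log 2 - q * C) * (d * (k - 1 / k)) =
          d * (k * Real.log 2 - θ) + q * C * d / k := by rw [hθ]; field_simp; ring
        have : 0 ≤ q * C * d / k := by positivity
        linarith
      have h3 := nae_tan d (q / 2 * Real.exp θ) hd0 (by positivity)
      have hlq : Real.log (q / 2 * Real.exp θ) = -(k * Real.log 2) + θ := by
        rw [Real.log_mul (by positivity) (by positivity), Real.log_exp]
        have : q / 2 = (2 ^ k)⁻¹ := by
          have e3 : (2 : ℝ) ^ k = 2 * 2 ^ (k - 1) := by
            rw [← pow_succ']; congr 1; omega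
          apply eq_inv_of_mul_eq_one_left
          rw [e3]
          linear_combination hqk
        rw [this, Real.log_inv, Real.log_pow]
      rw [hlq] at h3
      have h4 := mul_lt_mul_of_pos_left E2 (show 0 < q / 2 by positivity)
      linarith only [h1, h2, h3, h4, hRL, hrL, hH2]

lemma nae_eventually (ε : ℝ) (hε : 0 < ε) : ∀ᶠ k : ℕ in Filter.atTop,
    3 ≤ k ∧ (2 : ℝ) ^ (1 - (k : ℝ)) ≤ 1 / 4 ∧
    Real.exp (Real.log 2 / k + (2 : ℝ) ^ (1 - (k : ℝ)) * (Real.log 2 / 2 + (1 + ε) / 2) * k) +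
      4 * (2 : ℝ) ^ (1 - (k : ℝ)) * Real.log 2 < 1 + ε ∧
    (2 : ℝ) ^ (1 - (k : ℝ)) * (Real.log 2 / 2 + (1 + ε) / 2) ≤ 0.09 ∧
    3 * Real.log k + 1 < 0.2 * k ∧
    3 * (k : ℝ) ^ 2 * 0.99 ^ k < 1 / 6 ∧
    (2 : ℝ) ^ (1 - (k : ℝ)) * k ^ 2 < 1 / 2 := by
  simp only [naeq_eq]
  have t0 : Filter.Tendsto (fun k : ℕ => 2 * (1 / 2 : ℝ) ^ k) Filter.atTop (nhds 0) := by
    simpa using (tendsto_pow_atTop_nhds_zero_of_lt_one (r := (1 / 2 : ℝ)) (by norm_num)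
      (by norm_num)).const_mul 2
  have t1 : Filter.Tendsto (fun k : ℕ => (k : ℝ) * (1 / 2 : ℝ) ^ k) Filter.atTop (nhds 0) := by
    simpa using tendsto_pow_const_mul_const_pow_of_lt_one 1 (r := (1 / 2 : ℝ)) (by norm_num)
      (by norm_num)
  have t2 : Filter.Tendsto (fun k : ℕ => (k : ℝ) ^ 2 * (1 / 2 : ℝ) ^ k) Filter.atTop (nhds 0) :=
    tendsto_pow_const_mul_const_pow_of_lt_one 2 (by norm_num) (by norm_num)
  have t3 : Filter.Tendsto (fun k : ℕ => (k : ℝ) ^ 2 * (0.99 : ℝ) ^ k) Filter.atTop (nhds 0) :=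
    tendsto_pow_const_mul_const_pow_of_lt_one 2 (by norm_num) (by norm_num)
  have t4 : Filter.Tendsto (fun k : ℕ => Real.log 2 / (k : ℝ)) Filter.atTop (nhds 0) :=
    tendsto_const_div_atTop_nhds_zero_nat _
  have t5 : Filter.Tendsto (fun k : ℕ => Real.exp (Real.log 2 / k +
      2 * (1 / 2 : ℝ) ^ k * (Real.log 2 / 2 + (1 + ε) / 2) * k) +
      4 * (2 * (1 / 2 : ℝ) ^ k) * Real.log 2) Filter.atTop (nhds 1) := by
    have a := t4.add (t1.const_mul (2 * (Real.log 2 / 2 + (1 + ε) / 2)))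
    have b := ((Real.continuous_exp.tendsto _).comp a).add (t0.const_mul (4 * Real.log 2))
    simp only [mul_zero, add_zero, Real.exp_zero] at b
    refine b.congr fun k => ?_
    simp only [Function.comp]
    congr 1
    · congr 1; ring
    · ring
  have t6 := t0.mul_const (Real.log 2 / 2 + (1 + ε) / 2)
  rw [zero_mul] at t6
  have t7 : ∀ᶠ k : ℕ in Filter.atTop, ‖Real.log (k : ℝ)‖ ≤ 0.05 * ‖(k : ℝ)‖ :=
    tendsto_natCast_atTop_atTop.eventually (Real.isLittleO_log_id_atTop.bound (by norm_num))
  filter_upwards [Filter.eventually_ge_atTop 100, t0.eventually_le_const (u := 1 / 4) (by norm_num),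
    t5.eventually_lt_const (u := 1 + ε) (by linarith),
    t6.eventually_le_const (u := 0.09) (by norm_num), t7,
    t3.eventually_lt_const (u := 1 / 18) (by norm_num),
    t2.eventually_lt_const (u := 1 / 4) (by norm_num)] with k h1 h2 h3 h4 h5 h6 h7
  have hk : (100 : ℝ) ≤ k := by exact_mod_cast h1
  refine ⟨by omega, h2, h3, h4, ?_, by linarith, by linarith⟩
  have := Real.le_norm_self (Real.log k)
  rw [Real.norm_of_nonneg (show (0 : ℝ) ≤ k by linarith)] at h5
  linarith

lemma nae_second (k : ℕ) (hk : 3 ≤ k) (q r : ℝ)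
    (hq0 : 0 < q) (hq1 : q ≤ 1 / 4) (hqk : (2 : ℝ) ^ (k - 1) * q = 1)
    (hr0 : 0 < r) (hrq : r * q ≤ Real.log 2) (E6 : q * (k : ℝ) ^ 2 < 1 / 2)
    (hG0 : naeG k r q (1 / 2) = 0) :
    deriv (deriv (fun α => Real.exp (naeG k r q α))) (1 / 2) < 0 := by
  have hPpos : ∀ α ∈ Set.Ioo (0 : ℝ) 1, 0 < 1 - q * (2 - α ^ k - (1 - α) ^ k) := by
    intro α hα
    have h1 : 0 < α ^ k := pow_pos hα.1 k
    have h2 : 0 < (1 - α) ^ k := pow_pos (by linarith [hα.2]) k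
    nlinarith
  have hP1 : ∀ α : ℝ, HasDerivAt (fun α : ℝ => 1 - q * (2 - α ^ k - (1 - α) ^ k))
      (q * (k * α ^ (k - 1) - k * (1 - α) ^ (k - 1))) α := by
    intro α
    have := ((((hasDerivAt_pow k α).const_sub 2).sub
      (((hasDerivAt_id α).const_sub 1).pow k)).const_mul q).const_sub 1
    refine this.congr_deriv ?_
    simp; ring
  have hP2 : ∀ α : ℝ, HasDerivAt (fun α : ℝ => q * (k * α ^ (k - 1) - k * (1 - α) ^ (k - 1)))
      (q * k * (k - 1) * (α ^ (k - 2) + (1 - α) ^ (k - 2))) α := by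
    intro α
    have := (((hasDerivAt_pow (k - 1) α).const_mul (k : ℝ)).sub
      ((((hasDerivAt_id α).const_sub 1).pow (k - 1)).const_mul (k : ℝ))).const_mul q
    refine this.congr_deriv ?_
    have e : k - 1 - 1 = k - 2 := by omega
    rw [e, Nat.cast_sub (by omega)]
    simp; ring
  have hl1 : ∀ α ∈ Set.Ioo (0 : ℝ) 1, HasDerivAt (fun α : ℝ => Real.log (1 - α)) (-(1 - α)⁻¹) α := by
    intro α hα
    have := ((hasDerivAt_id α).const_sub 1).log (by simp; linarith [hα.2])
    refine this.congr_deriv ?_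
    simp; rw [neg_div, one_div]
  have hG1 : ∀ α ∈ Set.Ioo (0 : ℝ) 1, HasDerivAt (naeG k r q)
      (-Real.log α + Real.log (1 - α) + r * (q * (k * α ^ (k - 1) - k * (1 - α) ^ (k - 1)) /
        (1 - q * (2 - α ^ k - (1 - α) ^ k)))) α := by
    intro α hα
    have ha : α ≠ 0 := hα.1.ne'
    have hb : 1 - α ≠ 0 := by linarith [hα.2]
    have := ((((hasDerivAt_id α).mul (Real.hasDerivAt_log ha)).const_sub (-Real.log 2)).sub
      (((hasDerivAt_id α).const_sub 1).mul (hl1 α hα))).add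
      ((((hP1 α).log (hPpos α hα).ne').sub_const (2 * Real.log (1 - q))).const_mul r)
    refine this.congr_deriv ?_
    simp only [id]
    field_simp
    ring
  have hmem : (1 / 2 : ℝ) ∈ Set.Ioo (0 : ℝ) 1 := by constructor <;> norm_num
  have hev : deriv (fun α => Real.exp (naeG k r q α)) =ᶠ[nhds (1 / 2)] fun α =>
      Real.exp (naeG k r q α) *
      (-Real.log α + Real.log (1 - α) + r * (q * (k * α ^ (k - 1) - k * (1 - α) ^ (k - 1)) /
        (1 - q * (2 - α ^ k - (1 - α) ^ k)))) := by
    filter_upwards [isOpen_Ioo.mem_nhds hmem] with α hα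
    exact (hG1 α hα).exp.deriv
  rw [hev.deriv_eq]
  have h2 := (hG1 _ hmem).exp.mul (((Real.hasDerivAt_log (show (1 / 2 : ℝ) ≠ 0 by norm_num)).neg.add
    (hl1 _ hmem)).add ((((hP2 (1 / 2)).div (hP1 (1 / 2)) (hPpos _ hmem).ne')).const_mul r))
  have h3 := h2.deriv
  refine lt_of_eq_of_lt h3 ?_
  have e12 : (1 : ℝ) - 1 / 2 = 1 / 2 := by norm_num
  simp only [Pi.add_apply, Pi.neg_apply, Pi.div_apply, e12, hG0]
  have ek : (1 / 2 : ℝ) ^ k = q / 2 := by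
    have e3 : (2 : ℝ) ^ k = 2 * 2 ^ (k - 1) := by
      rw [← pow_succ']; congr 1; omega
    rw [one_div, inv_pow, inv_eq_iff_eq_inv, ← one_div, eq_div_iff (by positivity), e3]
    linear_combination hqk
  have ek2 : (1 / 2 : ℝ) ^ (k - 2) = 2 * q := by
    have : (1 / 2 : ℝ) ^ k = (1 / 2) ^ (k - 2) * (1 / 2) ^ 2 := by
      rw [← pow_add]; congr 1; omega
    rw [ek] at this
    linarith
  rw [ek, ek2]
  have eP : 1 - q * (2 - q / 2 - q / 2) = (1 - q) ^ 2 := by ring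
  rw [eP]
  simp only [sub_self, mul_zero, zero_div, Real.exp_zero, neg_add_cancel, add_zero,
    mul_zero, sub_zero]
  have hkR : (3 : ℝ) ≤ k := by exact_mod_cast hk
  have hq' : 0 < 1 - q := by linarith
  have key : r * (q * k * (k - 1) * (2 * q + 2 * q) * (1 - q) ^ 2 / ((1 - q) ^ 2) ^ 2) < 4 := by
    have e : r * (q * k * (k - 1) * (2 * q + 2 * q) * (1 - q) ^ 2 / ((1 - q) ^ 2) ^ 2) =
      4 * ((r * q) * (q * (k * (k - 1)))) / (1 - q) ^ 2 := by field_simp; ring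
    rw [e, div_lt_iff₀ (by positivity)]
    have h9 : 9 / 16 ≤ (1 - q) ^ 2 := by nlinarith
    have hl2' := Real.log_two_lt_d9
    have hA : q * (k * (k - 1)) ≤ 1 / 2 := by nlinarith
    have hA0 : 0 ≤ q * ((k : ℝ) * (k - 1)) := by
      have : (0 : ℝ) ≤ k - 1 := by linarith
      positivity
    have : (r * q) * (q * (k * (k - 1))) ≤ 0.7 * (1 / 2) := by
      apply mul_le_mul (by linarith) hA hA0 (by norm_num)
    linarith
  norm_num at key ⊢
  linarith

/-- For every ε > 0 there is k₀(ε) such that for all k ≥ k₀ and all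
0 < r ≤ 2^{k-1} ln 2 − (ln 2)/2 − (1+ε)/2, the function ℓ_r satisfies ℓ_r(1/2) = 1,
ℓ_r(α) < 1 for all α ∈ [0,1] with α ≠ 1/2, and ℓ_r''(1/2) < 0. -/
theorem naeL_max_at_half :
    ∀ ε : ℝ, 0 < ε → ∃ k₀ : ℕ, ∀ k : ℕ, k₀ ≤ k → ∀ r : ℝ, 0 < r →
      r ≤ (2 : ℝ) ^ (k - 1) * Real.log 2 - Real.log 2 / 2 - (1 + ε) / 2 →
      naeL k r (1 / 2) = 1 ∧
      (∀ α ∈ Set.Icc (0 : ℝ) 1, α ≠ 1 / 2 → naeL k r α < 1) ∧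
      deriv (deriv (naeL k r)) (1 / 2) < 0 := by
  intro ε hε
  obtain ⟨k₀, hk₀⟩ := Filter.eventually_atTop.1 (nae_eventually ε hε)
  refine ⟨k₀, fun k hk r hr0 hr => ?_⟩
  obtain ⟨hk3, hq1, E2, E3, E4, E5, E6⟩ := hk₀ k hk
  have hqk := naeq_mul k (by omega)
  have hq0 : 0 < (2 : ℝ) ^ (1 - (k : ℝ)) := by positivity
  have hex : ∀ α ∈ Set.Icc (0 : ℝ) 1,
      naeL k r α = Real.exp (naeG k r ((2 : ℝ) ^ (1 - (k : ℝ))) α) := by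
    intro α hα
    apply naeL_eq_exp k r α hα.1 hα.2 _ (by linarith)
    have h1 : 0 ≤ α ^ k := pow_nonneg hα.1 k
    have h2 : 0 ≤ (1 - α) ^ k := pow_nonneg (by linarith [hα.2]) k
    nlinarith
  have hhalf := naeq_eq k
  generalize (2 : ℝ) ^ (1 - (k : ℝ)) = q at *
  have hG0 : naeG k r q (1 / 2) = 0 := by
    unfold naeG
    have e12 : (1 : ℝ) - 1 / 2 = 1 / 2 := by norm_num
    have ek : (1 / 2 : ℝ) ^ k = q / 2 := by linarith
    have eP : 1 - q * (2 - q / 2 - q / 2) = (1 - q) ^ 2 := by ring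
    rw [e12, ek, eP, Real.log_pow, one_div, Real.log_inv]
    push_cast
    ring
  refine ⟨?_, ?_, ?_⟩
  · rw [hex _ (by constructor <;> norm_num), hG0, Real.exp_zero]
  · intro α hα hne
    rw [hex α hα, Real.exp_lt_one_iff]
    rcases lt_or_gt_of_ne hne with h | h
    · exact nae_main k hk3 q ε r α hε hq0 hq1 hqk hr0 hr E2 E3 E4 E5 hα.1 h
    · have hsym : naeG k r q α = naeG k r q (1 - α) := by
        unfold naeG
        rw [sub_sub_cancel]
        have : 2 - α ^ k - (1 - α) ^ k = 2 - (1 - α) ^ k - α ^ k := by ring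
        rw [this]
        ring
      rw [hsym]
      exact nae_main k hk3 q ε r (1 - α) hε hq0 hq1 hqk hr0 hr E2 E3 E4 E5
        (by linarith [hα.2]) (by linarith)
  · have hev : naeL k r =ᶠ[nhds (1 / 2)] fun α => Real.exp (naeG k r q α) := by
      filter_upwards [Icc_mem_nhds (show (0 : ℝ) < 1 / 2 by norm_num)
        (show (1 / 2 : ℝ) < 1 by norm_num)] with α hα
      exact hex α hα
    rw [hev.deriv.deriv_eq]
    have hrq : r * q ≤ Real.log 2 := by
      have h1 := mul_le_mul_of_nonneg_right hr hq0.le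
      have h2 : 0 < Real.log 2 := Real.log_pos (by norm_num)
      have h3 : 0 ≤ q * (Real.log 2 / 2 + (1 + ε) / 2) := by positivity
      have h4 : (2 ^ (k - 1) * Real.log 2 - Real.log 2 / 2 - (1 + ε) / 2) * q =
        Real.log 2 - q * (Real.log 2 / 2 + (1 + ε) / 2) := by
        linear_combination Real.log 2 * hqk
      linarith
    exact nae_second k hk3 q r hq0 hq1 hqk hr0 hrq E6 hG0
end
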